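/- arXiv:1609.04596 — 2 statements merged into one kernel-verified Lean document; each statement's English description precedes it below -/
import Mathlib

section
/- Let m ≥ 1, θ > 1, and let f₁, f₂ : ℝ^m → ℝ be locally Lipschitz continuous and bounded from below. Then for every t ∈ [0,1], λ*(t f₁ + (1−t) f₂) ≥ t λ*(f₁) + (1−t) λ*(f₂); i.e. f ↦ λ*(f) is concave. -/
open Filter

noncomputable def lap {m : ℕ} (φ : EuclideanSpace ℝ (Fin m) → ℝ)
    (y : EuclideanSpace ℝ (Fin m)) : ℝ :=
  ∑ i : Fin m, iteratedFDeriv ℝ 2 φ y ![EuclideanSpace.single i 1, EuclideanSpace.single i 1]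

def IsSubsolution {m : ℕ} (θ : ℝ) (f : EuclideanSpace ℝ (Fin m) → ℝ) (lam : ℝ)
    (φ : EuclideanSpace ℝ (Fin m) → ℝ) : Prop :=
  ContDiff ℝ 2 φ ∧
    ∀ y, -(1/2) * lap φ y + (1/θ) * ‖gradient φ y‖ ^ θ ≤ f y - lam

def IsSupersolution {m : ℕ} (θ : ℝ) (f : EuclideanSpace ℝ (Fin m) → ℝ) (lam : ℝ)
    (φ : EuclideanSpace ℝ (Fin m) → ℝ) : Prop :=
  ContDiff ℝ 2 φ ∧
    ∀ y, -(1/2) * lap φ y + (1/θ) * ‖gradient φ y‖ ^ θ ≥ f y - lam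

def IsSolution {m : ℕ} (θ : ℝ) (f : EuclideanSpace ℝ (Fin m) → ℝ) (lam : ℝ)
    (φ : EuclideanSpace ℝ (Fin m) → ℝ) : Prop :=
  ContDiff ℝ 2 φ ∧
    ∀ y, -(1/2) * lap φ y + (1/θ) * ‖gradient φ y‖ ^ θ = f y - lam

noncomputable def lambdaStar {m : ℕ} (θ : ℝ) (f : EuclideanSpace ℝ (Fin m) → ℝ) : ℝ :=
  sSup {lam : ℝ | ∃ φ, IsSubsolution θ f lam φ}

def H0 {m : ℕ} (f : EuclideanSpace ℝ (Fin m) → ℝ) (α f₀ : ℝ) : Prop :=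
  LocallyLipschitz f ∧ BddBelow (Set.range f) ∧
    ∀ y, DifferentiableAt ℝ f y →
      (1 ≤ α → ‖gradient f y‖ ≤ f₀ * (1 + ‖y‖ ^ (α - 1))) ∧
      (α < 1 → ‖gradient f y‖ ≤ f₀)

def H1 {m : ℕ} (f : EuclideanSpace ℝ (Fin m) → ℝ) (α f₀ : ℝ) : Prop :=
  ∀ y, f₀⁻¹ * (‖y‖ ^ α + 1) ≤ f y ∧ f y ≤ f₀ * (‖y‖ ^ α + 1)

def MemPhi {m : ℕ} (γ : ℝ) (v : EuclideanSpace ℝ (Fin m) → ℝ) : Prop :=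
  ContDiff ℝ 2 v ∧ ∃ c > 1, ∀ y, c⁻¹ * ‖y‖ ^ γ - c ≤ v y ∧ v y ≤ c * (1 + ‖y‖ ^ γ)

def Coercive {m : ℕ} (f : EuclideanSpace ℝ (Fin m) → ℝ) : Prop :=
  Tendsto f (cocompact (EuclideanSpace ℝ (Fin m))) atTop


theorem aux_one_dim (A A' : ℝ → ℝ) (a'' s b : ℝ) (n : ℕ) (hs : 0 < s)
    (hA : ∀ τ, HasDerivAt A (A' τ) τ) (hA' : HasDerivAt A' a'' 0)
    (hmax : IsLocalMax (fun τ => A τ - ((s - 2 * b * τ - τ ^ 2)⁻¹) ^ (n + 1)) 0) :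
    A' 0 = 2 * (n + 1) * b * s⁻¹ ^ (n + 2) ∧
    a'' ≤ 2 * (n + 1) * s⁻¹ ^ (n + 2) + 4 * (n + 1) * (n + 2) * b ^ 2 * s⁻¹ ^ (n + 3) := by
  set p : ℝ → ℝ := fun τ => s - 2 * b * τ - τ ^ 2 with hp
  have hpd : ∀ τ, HasDerivAt p (- 2 * b - 2 * τ) τ := by
    intro τ
    have := (((hasDerivAt_id τ).const_mul (2 * b)).const_sub s).sub ((hasDerivAt_id τ).pow 2)
    refine this.congr_deriv ?_
    simp
  have hpc : Continuous p := by fun_prop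
  have hp0 : p 0 = s := by simp [hp]
  have hpos : ∀ᶠ τ in nhds (0:ℝ), 0 < p τ :=
    hpc.continuousAt.eventually (by rw [hp0]; exact lt_mem_nhds hs)
  have hpow : ∀ (j : ℕ) τ, 0 < p τ → HasDerivAt (fun τ => (p τ)⁻¹ ^ (j + 1))
      ((j + 1) * (2 * b + 2 * τ) * (p τ)⁻¹ ^ (j + 2)) τ := by
    intro j τ h
    have := ((hpd τ).inv h.ne').pow (j + 1)
    refine this.congr_deriv ?_
    push_cast
    simp
    field_simp
    ring
  set g : ℝ → ℝ := fun τ => A τ - (p τ)⁻¹ ^ (n + 1) with hg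
  have hgd : ∀ τ, 0 < p τ →
      HasDerivAt g (A' τ - (n + 1) * (2 * b + 2 * τ) * (p τ)⁻¹ ^ (n + 2)) τ :=
    fun τ h => (hA τ).sub (hpow n τ h)
  have hg1 : deriv g =ᶠ[nhds 0] fun τ => A' τ - (n + 1) * (2 * b + 2 * τ) * (p τ)⁻¹ ^ (n + 2) := by
    filter_upwards [hpos] with τ h using (hgd τ h).deriv
  have h0 : 0 < p 0 := by rw [hp0]; exact hs
  have hg2 : HasDerivAt (deriv g) (a'' - (2 * (n + 1) * s⁻¹ ^ (n + 2)
      + 4 * (n + 1) * (n + 2) * b ^ 2 * s⁻¹ ^ (n + 3))) 0 := by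
    refine HasDerivAt.congr_of_eventuallyEq ?_ hg1
    have h1 : HasDerivAt (fun τ : ℝ => ((n:ℝ) + 1) * (2 * b + 2 * τ)) ((n + 1) * 2) 0 := by
      have := (((hasDerivAt_id (0:ℝ)).const_mul 2).const_add (2 * b)).const_mul ((n:ℝ) + 1)
      simpa using this
    have := hA'.sub (h1.mul (hpow (n + 1) 0 h0))
    refine this.congr_deriv ?_
    rw [hp0]
    push_cast
    ring
  have hd0 : deriv g 0 = 0 := hmax.deriv_eq_zero
  refine ⟨?_, ?_⟩
  · rw [hg1.eq_of_nhds] at hd0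
    simp only [hp0] at hd0
    linarith
  · by_contra! hlt
    have hmin : IsLocalMin g 0 := isLocalMin_of_deriv_deriv_pos (by rw [hg2.deriv]; linarith) hd0
      (hgd 0 h0).continuousAt
    have hconst : g =ᶠ[nhds 0] fun _ => g 0 := by
      filter_upwards [hmin, hmax] with x h1 h2 using le_antisymm h2 h1
    have h3 : deriv g =ᶠ[nhds 0] fun _ => 0 := by
      have := hconst.deriv
      simpa using this
    have h4 := h3.deriv_eq
    rw [hg2.deriv] at h4
    rw [deriv_const] at h4
    linarith

theorem aux_exists_max {m : ℕ} (φ : EuclideanSpace ℝ (Fin m) → ℝ) (hφ : Continuous φ) (n : ℕ) :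
    ∃ y, ‖y‖ < 1 ∧ IsLocalMax (fun x => φ x - ((1 - ‖x‖ ^ 2)⁻¹) ^ (n + 1)) y := by
  set K : Set (EuclideanSpace ℝ (Fin m)) :=
    Metric.closedBall 0 1 ∩ {x | 1 ≤ (1 - ‖x‖ ^ 2) ^ (n + 1) * (φ x - φ 0 + 1)} with hK
  have hKc : IsCompact K := (isCompact_closedBall 0 1).inter_right
    (isClosed_le continuous_const (by fun_prop))
  have h0K : (0 : EuclideanSpace ℝ (Fin m)) ∈ K := by simp [hK]
  have hKb : ∀ x ∈ K, ‖x‖ < 1 := by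
    rintro x ⟨h1, h2⟩
    have h1 : ‖x‖ ≤ 1 := by simpa using h1
    refine lt_of_le_of_ne h1 fun h => ?_
    simp [h] at h2
    linarith
  have hcont : ContinuousOn (fun x => φ x - ((1 - ‖x‖ ^ 2)⁻¹) ^ (n + 1)) K := by
    refine hφ.continuousOn.sub (ContinuousOn.pow (ContinuousOn.inv₀ (by fun_prop) ?_) _)
    intro x hx
    have := hKb x hx
    have := norm_nonneg x
    nlinarith
  obtain ⟨y, hyK, hy⟩ := hKc.exists_isMaxOn ⟨0, h0K⟩ hcont
  refine ⟨y, hKb y hyK, ?_⟩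
  have hball : ∀ᶠ x in nhds y, ‖x‖ < 1 :=
    continuous_norm.continuousAt.eventually (gt_mem_nhds (hKb y hyK))
  filter_upwards [hball] with x hx
  by_cases hxK : x ∈ K
  · exact hy hxK
  · refine le_trans ?_ (hy h0K)
    have hs : 0 < 1 - ‖x‖ ^ 2 := by
      have := norm_nonneg x
      nlinarith
    have hlt : (1 - ‖x‖ ^ 2) ^ (n + 1) * (φ x - φ 0 + 1) < 1 := by
      by_contra! h
      exact hxK ⟨by simpa using hx.le, h⟩
    have hp : 0 < (1 - ‖x‖ ^ 2) ^ (n + 1) := pow_pos hs _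
    have : φ x - φ 0 + 1 < ((1 - ‖x‖ ^ 2) ^ (n + 1))⁻¹ := by
      rw [← one_div, lt_div_iff₀ hp]; linarith
    simp only [inv_pow]
    simp
    linarith

theorem aux_est (θ : ℝ) (hθ : 1 < θ) (n m : ℕ) (hn : 2 ≤ ((n:ℝ) + 2) * (θ - 1)) :
    ∃ C : ℝ, ∀ r : ℝ, 0 ≤ r → r < 1 →
      (1/2) * (m * (2 * (n + 1) * (1 - r ^ 2)⁻¹ ^ (n + 2)) +
        4 * (n + 1) * (n + 2) * r ^ 2 * (1 - r ^ 2)⁻¹ ^ (n + 3))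
      - (1/θ) * (2 * (n + 1) * (1 - r ^ 2)⁻¹ ^ (n + 2) * r) ^ θ ≤ C := by
  set C1 : ℝ := m * (n + 1) + 2 * (n + 1) * (n + 2) with hC1
  have hC1p : 0 ≤ C1 := by positivity
  refine ⟨C1 * (θ * C1) ^ (n + 3) + C1 * 2 ^ (n + 3), fun r hr0 hr1 => ?_⟩
  have hs : 0 < 1 - r ^ 2 := by nlinarith
  set u := (1 - r ^ 2)⁻¹ with hu
  have hu1 : 1 ≤ u := (one_le_inv₀ hs).2 (by nlinarith)
  have hA : (1/2) * (m * (2 * (n + 1) * u ^ (n + 2)) +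
        4 * (n + 1) * (n + 2) * r ^ 2 * u ^ (n + 3)) ≤ C1 * u ^ (n + 3) := by
    have h1 : u ^ (n + 2) ≤ u ^ (n + 3) := pow_le_pow_right₀ hu1 (by omega)
    have h2 : r ^ 2 * u ^ (n + 3) ≤ 1 * u ^ (n + 3) := by gcongr; nlinarith
    have h3 := mul_le_mul_of_nonneg_left h1 (show (0:ℝ) ≤ m * (n + 1) by positivity)
    have h4 := mul_le_mul_of_nonneg_left h2 (show (0:ℝ) ≤ 2 * (n + 1) * (n + 2) by positivity)
    rw [hC1]
    nlinarith
  have hθ0 : 0 < θ := by linarith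
  have hgn : 0 ≤ (1/θ) * (2 * (n + 1) * u ^ (n + 2) * r) ^ θ := by positivity
  have hP1 : 0 ≤ C1 * (θ * C1) ^ (n + 3) := by positivity
  have hP2 : 0 ≤ C1 * 2 ^ (n + 3) := by positivity
  rcases lt_or_ge r (1/2) with hr | hr
  · have : u ≤ 2 := by
      rw [hu]; exact inv_le_of_inv_le₀ (by norm_num) (by nlinarith)
    have : C1 * u ^ (n + 3) ≤ C1 * 2 ^ (n + 3) := by gcongr
    linarith
  · rcases lt_or_ge u (θ * C1) with h | h
    · have : C1 * u ^ (n + 3) ≤ C1 * (θ * C1) ^ (n + 3) := by gcongr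
      linarith
    · have h5 : u ^ (n + 4) ≤ (2 * (n + 1) * u ^ (n + 2) * r) ^ θ := by
        have e1 : u ^ (n + 2) ≤ 2 * (n + 1) * u ^ (n + 2) * r := by
          have : 0 < u ^ (n + 2) := by positivity
          have h6 : 1 ≤ 2 * ((n:ℝ) + 1) * r := by
            have : (0:ℝ) ≤ n := by positivity
            nlinarith
          nlinarith
        calc u ^ (n + 4) = u ^ ((n + 4 : ℕ) : ℝ) := (Real.rpow_natCast _ _).symm
          _ ≤ u ^ (((n + 2 : ℕ) : ℝ) * θ) := by
            apply Real.rpow_le_rpow_of_exponent_le hu1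
            push_cast; linarith
          _ = (u ^ (n + 2)) ^ θ := by rw [Real.rpow_mul (by positivity), Real.rpow_natCast]
          _ ≤ _ := Real.rpow_le_rpow (by positivity) e1 hθ0.le
      have h7 : C1 * u ^ (n + 3) ≤ (1/θ) * u ^ (n + 4) := by
        rw [one_div, inv_mul_eq_div, le_div_iff₀ hθ0, pow_succ u (n + 3)]
        have : 0 < u ^ (n + 3) := by positivity
        nlinarith
      have h8 : (1/θ) * u ^ (n + 4) ≤ (1/θ) * (2 * (n + 1) * u ^ (n + 2) * r) ^ θ := by gcongr
      linarith

theorem aux_norm_line {m : ℕ} (y : EuclideanSpace ℝ (Fin m)) (i : Fin m) (τ : ℝ) :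
    ‖y + τ • EuclideanSpace.single i (1:ℝ)‖ ^ 2 = ‖y‖ ^ 2 + 2 * y i * τ + τ ^ 2 := by
  rw [norm_add_sq_real, inner_smul_right, EuclideanSpace.inner_single_right, norm_smul]
  simp
  ring

theorem aux_grad {m : ℕ} (φ : EuclideanSpace ℝ (Fin m) → ℝ) (y : EuclideanSpace ℝ (Fin m))
    (i : Fin m) : gradient φ y i = fderiv ℝ φ y (EuclideanSpace.single i 1) := by
  have h : inner ℝ (gradient φ y) (EuclideanSpace.single i 1) =
      fderiv ℝ φ y (EuclideanSpace.single i 1) := by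
    unfold gradient
    exact InnerProductSpace.toDual_symm_apply
  rw [← h, EuclideanSpace.inner_single_right]
  simp

theorem aux_bdd {m : ℕ} (θ : ℝ) (hθ : 1 < θ) (f : EuclideanSpace ℝ (Fin m) → ℝ)
    (hf : Continuous f) : BddAbove {lam : ℝ | ∃ φ, IsSubsolution θ f lam φ} := by
  obtain ⟨n, hn⟩ := exists_nat_ge (2 / (θ - 1))
  have hn : 2 ≤ ((n:ℝ) + 2) * (θ - 1) := by
    rw [div_le_iff₀ (by linarith)] at hn
    nlinarith
  obtain ⟨C, hC⟩ := aux_est θ hθ n m hn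
  obtain ⟨M, hM⟩ := (isCompact_closedBall (0 : EuclideanSpace ℝ (Fin m)) 1).bddAbove_image
    hf.continuousOn
  refine ⟨M + C, ?_⟩
  rintro lam ⟨φ, hφ, hsub⟩
  obtain ⟨y, hy1, hmax⟩ := aux_exists_max φ hφ.continuous n
  have hs : 0 < 1 - ‖y‖ ^ 2 := by
    have := norm_nonneg y
    nlinarith
  set u := (1 - ‖y‖ ^ 2)⁻¹ with hu
  have hφ1 : Differentiable ℝ φ := hφ.differentiable (by norm_num)
  have hφ2 : Differentiable ℝ (fderiv ℝ φ) :=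
    (hφ.fderiv_right (m := 1) (by norm_num)).differentiable (by norm_num)
  have key : ∀ i : Fin m, gradient φ y i = 2 * (n + 1) * y i * u ^ (n + 2) ∧
      iteratedFDeriv ℝ 2 φ y ![EuclideanSpace.single i 1, EuclideanSpace.single i 1] ≤
        2 * (n + 1) * u ^ (n + 2) + 4 * (n + 1) * (n + 2) * (y i) ^ 2 * u ^ (n + 3) := by
    intro i
    set e : EuclideanSpace ℝ (Fin m) := EuclideanSpace.single i 1 with he
    have hl : ∀ τ : ℝ, HasDerivAt (fun τ : ℝ => y + τ • e) e τ := by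
      intro τ
      simpa using ((hasDerivAt_id τ).smul_const e).const_add y
    have hA : ∀ τ : ℝ, HasDerivAt (fun τ : ℝ => φ (y + τ • e)) (fderiv ℝ φ (y + τ • e) e) τ :=
      fun τ => (hφ1 _).hasFDerivAt.comp_hasDerivAt τ (hl τ)
    have hA' : HasDerivAt (fun τ : ℝ => fderiv ℝ φ (y + τ • e) e)
        (fderiv ℝ (fderiv ℝ φ) y e e) 0 := by
      have h1 : HasFDerivAt (fderiv ℝ φ) (fderiv ℝ (fderiv ℝ φ) y) (y + (0:ℝ) • e) := by
        simpa using (hφ2 y).hasFDerivAt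
      have h2 := h1.comp_hasDerivAt (0:ℝ) (hl 0)
      simpa using h2.clm_apply (hasDerivAt_const (0:ℝ) e)
    have hlm : IsLocalMax (fun τ : ℝ => φ (y + τ • e) -
        ((1 - ‖y‖ ^ 2) - 2 * (y i) * τ - τ ^ 2)⁻¹ ^ (n + 1)) 0 := by
      have hc : Tendsto (fun τ : ℝ => y + τ • e) (nhds 0) (nhds y) := by
        have := (hl 0).continuousAt.tendsto
        simpa using this
      have := hc.eventually hmax
      filter_upwards [this] with τ h
      rw [aux_norm_line] at h
      have e1 : (1 - ‖y‖ ^ 2) - 2 * (y i) * τ - τ ^ 2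
        = 1 - (‖y‖ ^ 2 + 2 * y i * τ + τ ^ 2) := by ring
      rw [e1]
      simpa using h
    obtain ⟨k1, k2⟩ := aux_one_dim _ _ _ _ _ n hs hA hA' hlm
    rw [← hu] at k1 k2
    simp only [zero_smul, add_zero] at k1
    refine ⟨?_, ?_⟩
    · rw [aux_grad]
      exact k1
    · rw [iteratedFDeriv_two_apply]
      exact k2
  have hu0 : 0 < u := by positivity
  have hgrad : gradient φ y = (2 * (n + 1) * u ^ (n + 2)) • y := by
    ext i
    rw [(key i).1]
    simp
    ring
  have hgn : ‖gradient φ y‖ = 2 * (n + 1) * u ^ (n + 2) * ‖y‖ := by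
    rw [hgrad, norm_smul, Real.norm_of_nonneg (by positivity)]
  have hlap : lap φ y ≤ m * (2 * (n + 1) * u ^ (n + 2)) +
        4 * (n + 1) * (n + 2) * ‖y‖ ^ 2 * u ^ (n + 3) := by
    unfold lap
    refine (Finset.sum_le_sum fun i _ => (key i).2).trans (le_of_eq ?_)
    rw [Finset.sum_add_distrib, ← Finset.sum_mul (f := fun i => 4 * ((n:ℝ) + 1) * (n + 2) * (y i) ^ 2),
      EuclideanSpace.real_norm_sq_eq,
      Finset.sum_const, Finset.card_univ, Fintype.card_fin, nsmul_eq_mul, Finset.mul_sum]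
  have h1 := hsub y
  rw [hgn] at h1
  have h2 := hC ‖y‖ (norm_nonneg y) hy1
  have h3 : f y ≤ M := hM ⟨y, by simpa using hy1.le, rfl⟩
  linarith

theorem aux_nonempty {m : ℕ} (θ : ℝ) (hθ : 1 < θ) (f : EuclideanSpace ℝ (Fin m) → ℝ)
    (hf : BddBelow (Set.range f)) : {lam : ℝ | ∃ φ, IsSubsolution θ f lam φ}.Nonempty := by
  obtain ⟨c, hc⟩ := hf
  refine ⟨c, fun _ => 0, contDiff_const, fun y => ?_⟩
  have h1 : lap (fun _ : EuclideanSpace ℝ (Fin m) => (0:ℝ)) y = 0 := by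
    simp [lap, iteratedFDeriv_two_apply]
  have h2 : gradient (fun _ : EuclideanSpace ℝ (Fin m) => (0:ℝ)) y = 0 := by
    simp [gradient]
  have h3 := hc ⟨y, rfl⟩
  rw [h1, h2, norm_zero, Real.zero_rpow (by linarith)]
  linarith

theorem aux_convex {m : ℕ} (θ : ℝ) (hθ : 1 < θ) (f₁ f₂ : EuclideanSpace ℝ (Fin m) → ℝ)
    (t : ℝ) (ht0 : 0 ≤ t) (ht1 : t ≤ 1) (l₁ l₂ : ℝ) (φ₁ φ₂ : EuclideanSpace ℝ (Fin m) → ℝ)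
    (h₁ : IsSubsolution θ f₁ l₁ φ₁) (h₂ : IsSubsolution θ f₂ l₂ φ₂) :
    IsSubsolution θ (fun y => t * f₁ y + (1 - t) * f₂ y) (t * l₁ + (1 - t) * l₂)
      (t • φ₁ + (1 - t) • φ₂) := by
  obtain ⟨c1, h1⟩ := h₁
  obtain ⟨c2, h2⟩ := h₂
  refine ⟨(c1.const_smul t).add (c2.const_smul (1 - t)), fun y => ?_⟩
  have d1 : DifferentiableAt ℝ φ₁ y := c1.differentiable (by norm_num) y
  have d2 : DifferentiableAt ℝ φ₂ y := c2.differentiable (by norm_num) y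
  have hlap : lap (t • φ₁ + (1 - t) • φ₂) y = t * lap φ₁ y + (1 - t) * lap φ₂ y := by
    unfold lap
    rw [Finset.mul_sum, Finset.mul_sum, ← Finset.sum_add_distrib]
    refine Finset.sum_congr rfl fun i _ => ?_
    have s1 : ContDiff ℝ 2 (t • φ₁) := c1.const_smul t
    have s2 : ContDiff ℝ 2 ((1 - t) • φ₂) := c2.const_smul (1 - t)
    rw [iteratedFDeriv_add_apply s1.contDiffAt s2.contDiffAt,
      iteratedFDeriv_const_smul_apply c1.contDiffAt, iteratedFDeriv_const_smul_apply c2.contDiffAt]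
    simp
  have hgrad : gradient (t • φ₁ + (1 - t) • φ₂) y
      = t • gradient φ₁ y + (1 - t) • gradient φ₂ y := by
    unfold gradient
    rw [fderiv_add (d1.const_smul t) (d2.const_smul (1 - t)), fderiv_const_smul d1,
      fderiv_const_smul d2]
    simp
  have hn : ‖gradient (t • φ₁ + (1 - t) • φ₂) y‖
      ≤ t * ‖gradient φ₁ y‖ + (1 - t) * ‖gradient φ₂ y‖ := by
    rw [hgrad]
    refine (norm_add_le _ _).trans (le_of_eq ?_)
    rw [norm_smul, norm_smul, Real.norm_of_nonneg ht0, Real.norm_of_nonneg (by linarith)]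
  have hr := Real.rpow_le_rpow (norm_nonneg _) hn (show 0 ≤ θ by linarith)
  have hc := (convexOn_rpow hθ.le).2 (norm_nonneg (gradient φ₁ y)) (norm_nonneg (gradient φ₂ y))
    ht0 (show 0 ≤ 1 - t by linarith) (by ring)
  simp only [smul_eq_mul] at hc
  have hh := mul_le_mul_of_nonneg_left (hr.trans hc) (show 0 ≤ 1/θ by positivity)
  have e1 := mul_le_mul_of_nonneg_left (h1 y) ht0
  have e2 := mul_le_mul_of_nonneg_left (h2 y) (show 0 ≤ 1 - t by linarith)
  rw [hlap]
  linarith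

theorem stmt6 (m : ℕ) (hm : 1 ≤ m) (θ : ℝ) (hθ : 1 < θ)
    (f₁ f₂ : EuclideanSpace ℝ (Fin m) → ℝ)
    (hf₁ : LocallyLipschitz f₁) (hbd₁ : BddBelow (Set.range f₁))
    (hf₂ : LocallyLipschitz f₂) (hbd₂ : BddBelow (Set.range f₂))
    (t : ℝ) (ht0 : 0 ≤ t) (ht1 : t ≤ 1) :
    t * lambdaStar θ f₁ + (1 - t) * lambdaStar θ f₂ ≤
      lambdaStar θ (fun y => t * f₁ y + (1 - t) * f₂ y) := by
  have hb := aux_bdd θ hθ (fun y => t * f₁ y + (1 - t) * f₂ y)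
    ((continuous_const.mul hf₁.continuous).add (continuous_const.mul hf₂.continuous))
  have hs : 0 ≤ 1 - t := by linarith
  unfold lambdaStar
  refine le_of_forall_pos_le_add fun ε hε => ?_
  obtain ⟨l₁, ⟨φ₁, h₁⟩, hl₁⟩ := exists_lt_of_lt_csSup (aux_nonempty θ hθ f₁ hbd₁)
    (sub_lt_self _ hε)
  obtain ⟨l₂, ⟨φ₂, h₂⟩, hl₂⟩ := exists_lt_of_lt_csSup (aux_nonempty θ hθ f₂ hbd₂)
    (sub_lt_self _ hε)
  have := le_csSup hb ⟨_, aux_convex θ hθ f₁ f₂ t ht0 ht1 l₁ l₂ φ₁ φ₂ h₁ h₂⟩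
  have e1 := mul_le_mul_of_nonneg_left hl₁.le ht0
  have e2 := mul_le_mul_of_nonneg_left hl₂.le hs
  linarith
end

section
/- Let m ≥ 1, θ > 1, and let f : ℝ^m → ℝ be locally Lipschitz continuous and coercive, i.e. f(x) → +∞ as |x| → +∞. Then there exists a solution (λ, φ) of the ergodic problem (EP) such that φ is bounded from below on ℝ^m. -/
open Filter

open Filter

open scoped Topology
set_option maxSynthPendingDepth 3

abbrev EE (m : ℕ) := EuclideanSpace ℝ (Fin m)
abbrev ED (m : ℕ) := EuclideanSpace ℝ (Fin m) →L[ℝ] ℝ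

/-- trace of a bilinear form -/
noncomputable def trc {m : ℕ} (S : EE m →L[ℝ] ED m) : ℝ :=
  ∑ i : Fin m, S (EuclideanSpace.single i 1) (EuclideanSpace.single i 1)

noncomputable def Lc {m : ℕ} (φ : EE m → ℝ) (y : EE m) : ℝ :=
  trc (fderiv ℝ (fderiv ℝ φ) y)

lemma lap_eq_Lc {m : ℕ} (φ : EE m → ℝ) (y : EE m) : lap φ y = Lc φ y := by
  unfold lap Lc trc
  refine Finset.sum_congr rfl fun i _ => ?_
  rw [iteratedFDeriv_two_apply]
  simp

lemma norm_gradient_eq {m : ℕ} (φ : EE m → ℝ) (y : EE m) :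
    ‖gradient φ y‖ = ‖fderiv ℝ φ y‖ := by
  unfold gradient
  simp

lemma trc_add {m : ℕ} (S T : EE m →L[ℝ] ED m) : trc (S + T) = trc S + trc T := by
  simp [trc, Finset.sum_add_distrib]

lemma trc_sub {m : ℕ} (S T : EE m →L[ℝ] ED m) : trc (S - T) = trc S - trc T := by
  simp [trc, Finset.sum_sub_distrib]

lemma trc_neg {m : ℕ} (S : EE m →L[ℝ] ED m) : trc (-S) = - trc S := by
  simp [trc]

lemma trc_smul {m : ℕ} (c : ℝ) (S : EE m →L[ℝ] ED m) : trc (c • S) = c * trc S := by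
  simp [trc, Finset.mul_sum]

lemma single_norm {m : ℕ} (i : Fin m) : ‖(EuclideanSpace.single i 1 : EE m)‖ = 1 := by simp

lemma trc_le {m : ℕ} (S : EE m →L[ℝ] ED m) (c : ℝ) (h : ∀ a, S a a ≤ c * ‖a‖ ^ 2) :
    trc S ≤ m * c := by
  unfold trc
  calc _ ≤ ∑ i : Fin m, c := Finset.sum_le_sum fun i _ => by
        have := h (EuclideanSpace.single i 1)
        rw [single_norm] at this; simpa using this
    _ = m * c := by simp

/-- second order necessary conditions at a local maximum -/
lemma max_jet {F : Type*} [NormedAddCommGroup F] [NormedSpace ℝ F] {G : F → ℝ}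
    {G' : F → F →L[ℝ] ℝ} {S : F →L[ℝ] F →L[ℝ] ℝ} {x : F}
    (h1 : ∀ᶠ y in 𝓝 x, HasFDerivAt G (G' y) y) (h2 : HasFDerivAt G' S x) (hmax : IsLocalMax G x) :
    G' x = 0 ∧ ∀ a, S a a ≤ 0 := by
  have h0 : G' x = 0 := hmax.hasFDerivAt_eq_zero h1.self_of_nhds
  refine ⟨h0, fun a => ?_⟩
  by_contra hpos
  push Not at hpos
  set ℓ : ℝ → F := fun t => x + t • a with hℓ
  have hℓc : Continuous ℓ := by fun_prop
  have hℓ0 : ℓ 0 = x := by simp [hℓ]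
  have hℓd : ∀ t, HasDerivAt ℓ a t := fun t => by
    have := ((hasDerivAt_id t).smul_const a).const_add x
    rw [one_smul] at this
    exact this
  have hℓt : Tendsto ℓ (𝓝 0) (𝓝 x) := by
    have := hℓc.tendsto 0; rwa [hℓ0] at this
  have e1 : ∀ᶠ t in 𝓝 (0:ℝ), HasDerivAt (G ∘ ℓ) (G' (ℓ t) a) t := by
    filter_upwards [hℓt.eventually h1] with t ht
    exact ht.comp_hasDerivAt t (hℓd t)
  have e2 : deriv (G ∘ ℓ) =ᶠ[𝓝 0] fun t => G' (ℓ t) a := by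
    filter_upwards [e1] with t ht using ht.deriv
  have e3 : HasDerivAt (fun t => G' (ℓ t) a) (S a a) 0 := by
    have h2' : HasFDerivAt G' S (ℓ 0) := by rwa [hℓ0]
    have := (h2'.comp_hasDerivAt (0:ℝ) (hℓd 0))
    exact (this.clm_apply (hasDerivAt_const (0:ℝ) a)).congr_deriv (by simp)
  have e4 : deriv (deriv (G ∘ ℓ)) 0 = S a a := by
    rw [e2.deriv_eq]; exact e3.deriv
  have hd0 : deriv (G ∘ ℓ) 0 = 0 := by
    rw [e2.self_of_nhds]; simp only [hℓ0, h0]; simp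
  have hmin : IsLocalMin (G ∘ ℓ) 0 :=
    isLocalMin_of_deriv_deriv_pos (by rw [e4]; exact hpos) hd0 e1.self_of_nhds.continuousAt
  have hmax' : IsLocalMax (G ∘ ℓ) 0 := by
    have := hℓt.eventually hmax
    filter_upwards [this] with t ht
    simpa [hℓ0] using ht
  have hc : (G ∘ ℓ) =ᶠ[𝓝 0] fun _ => (G ∘ ℓ) 0 := by
    filter_upwards [hmin, hmax'] with t h1 h2 using le_antisymm h2 h1
  have hc' : deriv (G ∘ ℓ) =ᶠ[𝓝 0] fun _ => (0:ℝ) := by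
    have := hc.deriv
    filter_upwards [this] with t ht
    rw [ht]; simp
  have : deriv (deriv (G ∘ ℓ)) 0 = 0 := by
    rw [hc'.deriv_eq]; simp
  linarith

lemma C2_fderiv {F : Type*} [NormedAddCommGroup F] [NormedSpace ℝ F] {u : F → ℝ}
    (hu : ContDiff ℝ 2 u) : (∀ y, HasFDerivAt u (fderiv ℝ u y) y) ∧
    (∀ y, HasFDerivAt (fderiv ℝ u) (fderiv ℝ (fderiv ℝ u) y) y) ∧ ContDiff ℝ 1 (fderiv ℝ u) := by
  have h1 : ContDiff ℝ 1 (fderiv ℝ u) := hu.fderiv_right (by norm_num)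
  refine ⟨fun y => (hu.differentiable (by norm_num) y).hasFDerivAt, fun y =>
    (h1.differentiable (by norm_num) y).hasFDerivAt, h1⟩

noncomputable def inSL (m : ℕ) : EE m →L[ℝ] ED m := innerSL ℝ

lemma inSL_apply {m : ℕ} (x y : EE m) : inSL m x y = inner ℝ x y := rfl

lemma inSL_norm {m : ℕ} (x : EE m) : ‖inSL m x‖ = ‖x‖ := innerSL_apply_norm ℝ x

lemma hasFDerivAt_sqdist {m : ℕ} (x0 y : EE m) :
    HasFDerivAt (fun y : EE m => ‖y - x0‖ ^ 2) ((2:ℝ) • inSL m (y - x0)) y := by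
  have := (hasStrictFDerivAt_norm_sq (y - x0)).hasFDerivAt.comp y ((hasFDerivAt_id y).sub_const x0)
  refine this.congr_fderiv ?_
  ext a; simp [two_smul, inSL_apply]

lemma hasFDerivAt_innerSL {m : ℕ} (x0 y : EE m) :
    HasFDerivAt (fun y : EE m => (inSL m (y - x0) : ED m)) (inSL m) y := by
  have := ((inSL m : EE m →L[ℝ] ED m).hasFDerivAt (x := y - x0)).comp y
    ((hasFDerivAt_id y).sub_const x0)
  exact this

/-- approximate maximum principle -/
lemma approx_max {m : ℕ} {u : EE m → ℝ} (hu : ContDiff ℝ 2 u) {B : ℝ} (hB : ∀ x, u x ≤ B)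
    (x0 : EE m) {η : ℝ} (hη : 0 < η) :
    ∃ x, u x0 ≤ u x ∧ ‖fderiv ℝ u x‖ ≤ η ∧ Lc u x ≤ η := by
  obtain ⟨h1, h2, -⟩ := C2_fderiv hu
  set M := B - u x0 with hM
  have hM0 : 0 ≤ M := by have := hB x0; linarith
  obtain ⟨ε, hε, hε1, hε2⟩ : ∃ ε > 0, 4 * (ε * M) ≤ η ^ 2 ∧ 2 * m * ε ≤ η := by
    refine ⟨min (η ^ 2 / (4 * (M + 1))) (η / (2 * m + 1)), by positivity, ?_, ?_⟩
    · have : min (η ^ 2 / (4 * (M + 1))) (η / (2 * m + 1)) * (4 * (M+1)) ≤ η ^ 2 := by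
        rw [← le_div_iff₀ (by positivity)]; exact min_le_left _ _
      have h0 : 0 ≤ min (η ^ 2 / (4 * (M + 1))) (η / (2 * m + 1)) := by positivity
      nlinarith
    · have : min (η ^ 2 / (4 * (M + 1))) (η / (2 * m + 1)) * (2 * m + 1) ≤ η := by
        rw [← le_div_iff₀ (by positivity)]; exact min_le_right _ _
      have h0 : 0 ≤ min (η ^ 2 / (4 * (M + 1))) (η / (2 * m + 1)) := by positivity
      nlinarith
  set G : EE m → ℝ := fun y => u y - ε * ‖y - x0‖ ^ 2 with hG
  have hGc : Continuous G := by have := hu.continuous; fun_prop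
  set r := Real.sqrt (M / ε) + 1 with hr
  have hr0 : 0 < r := by positivity
  obtain ⟨x, hx, hxm⟩ := (isCompact_closedBall x0 r).exists_isMaxOn
    ⟨x0, Metric.mem_closedBall_self hr0.le⟩ hGc.continuousOn
  have hglob : ∀ y, G y ≤ G x := by
    intro y
    by_cases hy : y ∈ Metric.closedBall x0 r
    · exact hxm hy
    · have hx0 : G x0 ≤ G x := hxm (Metric.mem_closedBall_self hr0.le)
      refine le_trans ?_ hx0
      simp only [Metric.mem_closedBall, dist_eq_norm, not_le] at hy
      have h3 : M / ε ≤ ‖y - x0‖ ^ 2 := by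
        have hs := Real.sq_sqrt (show 0 ≤ M / ε by positivity)
        have : Real.sqrt (M/ε) ≤ ‖y - x0‖ := by linarith
        nlinarith [Real.sqrt_nonneg (M/ε)]
      rw [div_le_iff₀ hε] at h3
      have := hB y
      simp only [hG, sub_self, norm_zero]
      nlinarith
  have hd1 : ∀ᶠ y in 𝓝 x, HasFDerivAt G (fderiv ℝ u y - ε • ((2:ℝ) • inSL m (y - x0))) y :=
    Eventually.of_forall fun y => (h1 y).sub ((hasFDerivAt_sqdist x0 y).const_mul ε)
  have hd2 : HasFDerivAt (fun y => fderiv ℝ u y - ε • ((2:ℝ) • (inSL m (y - x0) : ED m)))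
      (fderiv ℝ (fderiv ℝ u) x - ε • ((2:ℝ) • inSL m)) x :=
    (h2 x).sub (((hasFDerivAt_innerSL x0 x).const_smul (2:ℝ)).const_smul ε)
  obtain ⟨j1, j2⟩ := max_jet hd1 hd2 (Eventually.of_forall hglob)
  have hx0 := hglob x0
  simp only [hG, sub_self, norm_zero] at hx0
  refine ⟨x, by nlinarith [sq_nonneg ‖x - x0‖], ?_, ?_⟩
  · have : fderiv ℝ u x = (ε * 2) • (inSL m (x - x0)) := by
      rw [sub_eq_zero] at j1; rw [j1, smul_smul]
    rw [this, norm_smul, inSL_norm, Real.norm_of_nonneg (by positivity)]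
    have hb := hB x
    have h5 : ε * ‖x - x0‖ ^ 2 ≤ M := by rw [hM]; nlinarith
    refine abs_le_of_sq_le_sq' ?_ hη.le |>.2
    nlinarith [mul_le_mul_of_nonneg_left h5 hε.le]
  · refine (trc_le _ (2 * ε) fun a => ?_).trans (by linarith)
    have := j2 a
    simp only [sub_apply, smul_apply, smul_eq_mul] at this
    rw [inSL_apply, real_inner_self_eq_norm_sq] at this
    linarith

lemma Lc_sub {m : ℕ} {u v : EE m → ℝ} (hu : ContDiff ℝ 2 u) (hv : ContDiff ℝ 2 v) (x : EE m) :
    fderiv ℝ (fun y => u y - v y) x = fderiv ℝ u x - fderiv ℝ v x ∧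
    Lc (fun y => u y - v y) x = Lc u x - Lc v x := by
  obtain ⟨h1, h2, -⟩ := C2_fderiv hu
  obtain ⟨k1, k2, -⟩ := C2_fderiv hv
  have e : fderiv ℝ (fun y => u y - v y) = fun x => fderiv ℝ u x - fderiv ℝ v x := by
    ext1 x; exact ((h1 x).sub (k1 x)).fderiv
  refine ⟨congrFun e x, ?_⟩
  unfold Lc
  rw [e, ((h2 x).fun_sub (k2 x)).fderiv, trc_sub]

lemma comparison {m : ℕ} {ρ ℓ δ B : ℝ} (hρ : 0 < ρ) {H : ED m → ℝ}
    (hH : ∀ p q, |H p - H q| ≤ ℓ * ‖p - q‖)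
    {u v : EE m → ℝ} (hu : ContDiff ℝ 2 u) (hv : ContDiff ℝ 2 v)
    (hB : ∀ x, u x - v x ≤ B)
    (h : ∀ x, ρ * u x - 1/2 * Lc u x + H (fderiv ℝ u x)
      ≤ ρ * v x - 1/2 * Lc v x + H (fderiv ℝ v x) + δ) (x0 : EE m) :
    ρ * (u x0 - v x0) ≤ δ := by
  have hw : ContDiff ℝ 2 (fun y => u y - v y) := hu.sub hv
  have key : ∀ η > 0, ρ * (u x0 - v x0) ≤ δ + (1/2 + |ℓ|) * η := by
    intro η hη
    obtain ⟨x, a1, a2, a3⟩ := approx_max hw hB x0 hη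
    obtain ⟨b1, b2⟩ := Lc_sub hu hv x
    rw [b1] at a2
    rw [b2] at a3
    have := h x
    have h3 := (abs_le.1 (hH (fderiv ℝ u x) (fderiv ℝ v x))).1
    have h4 : ℓ * ‖fderiv ℝ u x - fderiv ℝ v x‖ ≤ |ℓ| * η := by
      gcongr; exact le_abs_self _
    have h5 : ρ * (u x0 - v x0) ≤ ρ * (u x - v x) := by gcongr
    linarith
  refine le_of_forall_pos_le_add fun e he => ?_
  have hp : 0 < 1/2 + |ℓ| := by positivity
  have := key (e / (1/2 + |ℓ|)) (by positivity)
  rwa [mul_div_cancel₀ _ hp.ne'] at this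

open Filter
open scoped Topology
set_option maxSynthPendingDepth 3

open MeasureTheory in
lemma integrable_gauss {m : ℕ} {b : ℝ} (hb : 0 < b) :
    Integrable (fun z : EE m => Real.exp (-b * ‖z‖ ^ 2)) := by
  by_contra h
  have h1 := GaussianFourier.integral_rexp_neg_mul_sq_norm (V := EE m) hb
  rw [integral_undef h] at h1
  have : 0 < (Real.pi / b) ^ (Module.finrank ℝ (EE m) / 2 : ℝ) := by positivity
  linarith

/-- the Gaussian kernel -/
noncomputable def gc (m : ℕ) : ℝ := (∫ z : EE m, Real.exp (-(1/2) * ‖z‖ ^ 2))⁻¹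

lemma gc_pos (m : ℕ) : 0 < gc m := by
  unfold gc
  rw [GaussianFourier.integral_rexp_neg_mul_sq_norm (V := EE m) (by norm_num)]
  positivity

noncomputable def gk {m : ℕ} (z : EE m) : ℝ := gc m * Real.exp (-(1/2) * ‖z‖ ^ 2)

lemma gk_pos {m : ℕ} (z : EE m) : 0 < gk z := mul_pos (gc_pos m) (Real.exp_pos _)

noncomputable def Dk1 {m : ℕ} (z : EE m) : ED m := -(gk z) • inSL m z

noncomputable def Dk2 {m : ℕ} (z : EE m) : EE m →L[ℝ] ED m :=
  gk z • ((inSL m z).smulRight (inSL m z) - inSL m)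

lemma integral_gk (m : ℕ) : ∫ z : EE m, gk z = 1 := by
  unfold gk
  rw [MeasureTheory.integral_const_mul]
  exact inv_mul_cancel₀ (fun h => (gc_pos m).ne' (by unfold gc; rw [h, inv_zero]))

lemma hasFDerivAt_nsq {m : ℕ} (y : EE m) :
    HasFDerivAt (fun y : EE m => ‖y‖ ^ 2) ((2:ℝ) • inSL m y) y := by
  simpa using hasFDerivAt_sqdist 0 y

lemma hasFDerivAt_gk {m : ℕ} (z : EE m) : HasFDerivAt gk (Dk1 z) z := by
  have := (((hasFDerivAt_nsq z).const_mul (-(1/2))).exp).const_mul (gc m)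
  refine this.congr_fderiv ?_
  ext a
  simp [Dk1, gk]
  ring

lemma hasFDerivAt_Dk1 {m : ℕ} (z : EE m) : HasFDerivAt Dk1 (Dk2 z) z := by
  have := ((hasFDerivAt_gk z).neg).smul ((inSL m).hasFDerivAt (x := z))
  refine this.congr_fderiv ?_
  ext a b
  simp [Dk1, Dk2]
  ring

lemma trc_Dk2 {m : ℕ} (z : EE m) : trc (Dk2 z) = gk z * (‖z‖ ^ 2 - m) := by
  unfold Dk2
  rw [trc_smul, trc_sub]
  congr 2
  · rw [EuclideanSpace.norm_sq_eq]
    unfold trc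
    refine Finset.sum_congr rfl fun i _ => ?_
    simp [inSL_apply, sq, EuclideanSpace.inner_single_right]
  · unfold trc
    simp [inSL_apply]

lemma four_exp_ge (x : ℝ) : 1 + x ≤ 4 * Real.exp (x / 4) := by
  have := Real.add_one_le_exp (x/4)
  linarith

lemma gauss_dom {m : ℕ} (z : EE m) :
    gk z * (1 + ‖z‖ ^ 2) ≤ 4 * gc m * Real.exp (-(1/4) * ‖z‖ ^ 2) := by
  have h := four_exp_ge (‖z‖ ^ 2)
  have e : Real.exp (-(1/2) * ‖z‖ ^ 2) * Real.exp (‖z‖ ^ 2 / 4) = Real.exp (-(1/4) * ‖z‖ ^ 2) := by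
    rw [← Real.exp_add]; congr 1; ring
  rw [← e]
  unfold gk
  have := gc_pos m
  have h2 := Real.exp_pos (-(1/2) * ‖z‖ ^ 2)
  calc _ = gc m * Real.exp (-(1/2) * ‖z‖ ^ 2) * (1 + ‖z‖ ^ 2) := rfl
    _ ≤ gc m * Real.exp (-(1/2) * ‖z‖ ^ 2) * (4 * Real.exp (‖z‖ ^ 2 / 4)) := by gcongr
    _ = _ := by ring

/-- kernels with Gaussian bounds -/
def Good {m : ℕ} {F : Type*} [NormedAddCommGroup F] (q : EE m → F) (A : ℝ) : Prop :=
  Continuous q ∧ ∀ z, ‖q z‖ ≤ A * Real.exp (-(1/4) * ‖z‖ ^ 2)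

lemma gk_cont {m : ℕ} : Continuous (gk : EE m → ℝ) := by unfold gk; fun_prop

lemma good_gk {m : ℕ} : Good (gk : EE m → ℝ) (4 * gc m) := by
  refine ⟨gk_cont, fun z => le_trans ?_ (gauss_dom z)⟩
  rw [Real.norm_of_nonneg (gk_pos z).le]
  nlinarith [gk_pos z, sq_nonneg ‖z‖]

lemma good_Dk1 {m : ℕ} : Good (Dk1 : EE m → ED m) (4 * gc m) := by
  refine ⟨continuous_iff_continuousAt.2 fun z => (hasFDerivAt_Dk1 z).continuousAt,
    fun z => le_trans ?_ (gauss_dom z)⟩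
  unfold Dk1
  rw [norm_smul, norm_neg, Real.norm_of_nonneg (gk_pos z).le, inSL_norm]
  gcongr
  · exact (gk_pos z).le
  · nlinarith [sq_nonneg (‖z‖ - 1)]

lemma inSL_opnorm (m : ℕ) : ‖inSL m‖ ≤ 1 :=
  ContinuousLinearMap.opNorm_le_bound _ zero_le_one fun z => by rw [inSL_norm, one_mul]

lemma good_Dk2 {m : ℕ} : Good (Dk2 : EE m → EE m →L[ℝ] ED m) (4 * gc m) := by
  refine ⟨?_, fun z => le_trans ?_ (gauss_dom z)⟩
  · unfold Dk2
    have := gk_cont (m := m)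
    have h2 : Continuous fun z : EE m => (inSL m z).smulRight (inSL m z) := by
      have : (fun z : EE m => (inSL m z).smulRight (inSL m z)) = fun z : EE m =>
        ContinuousLinearMap.smulRightL ℝ (EE m) (ED m) (inSL m z) (inSL m z) := by
        ext z; rfl
      rw [this]; fun_prop
    fun_prop
  · unfold Dk2
    rw [norm_smul, Real.norm_of_nonneg (gk_pos z).le]
    gcongr
    · exact (gk_pos z).le
    · refine (norm_sub_le _ _).trans ?_
      rw [ContinuousLinearMap.norm_smulRight_apply, inSL_norm]
      nlinarith [inSL_opnorm m]

/-- averaging operators -/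
noncomputable def TT {m : ℕ} {F : Type*} [NormedAddCommGroup F] [NormedSpace ℝ F]
    (q : EE m → F) (s : ℝ) (g : EE m → ℝ) (x : EE m) : F := ∫ z, g (x + s • z) • q z

noncomputable def J4 (m : ℕ) : ℝ := ∫ z : EE m, Real.exp (-(1/4) * ‖z‖ ^ 2)

lemma J4_nonneg (m : ℕ) : 0 ≤ J4 m := MeasureTheory.integral_nonneg fun _ => (Real.exp_pos _).le

section
variable {m : ℕ} {F : Type*} [NormedAddCommGroup F] [NormedSpace ℝ F]

open MeasureTheory

lemma Good.A_nonneg {q : EE m → F} {A : ℝ} (hq : Good q A) : 0 ≤ A := by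
  have := (norm_nonneg _).trans (hq.2 0)
  simpa using this

lemma TT_dom {q : EE m → F} {A B : ℝ} (hq : Good q A) {g : EE m → ℝ}
    (hB : ∀ x, |g x| ≤ B) (s : ℝ) (x z : EE m) :
    ‖g (x + s • z) • q z‖ ≤ B * A * Real.exp (-(1/4) * ‖z‖ ^ 2) := by
  rw [norm_smul, mul_assoc]
  exact mul_le_mul (hB _) (hq.2 z) (norm_nonneg _) ((abs_nonneg _).trans (hB x))

lemma dom_int (m : ℕ) (C : ℝ) :
    Integrable (fun z : EE m => C * Real.exp (-(1/4) * ‖z‖ ^ 2)) :=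
  (integrable_gauss (by norm_num)).const_mul _

lemma TT_meas {q : EE m → F} {A : ℝ} (hq : Good q A) {g : EE m → ℝ} (hg : Continuous g)
    (s : ℝ) (x : EE m) : AEStronglyMeasurable (fun z => g (x + s • z) • q z) volume := by
  have := hq.1
  exact Continuous.aestronglyMeasurable (by fun_prop)

lemma TT_int {q : EE m → F} {A B : ℝ} (hq : Good q A) {g : EE m → ℝ} (hg : Continuous g)
    (hB : ∀ x, |g x| ≤ B) (s : ℝ) (x : EE m) : Integrable (fun z => g (x + s • z) • q z) :=
  (dom_int m (B * A)).mono' (TT_meas hq hg s x) (Eventually.of_forall fun z => TT_dom hq hB s x z)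

lemma TT_bound {q : EE m → F} {A B : ℝ} (hq : Good q A) {g : EE m → ℝ}
    (hB : ∀ x, |g x| ≤ B) (s : ℝ) (x : EE m) : ‖TT q s g x‖ ≤ B * (A * J4 m) := by
  unfold TT
  refine (norm_integral_le_of_norm_le (dom_int m (B * A))
    (Eventually.of_forall fun z => TT_dom hq hB s x z)).trans ?_
  rw [integral_const_mul, mul_assoc]; rfl

lemma TT_continuous {q : EE m → F} {A B : ℝ} (hq : Good q A) {g : EE m → ℝ} (hg : Continuous g)
    (hB : ∀ x, |g x| ≤ B) : Continuous fun p : ℝ × EE m => TT q p.1 g p.2 := by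
  unfold TT
  refine continuous_of_dominated (fun p => TT_meas hq hg _ _)
    (fun p => Eventually.of_forall fun z => TT_dom hq hB p.1 p.2 z) (dom_int m (B * A))
    (Eventually.of_forall fun z => ?_)
  fun_prop

lemma TT_sub {q : EE m → F} {A B B' : ℝ} (hq : Good q A) {g g' : EE m → ℝ} (hg : Continuous g)
    (hB : ∀ x, |g x| ≤ B) (hg' : Continuous g') (hB' : ∀ x, |g' x| ≤ B') (s : ℝ) (x : EE m) :
    TT q s (fun y => g y - g' y) x = TT q s g x - TT q s g' x := by
  unfold TT
  rw [← integral_sub (TT_int hq hg hB s x) (TT_int hq hg' hB' s x)]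
  simp only [sub_smul]

lemma TT_hasFDerivAt {q : EE m → F} {q' : EE m → EE m →L[ℝ] F} {A A' B : ℝ}
    (hq : Good q A) (hq' : Good q' A') (hd : ∀ z, HasFDerivAt q (q' z) z) {g : EE m → ℝ}
    (hg : Continuous g) (hB : ∀ x, |g x| ≤ B) {s : ℝ} (hs : 0 < s) (x0 : EE m) :
    HasFDerivAt (TT q s g) (-(s⁻¹) • TT q' s g x0) x0 := by
  have hB0 : 0 ≤ B := (abs_nonneg _).trans (hB 0)
  have hc := hq.1
  have hc' := hq'.1
  have key : HasFDerivAt (fun b : EE m => ∫ z, g (x0 + s • z) • q (z - b))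
      (∫ z, g (x0 + s • z) • (- q' (z - 0))) 0 := by
    have hbd : Integrable (fun z : EE m =>
        B * (A' * Real.exp (1/4)) * Real.exp (-(1/8) * ‖z‖ ^ 2)) :=
      (integrable_gauss (by norm_num)).const_mul _
    refine hasFDerivAt_integral_of_dominated_of_fderiv_le (s := Metric.ball 0 1)
      (F' := fun b z => g (x0 + s • z) • (- q' (z - b)))
      (Metric.ball_mem_nhds _ zero_lt_one) ?_ ?_ ?_ ?_ hbd ?_
    · exact Eventually.of_forall fun b => Continuous.aestronglyMeasurable (by fun_prop)
    · simpa using TT_int hq hg hB s x0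
    · exact Continuous.aestronglyMeasurable (by fun_prop)
    · refine Eventually.of_forall fun z b hb => ?_
      rw [norm_smul, norm_neg, mul_assoc, mul_assoc]
      refine mul_le_mul (hB _) ((hq'.2 _).trans ?_) (norm_nonneg _) hB0
      refine mul_le_mul_of_nonneg_left ?_ hq'.A_nonneg
      rw [← Real.exp_add]
      refine Real.exp_le_exp.2 ?_
      have hb1 : ‖b‖ ≤ 1 := by
        have := Metric.mem_ball.1 hb; rw [dist_zero_right] at this; exact this.le
      have h1 : ‖z‖ ≤ ‖z - b‖ + ‖b‖ := by simpa using norm_add_le (z - b) b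
      have h2 : ‖z‖ ^ 2 ≤ (‖z - b‖ + 1) ^ 2 := by
        have := norm_nonneg z; gcongr; linarith
      nlinarith [sq_nonneg (‖z - b‖ - 1)]
    · refine Eventually.of_forall fun z b _ => ?_
      have h1 : HasFDerivAt (fun b : EE m => z - b) (-ContinuousLinearMap.id ℝ (EE m)) b :=
        (hasFDerivAt_id b).const_sub z
      have h2 := ((hd (z - b)).comp b h1).const_smul (g (x0 + s • z))
      refine h2.congr_fderiv ?_
      ext a; simp
  have heq : ∀ x, TT q s g x = (fun b : EE m => ∫ z, g (x0 + s • z) • q (z - b))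
      (s⁻¹ • (x - x0)) := by
    intro x
    simp only [TT]
    rw [← integral_add_right_eq_self (μ := volume) (fun z => g (x0 + s • z) • q (z - s⁻¹ • (x - x0)))
      (s⁻¹ • (x - x0))]
    congr 1
    ext z
    rw [add_sub_cancel_right]
    congr 2
    rw [smul_add, smul_smul, mul_inv_cancel₀ hs.ne', one_smul]
    abel
  have hin : HasFDerivAt (fun x : EE m => s⁻¹ • (x - x0)) (s⁻¹ • ContinuousLinearMap.id ℝ (EE m)) x0 :=
    ((hasFDerivAt_id x0).sub_const x0).const_smul s⁻¹
  have key' : HasFDerivAt (fun b : EE m => ∫ z, g (x0 + s • z) • q (z - b))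
      (∫ z, g (x0 + s • z) • (- q' (z - 0))) (s⁻¹ • (x0 - x0)) := by
    rw [sub_self, smul_zero]; exact key
  have := key'.comp x0 hin
  rw [show TT q s g = _ from funext heq]
  refine this.congr_fderiv ?_
  simp only [sub_zero, smul_neg, integral_neg, TT]
  ext a
  simp

end

open Filter
open scoped Topology
set_option maxSynthPendingDepth 3

section
open MeasureTheory Set
variable {m : ℕ}

noncomputable def trcL (m : ℕ) : (EE m →L[ℝ] ED m) →L[ℝ] ℝ :=
  ∑ i : Fin m, (ContinuousLinearMap.apply ℝ ℝ (EuclideanSpace.single i 1 : EE m)).comp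
    (ContinuousLinearMap.apply ℝ (ED m) (EuclideanSpace.single i 1 : EE m))

lemma trcL_apply (S : EE m →L[ℝ] ED m) : trcL m S = trc S := by
  unfold trcL trc
  simp

lemma int_Dk2_zero : ∫ z : EE m, Dk2 z = 0 := by
  have h := TT_hasFDerivAt (m := m) good_Dk1 good_Dk2 hasFDerivAt_Dk1 (g := fun _ => (1:ℝ))
    continuous_const (B := 1) (by simp) (s := 1) one_pos 0
  have e : TT (Dk1 : EE m → ED m) 1 (fun _ => (1:ℝ)) = fun _ => ∫ z : EE m, Dk1 z := by
    ext x; simp [TT]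
  rw [e] at h
  have h2 := h.unique (hasFDerivAt_const (∫ z : EE m, Dk1 z) (0 : EE m))
  simpa [TT] using h2

noncomputable def J8 (m : ℕ) : ℝ := ∫ z : EE m, 8 * Real.exp (-(1/8) * ‖z‖ ^ 2)

lemma J8_nonneg (m : ℕ) : 0 ≤ J8 m :=
  integral_nonneg fun _ => by positivity

lemma TT_Dk2_holder {g : EE m → ℝ} (hg : Continuous g) {B : ℝ} (hB : ∀ x, |g x| ≤ B) {K : ℝ} (hK0' : 0 ≤ K)
    (hK : ∀ x y, |g x - g y| ≤ K * √‖x - y‖) {s : ℝ} (hs : 0 < s) (x : EE m) :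
    ‖TT Dk2 s g x‖ ≤ K * √s * (4 * gc m * J8 m) := by
  have e : TT Dk2 s g x = ∫ z, (g (x + s • z) - g x) • Dk2 z := by
    have h1 := TT_int good_Dk2 hg hB s x
    have h2 : Integrable (fun z : EE m => g x • Dk2 z) := by
      simpa using TT_int good_Dk2 (g := fun _ => g x) continuous_const (B := |g x|)
        (by simp) s x
    simp only [sub_smul]
    rw [integral_sub h1 h2, integral_smul, int_Dk2_zero, smul_zero, sub_zero]; rfl
  rw [e]
  have hintg : Integrable (fun z : EE m => K * √s * (4 * gc m * (8 * Real.exp (-(1/8) * ‖z‖ ^ 2)))) :=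
    ((((integrable_gauss (by norm_num)).const_mul _).const_mul _).const_mul _)
  have hK0 : 0 ≤ K * √s := by positivity
  refine (norm_integral_le_of_norm_le hintg (Eventually.of_forall fun z => ?_)).trans ?_
  · rw [norm_smul]
    have h1 : ‖g (x + s • z) - g x‖ ≤ K * √s * √‖z‖ := by
      refine (hK _ _).trans ?_
      rw [add_sub_cancel_left, norm_smul, Real.norm_of_nonneg hs.le, Real.sqrt_mul hs.le, mul_assoc]
    have h2 := good_Dk2.2 z
    have h3 : √‖z‖ ≤ 8 * Real.exp (1/8 * ‖z‖^2) := by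
      have := Real.add_one_le_exp (1/8 * ‖z‖^2)
      have h5 : √‖z‖ ≤ 1 + ‖z‖ := by
        rw [Real.sqrt_le_left (by positivity)]; nlinarith [norm_nonneg z]
      nlinarith [sq_nonneg (‖z‖ - 1)]
    have h4 : Real.exp (1/8 * ‖z‖^2) * Real.exp (-(1/4) * ‖z‖ ^ 2) = Real.exp (-(1/8) * ‖z‖ ^ 2) := by
      rw [← Real.exp_add]; congr 1; ring
    have hgc := gc_pos m
    calc _ ≤ (K * √s * √‖z‖) * (4 * gc m * Real.exp (-(1/4) * ‖z‖ ^ 2)) := by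
          gcongr
      _ ≤ (K * √s * (8 * Real.exp (1/8 * ‖z‖^2))) * (4 * gc m * Real.exp (-(1/4) * ‖z‖ ^ 2)) := by
          gcongr
      _ = K * √s * (4 * gc m * (8 * (Real.exp (1/8 * ‖z‖^2) * Real.exp (-(1/4) * ‖z‖ ^ 2)))) := by
          ring
      _ ≤ _ := by rw [h4]
  · rw [integral_const_mul, integral_const_mul]; rfl

lemma good_trDk2 : Good (fun z : EE m => trc (Dk2 z)) (‖trcL m‖ * (4 * gc m)) := by
  simp only [← trcL_apply]
  refine ⟨(trcL m).continuous.comp good_Dk2.1, fun z => ?_⟩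
  rw [mul_assoc]
  exact ((trcL m).le_opNorm _).trans (by gcongr; exact good_Dk2.2 z)

lemma trc_TT {g : EE m → ℝ} (hg : Continuous g) {B : ℝ} (hB : ∀ x, |g x| ≤ B) (s : ℝ) (x : EE m) :
    trc (TT Dk2 s g x) = TT (fun z => trc (Dk2 z)) s g x := by
  unfold TT
  rw [← trcL_apply, ← ContinuousLinearMap.integral_comp_comm _ (TT_int good_Dk2 hg hB s x)]
  simp [trcL_apply]

lemma TT_hasDerivAt_s {g : EE m → ℝ} (hg : Continuous g) {B : ℝ} (hB : ∀ x, |g x| ≤ B)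
    {s0 : ℝ} (hs : 0 < s0) (x : EE m) :
    HasDerivAt (fun s => TT gk s g x) (s0⁻¹ * TT (fun z => trc (Dk2 z)) s0 g x) s0 := by
  have hB0 : 0 ≤ B := (abs_nonneg _).trans (hB 0)
  have hgk := gk_cont (m := m)
  have hgc := gc_pos m
  -- derivative in the dilation parameter
  have key : HasDerivAt (fun j : ℝ => ∫ z : EE m, g (x + s0 • z) * gk (j • z))
      (∫ z : EE m, g (x + s0 • z) * (-(1 * ‖z‖ ^ 2) * gk ((1:ℝ) • z))) 1 := by
    have hbd : Integrable (fun z : EE m => B * (gc m * (32 * Real.exp (-(1/16) * ‖z‖ ^ 2)))) :=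
      (((integrable_gauss (by norm_num)).const_mul _).const_mul _).const_mul _
    refine (hasDerivAt_integral_of_dominated_loc_of_deriv_le (s := Ioo (1/2) 2)
      (F' := fun j z => g (x + s0 • z) * (-(j * ‖z‖ ^ 2) * gk (j • z)))
      (Ioo_mem_nhds (by norm_num) (by norm_num)) ?_ ?_ ?_ ?_ hbd ?_).2
    · exact Eventually.of_forall fun b => Continuous.aestronglyMeasurable (by fun_prop)
    · simpa using TT_int good_gk hg hB s0 x
    · exact Continuous.aestronglyMeasurable (by fun_prop)
    · refine Eventually.of_forall fun z j hj => ?_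
      rw [norm_mul]
      refine mul_le_mul (hB _) ?_ (norm_nonneg _) hB0
      rw [norm_mul, norm_neg, Real.norm_of_nonneg (by have := hj.1; positivity),
        Real.norm_of_nonneg (gk_pos _).le]
      unfold gk
      rw [norm_smul, Real.norm_of_nonneg (by linarith [hj.1]), mul_pow]
      have h1 : Real.exp (-(1/2) * (j ^ 2 * ‖z‖ ^ 2)) ≤ Real.exp (-(1/8) * ‖z‖ ^ 2) := by
        refine Real.exp_le_exp.2 ?_
        have : 1/4 ≤ j ^ 2 := by nlinarith [hj.1]
        nlinarith [sq_nonneg ‖z‖]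
      have h2 : j * ‖z‖ ^ 2 ≤ 32 * Real.exp (1/16 * ‖z‖ ^ 2) := by
        have := Real.add_one_le_exp (1/16 * ‖z‖ ^ 2)
        nlinarith [hj.2, sq_nonneg ‖z‖]
      have h4 : Real.exp (1/16 * ‖z‖^2) * Real.exp (-(1/8) * ‖z‖ ^ 2) = Real.exp (-(1/16) * ‖z‖ ^ 2) := by
        rw [← Real.exp_add]; congr 1; ring
      rw [← h4]
      calc _ ≤ 32 * Real.exp (1/16 * ‖z‖ ^ 2) * (gc m * Real.exp (-(1/8) * ‖z‖ ^ 2)) := by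
            gcongr
        _ = _ := by ring
    · refine Eventually.of_forall fun z j hj => ?_
      have : HasDerivAt (fun j : ℝ => gk (j • z)) (-(j * ‖z‖ ^ 2) * gk (j • z)) j := by
        unfold gk
        have e : ∀ j : ℝ, ‖j • z‖ ^ 2 = j ^ 2 * ‖z‖ ^ 2 := fun j => by
          rw [norm_smul, mul_pow, Real.norm_eq_abs, sq_abs]
        simp only [e]
        have := (((((hasDerivAt_pow 2 j).mul_const (‖z‖ ^ 2)).const_mul (-(1/2:ℝ)))).exp).const_mul
          (gc m)
        refine this.congr_deriv ?_
        simp; ring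
      exact this.const_mul _
  have hW := (hasDerivAt_pow m (1:ℝ)).mul key
  have hj : HasDerivAt (fun s : ℝ => s0 / s) (- s0⁻¹) s0 := by
    have := (hasDerivAt_inv hs.ne').const_mul s0
    refine (this.congr_deriv ?_)
    field_simp
  have hW' := hW
  rw [show (1:ℝ) = s0 / s0 from (div_self hs.ne').symm] at hW
  have hcomp := HasDerivAt.comp s0 hW hj
  have heq : (fun s => TT gk s g x) =ᶠ[𝓝 s0] (((fun j : ℝ => j ^ m) *
      fun j : ℝ => ∫ z : EE m, g (x + s0 • z) * gk (j • z)) ∘ fun s => s0 / s) := by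
    filter_upwards [lt_mem_nhds hs] with s hs1
    have hR := Measure.integral_comp_smul (volume : Measure (EE m))
      (fun z => g (x + s0 • z) * gk ((s0 / s) • z)) (s / s0)
    simp only [Function.comp, Pi.mul_apply, TT, smul_eq_mul]
    have h1 : ∀ z : EE m, s0 • (s / s0) • z = s • z := fun z => by
      rw [smul_smul]; congr 1; field_simp
    have h2 : ∀ z : EE m, (s0 / s) • (s / s0) • z = z := fun z => by
      rw [smul_smul, show s0 / s * (s / s0) = 1 by field_simp, one_smul]
    simp only [h1, h2] at hR
    rw [hR, finrank_euclideanSpace, Fintype.card_fin, abs_of_pos (by positivity), smul_eq_mul]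
    congr 1
    rw [← inv_pow, inv_div]
  refine (hcomp.congr_of_eventuallyEq heq).congr_deriv ?_
  have hd : s0 / s0 = 1 := div_self hs.ne'
  simp only [hd, one_pow, one_smul, mul_one, one_mul]
  unfold TT
  have i1 := TT_int good_gk hg hB s0 x
  have i2 := TT_int good_trDk2 hg hB s0 x
  simp only [smul_eq_mul] at i1 i2 ⊢
  have : ∫ z : EE m, g (x + s0 • z) * trc (Dk2 z) =
    -(∫ z : EE m, (m * (g (x + s0 • z) * gk z) + g (x + s0 • z) * (-‖z‖ ^ 2 * gk z))) := by
    rw [← integral_neg]; congr 1; ext z; rw [trc_Dk2]; ring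
  have i3 : Integrable (fun z : EE m => g (x + s0 • z) * (-‖z‖ ^ 2 * gk z)) := by
    refine (i2.neg.sub (i1.const_mul m)).congr (Eventually.of_forall fun z => ?_)
    simp only [Pi.sub_apply, Pi.neg_apply]
    rw [trc_Dk2]; ring
  rw [this, integral_add (i1.const_mul _) i3, integral_const_mul]
  ring

end

open Filter
open scoped Topology
set_option maxSynthPendingDepth 3

section
open MeasureTheory Set
variable {m : ℕ}

noncomputable def IW {F : Type*} [NormedAddCommGroup F] [NormedSpace ℝ F]
    (w : ℝ → ℝ) (q : EE m → F) (g : EE m → ℝ) (x : EE m) : F :=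
  ∫ s in Ioi (0:ℝ), w s • TT q s g x

lemma IW_meas {F : Type*} [NormedAddCommGroup F] [NormedSpace ℝ F]
    {w : ℝ → ℝ} (hw : ContinuousOn w (Ioi 0)) {q : EE m → F} {A B : ℝ} (hq : Good q A)
    {g : EE m → ℝ} (hg : Continuous g) (hB : ∀ x, |g x| ≤ B) (x : EE m) :
    AEStronglyMeasurable (fun s => w s • TT q s g x) (volume.restrict (Ioi 0)) := by
  refine ContinuousOn.aestronglyMeasurable (ContinuousOn.smul hw ?_) measurableSet_Ioi
  exact ((TT_continuous hq hg hB).comp (by fun_prop : Continuous fun s : ℝ => (s, x))).continuousOn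

lemma IW_int {F : Type*} [NormedAddCommGroup F] [NormedSpace ℝ F]
    {w : ℝ → ℝ} (hw : ContinuousOn w (Ioi 0)) {q : EE m → F} {A B : ℝ} (hq : Good q A)
    {g : EE m → ℝ} (hg : Continuous g) (hB : ∀ x, |g x| ≤ B) {b : ℝ → ℝ} (hb : IntegrableOn b (Ioi 0))
    (x : EE m) (h : ∀ s, 0 < s → ‖w s • TT q s g x‖ ≤ b s) :
    IntegrableOn (fun s => w s • TT q s g x) (Ioi 0) :=
  Integrable.mono' hb (IW_meas hw hq hg hB x) ((ae_restrict_mem measurableSet_Ioi).mono fun s hs => h s hs)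

lemma IW_bound {F : Type*} [NormedAddCommGroup F] [NormedSpace ℝ F]
    {w : ℝ → ℝ} {q : EE m → F}
    {g : EE m → ℝ} {b : ℝ → ℝ} (hb : IntegrableOn b (Ioi 0))
    (x : EE m) (h : ∀ s, 0 < s → ‖w s • TT q s g x‖ ≤ b s) :
    ‖IW w q g x‖ ≤ ∫ s in Ioi (0:ℝ), b s :=
  norm_integral_le_of_norm_le hb ((ae_restrict_mem measurableSet_Ioi).mono fun s hs => h s hs)

lemma IW_continuous {F : Type*} [NormedAddCommGroup F] [NormedSpace ℝ F]
    {w : ℝ → ℝ} (hw : ContinuousOn w (Ioi 0)) {q : EE m → F} {A B : ℝ} (hq : Good q A)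
    {g : EE m → ℝ} (hg : Continuous g) (hB : ∀ x, |g x| ≤ B) {b : ℝ → ℝ} (hb : IntegrableOn b (Ioi 0))
    (h : ∀ x s, 0 < s → ‖w s • TT q s g x‖ ≤ b s) :
    Continuous (IW w q g) := by
  unfold IW
  refine continuous_of_dominated (fun x => IW_meas hw hq hg hB x)
    (fun x => (ae_restrict_mem measurableSet_Ioi).mono fun s hs => h x s hs) hb
    (Eventually.of_forall fun s => ?_)
  exact ((TT_continuous hq hg hB).comp (by fun_prop : Continuous fun x : EE m => (s, x))).const_smul _

lemma IW_hasFDerivAt {F : Type*} [NormedAddCommGroup F] [NormedSpace ℝ F]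
    {w w' : ℝ → ℝ} (hw : ContinuousOn w (Ioi 0)) (hw' : ContinuousOn w' (Ioi 0))
    {q : EE m → F} {q' : EE m → EE m →L[ℝ] F} {A A' B : ℝ} (hq : Good q A) (hq' : Good q' A')
    (hd : ∀ z, HasFDerivAt q (q' z) z) (hww : ∀ s, 0 < s → w' s = - (s⁻¹ * w s))
    {g : EE m → ℝ} (hg : Continuous g) (hB : ∀ x, |g x| ≤ B) {b b' : ℝ → ℝ}
    (hb : IntegrableOn b (Ioi 0)) (hb' : IntegrableOn b' (Ioi 0))
    (h : ∀ x s, 0 < s → ‖w s • TT q s g x‖ ≤ b s)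
    (h' : ∀ x s, 0 < s → ‖w' s • TT q' s g x‖ ≤ b' s) (x : EE m) :
    HasFDerivAt (IW w q g) (IW w' q' g x) x := by
  unfold IW
  refine hasFDerivAt_integral_of_dominated_of_fderiv_le (s := univ) (bound := b')
    (F' := fun x s => w' s • TT q' s g x)
    univ_mem (Eventually.of_forall fun x => IW_meas hw hq hg hB x) (IW_int hw hq hg hB hb x (h x))
    (IW_meas hw' hq' hg hB x) ((ae_restrict_mem measurableSet_Ioi).mono fun s hs y _ => h' y s hs)
    hb' ((ae_restrict_mem measurableSet_Ioi).mono fun s hs y _ => ?_)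
  have := (TT_hasFDerivAt hq hq' hd hg hB hs y).const_smul (w s)
  refine this.congr_fderiv ?_
  rw [hww s hs, smul_smul]; congr 1; ring

/-- weights -/
noncomputable def w0 (s : ℝ) : ℝ := 2 * s * Real.exp (-s ^ 2)
noncomputable def w1 (s : ℝ) : ℝ := -(2 * Real.exp (-s ^ 2))
noncomputable def w2 (s : ℝ) : ℝ := 2 * Real.exp (-s ^ 2) * s⁻¹

noncomputable def Rop (g : EE m → ℝ) : EE m → ℝ := IW w0 gk g
noncomputable def D1 (g : EE m → ℝ) : EE m → ED m := IW w1 Dk1 g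
noncomputable def D2 (g : EE m → ℝ) : EE m → EE m →L[ℝ] ED m := IW w2 Dk2 g

lemma w0_cont : ContinuousOn w0 (Ioi 0) := by unfold w0; fun_prop
lemma w1_cont : ContinuousOn w1 (Ioi 0) := by unfold w1; fun_prop
lemma w2_cont : ContinuousOn w2 (Ioi 0) := by
  unfold w2
  exact ContinuousOn.mul (by fun_prop) (continuousOn_inv₀.mono fun s hs => ne_of_gt hs)

lemma int_w0 : IntegrableOn w0 (Ioi 0) := by
  have := integrableOn_rpow_mul_exp_neg_mul_sq (b := 1) one_pos (s := 1) (by norm_num)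
  refine (this.const_mul 2).congr (Eventually.of_forall fun s => ?_)
  simp [w0]; ring

lemma int_w1 : IntegrableOn (fun s : ℝ => 2 * Real.exp (-s ^ 2)) (Ioi 0) := by
  have := integrableOn_rpow_mul_exp_neg_mul_sq (b := 1) one_pos (s := 0) (by norm_num)
  refine (this.const_mul 2).congr (Eventually.of_forall fun s => ?_)
  simp

lemma int_wh : IntegrableOn (fun s : ℝ => 2 * Real.exp (-s ^ 2) * (√s)⁻¹) (Ioi 0) := by
  have := integrableOn_rpow_mul_exp_neg_mul_sq (b := 1) one_pos (s := -(1/2)) (by norm_num)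
  refine (this.const_mul 2).congr ((ae_restrict_mem measurableSet_Ioi).mono fun s hs => ?_)
  have : s ^ (-(1/2) : ℝ) = (√s)⁻¹ := by
    rw [Real.rpow_neg (le_of_lt hs), Real.sqrt_eq_rpow]
  simp only [this]; simp; ring

noncomputable def CK (m : ℕ) : ℝ := 4 * gc m * J4 m + 4 * gc m * J8 m

lemma CK_nonneg (m : ℕ) : 0 ≤ CK m := by
  have := gc_pos m; have := J4_nonneg m; have := J8_nonneg m; unfold CK; positivity

lemma CK4 (m : ℕ) : 4 * gc m * J4 m ≤ CK m := by
  have := gc_pos m; have := J8_nonneg m; unfold CK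
  have : 0 ≤ 4 * gc m * J8 m := by positivity
  linarith

lemma CK8 (m : ℕ) : 4 * gc m * J8 m ≤ CK m := by
  have := gc_pos m; have := J4_nonneg m; unfold CK
  have : 0 ≤ 4 * gc m * J4 m := by positivity
  linarith

lemma bd0 {g : EE m → ℝ} {B : ℝ} (hB : ∀ x, |g x| ≤ B) (x : EE m) (s : ℝ) (hs : 0 < s) :
    ‖w0 s • TT gk s g x‖ ≤ w0 s * (B * CK m) := by
  have hB0 : 0 ≤ B := (abs_nonneg _).trans (hB 0)
  have h : 0 ≤ w0 s := by unfold w0; positivity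
  rw [norm_smul, Real.norm_of_nonneg h]
  gcongr
  exact (TT_bound good_gk hB s x).trans (mul_le_mul_of_nonneg_left (CK4 m) hB0)

lemma bd1 {g : EE m → ℝ} {B : ℝ} (hB : ∀ x, |g x| ≤ B) (x : EE m) (s : ℝ) :
    ‖w1 s • TT Dk1 s g x‖ ≤ 2 * Real.exp (-s ^ 2) * (B * CK m) := by
  have hB0 : 0 ≤ B := (abs_nonneg _).trans (hB 0)
  have h : ‖w1 s‖ = 2 * Real.exp (-s ^ 2) := by unfold w1; rw [norm_neg, Real.norm_of_nonneg (by positivity)]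
  rw [norm_smul, h]
  gcongr
  exact (TT_bound good_Dk1 hB s x).trans (mul_le_mul_of_nonneg_left (CK4 m) hB0)

lemma bd2 {g : EE m → ℝ} (hg : Continuous g) {B : ℝ} (hB : ∀ x, |g x| ≤ B) {K : ℝ} (hK0 : 0 ≤ K)
    (hK : ∀ x y, |g x - g y| ≤ K * √‖x - y‖) (x : EE m) (s : ℝ) (hs : 0 < s) :
    ‖w2 s • TT Dk2 s g x‖ ≤ 2 * Real.exp (-s ^ 2) * (√s)⁻¹ * (K * CK m) := by
  have h : 0 ≤ w2 s := by unfold w2; positivity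
  rw [norm_smul, Real.norm_of_nonneg h]
  have h1 := (TT_Dk2_holder hg hB hK0 hK hs x).trans
    (mul_le_mul_of_nonneg_left (CK8 m) (by positivity))
  refine (mul_le_mul_of_nonneg_left h1 h).trans (le_of_eq ?_)
  unfold w2
  have hs' : √s ≠ 0 := (Real.sqrt_pos.2 hs).ne'
  have : s⁻¹ = (√s)⁻¹ * (√s)⁻¹ := by rw [← mul_inv, Real.mul_self_sqrt hs.le]
  rw [this]
  field_simp

lemma Rop_hasFDerivAt {g : EE m → ℝ} (hg : Continuous g) {B : ℝ} (hB : ∀ x, |g x| ≤ B) (x : EE m) :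
    HasFDerivAt (Rop g) (D1 g x) x :=
  IW_hasFDerivAt w0_cont w1_cont good_gk good_Dk1 hasFDerivAt_gk
    (fun s hs => by unfold w0 w1; field_simp) hg hB (int_w0.mul_const _) (int_w1.mul_const _)
    (bd0 hB) (fun x s _ => bd1 hB x s) x

lemma D1_hasFDerivAt {g : EE m → ℝ} (hg : Continuous g) {B : ℝ} (hB : ∀ x, |g x| ≤ B)
    {K : ℝ} (hK0 : 0 ≤ K) (hK : ∀ x y, |g x - g y| ≤ K * √‖x - y‖) (x : EE m) :
    HasFDerivAt (D1 g) (D2 g x) x :=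
  IW_hasFDerivAt w1_cont w2_cont good_Dk1 good_Dk2 hasFDerivAt_Dk1
    (fun s hs => by unfold w1 w2; field_simp) hg hB (int_w1.mul_const _) (int_wh.mul_const _)
    (fun x s _ => bd1 hB x s) (bd2 hg hB hK0 hK) x

lemma D2_continuous {g : EE m → ℝ} (hg : Continuous g) {B : ℝ} (hB : ∀ x, |g x| ≤ B)
    {K : ℝ} (hK0 : 0 ≤ K) (hK : ∀ x y, |g x - g y| ≤ K * √‖x - y‖) :
    Continuous (D2 g) :=
  IW_continuous w2_cont good_Dk2 hg hB (int_wh.mul_const _) (bd2 hg hB hK0 hK)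

lemma Rop_contDiff {g : EE m → ℝ} (hg : Continuous g) {B : ℝ} (hB : ∀ x, |g x| ≤ B)
    {K : ℝ} (hK0 : 0 ≤ K) (hK : ∀ x y, |g x - g y| ≤ K * √‖x - y‖) :
    ContDiff ℝ 2 (Rop g) := by
  have e1 : fderiv ℝ (Rop g) = D1 g := funext fun x => (Rop_hasFDerivAt hg hB x).fderiv
  have e2 : fderiv ℝ (D1 g) = D2 g := funext fun x => (D1_hasFDerivAt hg hB hK0 hK x).fderiv
  rw [show (2 : WithTop ℕ∞) = 1 + 1 by norm_num, contDiff_succ_iff_fderiv]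
  refine ⟨fun x => (Rop_hasFDerivAt hg hB x).differentiableAt, by simp, ?_⟩
  rw [e1, contDiff_one_iff_fderiv, e2]
  exact ⟨fun x => (D1_hasFDerivAt hg hB hK0 hK x).differentiableAt, D2_continuous hg hB hK0 hK⟩

lemma Rop_eq {g : EE m → ℝ} (hg : Continuous g) {B : ℝ} (hB : ∀ x, |g x| ≤ B)
    {K : ℝ} (hK0 : 0 ≤ K) (hK : ∀ x y, |g x - g y| ≤ K * √‖x - y‖) (x : EE m) :
    Rop g x - 1/2 * Lc (Rop g) x = g x := by
  have e1 : fderiv ℝ (Rop g) = D1 g := funext fun x => (Rop_hasFDerivAt hg hB x).fderiv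
  have e2 : fderiv ℝ (D1 g) = D2 g := funext fun x => (D1_hasFDerivAt hg hB hK0 hK x).fderiv
  unfold Lc
  rw [e1, e2]
  have hi0 := IW_int w0_cont good_gk hg hB (int_w0.mul_const _) x (bd0 hB x)
  have hi2 := IW_int w2_cont good_Dk2 hg hB (int_wh.mul_const _) x (bd2 hg hB hK0 hK x)
  have et : trc (D2 g x) = ∫ s in Ioi (0:ℝ), w2 s * TT (fun z => trc (Dk2 z)) s g x := by
    unfold D2 IW
    rw [← trcL_apply, ← ContinuousLinearMap.integral_comp_comm _ hi2]
    refine integral_congr_ae (Eventually.of_forall fun s => ?_)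
    simp only [map_smul, trcL_apply, trc_TT hg hB, smul_eq_mul]
  have hi2' : IntegrableOn (fun s => w2 s * TT (fun z => trc (Dk2 z)) s g x) (Ioi 0) := by
    refine ((trcL m).integrable_comp hi2).congr (Eventually.of_forall fun s => ?_)
    simp only [map_smul, trcL_apply, trc_TT hg hB, smul_eq_mul]
  have hd : ∀ s ∈ Ioi (0:ℝ), HasDerivAt (fun s => -(Real.exp (-s ^ 2) * TT gk s g x))
      (w0 s • TT gk s g x - 1/2 * (w2 s * TT (fun z => trc (Dk2 z)) s g x)) s := by
    intro s hs
    have h1 : HasDerivAt (fun s : ℝ => Real.exp (-s ^ 2)) (Real.exp (-s^2) * (-(2 * s))) s := by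
      simpa using ((hasDerivAt_pow 2 s).neg).exp
    refine ((h1.mul (TT_hasDerivAt_s hg hB hs x)).neg).congr_deriv ?_
    have : s ≠ 0 := ne_of_gt hs
    simp only [w0, w2, smul_eq_mul]; field_simp; ring
  have hcont : ContinuousWithinAt (fun s => -(Real.exp (-s ^ 2) * TT gk s g x)) (Ici 0) 0 := by
    have := ((TT_continuous good_gk hg hB).comp (by fun_prop : Continuous fun s : ℝ => (s, x)))
    have h2 : Continuous (fun s => TT gk s g x) := this
    exact (by fun_prop : Continuous (fun s => -(Real.exp (-s ^ 2) * TT gk s g x))).continuousWithinAt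
  have hlim : Tendsto (fun s : ℝ => -(Real.exp (-s ^ 2) * TT gk s g x)) atTop (𝓝 0) := by
    have h1 : Tendsto (fun s : ℝ => Real.exp (-s ^ 2) * (B * (4 * gc m * J4 m))) atTop (𝓝 0) := by
      have : Tendsto (fun s : ℝ => -s ^ 2) atTop atBot :=
        tendsto_neg_atTop_atBot.comp (tendsto_pow_atTop two_ne_zero)
      simpa using (Real.tendsto_exp_atBot.comp this).mul_const (B * (4 * gc m * J4 m))
    refine squeeze_zero_norm (fun s => ?_) h1
    rw [norm_neg, norm_mul, Real.norm_of_nonneg (Real.exp_pos _).le]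
    gcongr
    exact TT_bound good_gk hB s x
  have := integral_Ioi_of_hasDerivAt_of_tendsto hcont hd (hi0.sub (hi2'.const_mul _)) hlim
  have ez : TT gk 0 g x = g x := by
    unfold TT
    simp only [zero_smul, add_zero, smul_eq_mul]
    rw [integral_const_mul, integral_gk, mul_one]
  rw [integral_sub hi0 (hi2'.const_mul _), integral_const_mul, ← et] at this
  simp only [ez] at this
  unfold Rop IW
  rw [this]; simp

noncomputable def CR (m : ℕ) : ℝ :=
  (∫ s in Ioi (0:ℝ), w0 s) * CK m + (∫ s in Ioi (0:ℝ), 2 * Real.exp (-s ^ 2)) * CK m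
   + (∫ s in Ioi (0:ℝ), 2 * Real.exp (-s ^ 2) * (√s)⁻¹) * (2 * CK m) + 1

lemma CR_parts (m : ℕ) : 0 < CR m ∧ (∫ s in Ioi (0:ℝ), w0 s) * CK m ≤ CR m ∧
    (∫ s in Ioi (0:ℝ), 2 * Real.exp (-s ^ 2)) * CK m ≤ CR m ∧
    (∫ s in Ioi (0:ℝ), 2 * Real.exp (-s ^ 2) * (√s)⁻¹) * (2 * CK m) ≤ CR m := by
  have h := CK_nonneg m
  have h0 : 0 ≤ ∫ s in Ioi (0:ℝ), w0 s := setIntegral_nonneg measurableSet_Ioi fun s hs => by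
    have : 0 < s := hs
    unfold w0; positivity
  have h1 : 0 ≤ ∫ s in Ioi (0:ℝ), 2 * Real.exp (-s ^ 2) := integral_nonneg fun s => by positivity
  have h2 : 0 ≤ ∫ s in Ioi (0:ℝ), 2 * Real.exp (-s ^ 2) * (√s)⁻¹ := integral_nonneg fun s => by positivity
  have := mul_nonneg h0 h
  have := mul_nonneg h1 h
  have := mul_nonneg h2 (mul_nonneg two_pos.le h)
  unfold CR
  refine ⟨?_, ?_, ?_, ?_⟩ <;> linarith

lemma Rop_bound {g : EE m → ℝ} {B : ℝ} (hB : ∀ x, |g x| ≤ B) (x : EE m) :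
    |Rop g x| ≤ CR m * B := by
  have hB0 : 0 ≤ B := (abs_nonneg _).trans (hB 0)
  have := IW_bound (int_w0.mul_const _) x (bd0 hB x)
  rw [integral_mul_const] at this
  refine this.trans ?_
  calc _ = ((∫ s in Ioi (0:ℝ), w0 s) * CK m) * B := by ring
    _ ≤ _ := mul_le_mul_of_nonneg_right (CR_parts m).2.1 hB0

lemma D1_bound {g : EE m → ℝ} {B : ℝ} (hB : ∀ x, |g x| ≤ B) (x : EE m) :
    ‖D1 g x‖ ≤ CR m * B := by
  have hB0 : 0 ≤ B := (abs_nonneg _).trans (hB 0)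
  have := IW_bound (int_w1.mul_const _) x (fun s _ => bd1 hB x s)
  rw [integral_mul_const] at this
  refine this.trans ?_
  calc _ = ((∫ s in Ioi (0:ℝ), 2 * Real.exp (-s ^ 2)) * CK m) * B := by ring
    _ ≤ _ := mul_le_mul_of_nonneg_right (CR_parts m).2.2.1 hB0

lemma D1_continuous {g : EE m → ℝ} (hg : Continuous g) {B : ℝ} (hB : ∀ x, |g x| ≤ B) :
    Continuous (D1 g) :=
  IW_continuous w1_cont good_Dk1 hg hB (int_w1.mul_const _) (fun x s _ => bd1 hB x s)

lemma D1_sub {g g' : EE m → ℝ} (hg : Continuous g) {B B' : ℝ} (hB : ∀ x, |g x| ≤ B)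
    (hg' : Continuous g') (hB' : ∀ x, |g' x| ≤ B') (x : EE m) :
    D1 (fun y => g y - g' y) x = D1 g x - D1 g' x := by
  have h1 := IW_int w1_cont good_Dk1 hg hB (int_w1.mul_const _) x (fun s _ => bd1 hB x s)
  have h2 := IW_int w1_cont good_Dk1 hg' hB' (int_w1.mul_const _) x (fun s _ => bd1 hB' x s)
  unfold D1 IW
  rw [← integral_sub h1 h2]
  refine integral_congr_ae (Eventually.of_forall fun s => ?_)
  simp only [TT_sub good_Dk1 hg hB hg' hB', smul_sub]

lemma Rop_sub {g g' : EE m → ℝ} (hg : Continuous g) {B B' : ℝ} (hB : ∀ x, |g x| ≤ B)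
    (hg' : Continuous g') (hB' : ∀ x, |g' x| ≤ B') (x : EE m) :
    Rop (fun y => g y - g' y) x = Rop g x - Rop g' x := by
  have h1 := IW_int w0_cont good_gk hg hB (int_w0.mul_const _) x (bd0 hB x)
  have h2 := IW_int w0_cont good_gk hg' hB' (int_w0.mul_const _) x (bd0 hB' x)
  unfold Rop IW
  rw [← integral_sub h1 h2]
  refine integral_congr_ae (Eventually.of_forall fun s => ?_)
  simp only [TT_sub good_gk hg hB hg' hB', smul_sub]

lemma D1_holder {g : EE m → ℝ} (hg : Continuous g) {B : ℝ} (hB : ∀ x, |g x| ≤ B) (x y : EE m) :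
    ‖D1 g x - D1 g y‖ ≤ CR m * B * √‖x - y‖ := by
  have hB0 : 0 ≤ B := (abs_nonneg _).trans (hB 0)
  have hCK := CK_nonneg m
  have h1 := IW_int w1_cont good_Dk1 hg hB (int_w1.mul_const _) x (fun s _ => bd1 hB x s)
  have h2 := IW_int w1_cont good_Dk1 hg hB (int_w1.mul_const _) y (fun s _ => bd1 hB y s)
  have key : ∀ s, 0 < s → ‖TT Dk1 s g x - TT Dk1 s g y‖ ≤ 2 * (B * CK m) * (√s)⁻¹ * √‖x - y‖ := by
    intro s hs
    have ha : ‖TT Dk1 s g x - TT Dk1 s g y‖ ≤ 2 * (B * CK m) := by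
      have a1 := (TT_bound good_Dk1 hB s x).trans (mul_le_mul_of_nonneg_left (CK4 m) hB0)
      have a2 := (TT_bound good_Dk1 hB s y).trans (mul_le_mul_of_nonneg_left (CK4 m) hB0)
      exact (norm_sub_le _ _).trans (by linarith)
    have hb : ‖TT Dk1 s g x - TT Dk1 s g y‖ ≤ s⁻¹ * (B * CK m) * ‖x - y‖ := by
      refine Convex.norm_image_sub_le_of_norm_hasFDerivWithin_le (s := univ)
        (fun z _ => (TT_hasFDerivAt good_Dk1 good_Dk2 hasFDerivAt_Dk1 hg hB hs z).hasFDerivWithinAt)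
        (fun z _ => ?_) convex_univ (mem_univ _) (mem_univ _)
      rw [norm_smul, norm_neg, Real.norm_of_nonneg (by positivity)]
      gcongr
      exact (TT_bound good_Dk2 hB s z).trans (mul_le_mul_of_nonneg_left (CK4 m) hB0)
    set d := ‖x - y‖
    have hsq := Real.sqrt_pos.2 hs
    rcases le_total s d with h | h
    · refine ha.trans ?_
      rw [mul_assoc]
      refine le_mul_of_one_le_right (by positivity) ?_
      rw [inv_mul_eq_div, le_div_iff₀ hsq, one_mul]
      exact Real.sqrt_le_sqrt h
    · refine hb.trans ?_
      have hd0 : 0 ≤ d := norm_nonneg _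
      have e1 : s⁻¹ * d = ((√s)⁻¹ * √d) * ((√s)⁻¹ * √d) := by
        have : s⁻¹ = (√s)⁻¹ * (√s)⁻¹ := by rw [← mul_inv, Real.mul_self_sqrt hs.le]
        rw [this]
        nth_rewrite 1 [← Real.mul_self_sqrt hd0]; ring
      have e2 : (√s)⁻¹ * √d ≤ 1 := by
        rw [inv_mul_eq_div, div_le_one hsq]; exact Real.sqrt_le_sqrt h
      have e3 : 0 ≤ (√s)⁻¹ * √d := by positivity
      have e4 : 0 ≤ B * CK m := by positivity
      calc s⁻¹ * (B * CK m) * d = (B * CK m) * (s⁻¹ * d) := by ring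
        _ ≤ (B * CK m) * (2 * ((√s)⁻¹ * √d)) := by
          refine mul_le_mul_of_nonneg_left ?_ e4
          rw [e1]; nlinarith
        _ = _ := by ring
  have e : D1 g x - D1 g y = ∫ s in Ioi (0:ℝ), w1 s • (TT Dk1 s g x - TT Dk1 s g y) := by
    unfold D1 IW
    rw [← integral_sub h1 h2]
    simp only [smul_sub]
  rw [e]
  have hh := norm_integral_le_of_norm_le (int_wh.mul_const (2 * (B * CK m) * √‖x - y‖))
    ((ae_restrict_mem measurableSet_Ioi).mono fun s hs => (?_ : ‖w1 s • (TT Dk1 s g x - TT Dk1 s g y)‖ ≤ _))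
  · refine hh.trans ?_
    rw [integral_mul_const]
    calc _ = ((∫ s in Ioi (0:ℝ), 2 * Real.exp (-s ^ 2) * (√s)⁻¹) * (2 * CK m)) * (B * √‖x - y‖) := by ring
      _ ≤ CR m * (B * √‖x - y‖) := mul_le_mul_of_nonneg_right (CR_parts m).2.2.2 (by positivity)
      _ = _ := by ring
  · have h : ‖w1 s‖ = 2 * Real.exp (-s ^ 2) := by
      unfold w1; rw [norm_neg, Real.norm_of_nonneg (by positivity)]
    rw [norm_smul, h]
    refine (mul_le_mul_of_nonneg_left (key s hs) (by positivity)).trans (le_of_eq ?_)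
    ring

end

open Filter
open scoped Topology
set_option maxSynthPendingDepth 3

section
open Set
open scoped BoundedContinuousFunction
variable {m : ℕ}

lemma holder_of_lip {g : EE m → ℝ} {B L : ℝ} (hL0 : 0 ≤ L) (hB : ∀ x, |g x| ≤ B)
    (hL : ∀ x y, |g x - g y| ≤ L * ‖x - y‖) (x y : EE m) :
    |g x - g y| ≤ (2 * B + L) * √‖x - y‖ := by
  have hB0 : 0 ≤ B := (abs_nonneg _).trans (hB 0)
  set d := ‖x - y‖ with hd
  have hd0 : 0 ≤ d := norm_nonneg _
  have hs := Real.sqrt_nonneg d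
  have hss := Real.mul_self_sqrt hd0
  rcases le_total d 1 with h | h
  · have h1 : √d ≤ 1 := Real.sqrt_le_one.2 h
    have h2 : d ≤ √d := by nlinarith
    have h3 := hL x y
    rw [← hd] at h3
    nlinarith [mul_le_mul_of_nonneg_left h2 hL0, mul_nonneg hB0 hs]
  · have h1 : 1 ≤ √d := Real.one_le_sqrt.2 h
    have h3 : |g x - g y| ≤ 2 * B := (abs_sub _ _).trans (by linarith [hB x, hB y])
    nlinarith [mul_nonneg hL0 hs]

lemma small_exists {ℓ : ℝ} (hℓ0 : 0 ≤ ℓ) (hℓ : CR m * ℓ ≤ 1 / 2) {H : ED m → ℝ}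
    (hH : ∀ p q, |H p - H q| ≤ ℓ * ‖p - q‖) {f : EE m → ℝ} (hf : Continuous f) {B : ℝ}
    (hB : ∀ x, |f x| ≤ B) {K : ℝ} (hK0 : 0 ≤ K) (hK : ∀ x y, |f x - f y| ≤ K * √‖x - y‖) :
    ∃ u : EE m → ℝ, ContDiff ℝ 2 u ∧ (∃ Bu, ∀ x, |u x| ≤ Bu) ∧
      ∀ x, u x - 1/2 * Lc u x + H (fderiv ℝ u x) = f x := by
  have hHc : Continuous H := by
    refine LipschitzWith.continuous (K := ⟨ℓ, hℓ0⟩) (LipschitzWith.of_dist_le_mul fun p q => ?_)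
    rw [Real.dist_eq, dist_eq_norm]; exact hH p q
  set G : (EE m →ᵇ ED m) → EE m → ℝ := fun p x => f x - H (p x) with hG
  have hGc : ∀ p, Continuous (G p) := fun p => hf.sub (hHc.comp p.continuous)
  have hGB : ∀ p : EE m →ᵇ ED m, ∀ x, |G p x| ≤ B + (|H 0| + ℓ * ‖p‖) := by
    intro p x
    refine (abs_sub _ _).trans (add_le_add (hB x) ?_)
    have h1 := hH (p x) 0
    rw [sub_zero] at h1
    have h2 : ℓ * ‖p x‖ ≤ ℓ * ‖p‖ := mul_le_mul_of_nonneg_left (p.norm_coe_le_norm x) hℓ0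
    have h3 := abs_sub_abs_le_abs_sub (H (p x)) (H 0)
    linarith
  set Φ : (EE m →ᵇ ED m) → (EE m →ᵇ ED m) := fun p =>
    BoundedContinuousFunction.ofNormedAddCommGroup (D1 (G p)) (D1_continuous (hGc p) (hGB p)) _
      (D1_bound (hGB p)) with hΦ
  have hctr : ContractingWith (1/2) Φ := by
    refine ⟨by norm_num, LipschitzWith.of_dist_le_mul fun p q => ?_⟩
    rw [BoundedContinuousFunction.dist_le (by positivity)]
    intro x
    have e : Φ p x - Φ q x = D1 (fun y => G p y - G q y) x :=
      (D1_sub (hGc p) (hGB p) (hGc q) (hGB q) x).symm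
    rw [dist_eq_norm, e]
    have := D1_bound (g := fun y => G p y - G q y) (B := ℓ * dist p q) (fun y => ?_) x
    · refine this.trans ?_
      rw [← mul_assoc]
      refine mul_le_mul_of_nonneg_right ?_ dist_nonneg
      simpa using hℓ
    · simp only [hG]
      rw [show f y - H (p y) - (f y - H (q y)) = H (q y) - H (p y) by ring]
      refine (hH _ _).trans (mul_le_mul_of_nonneg_left ?_ hℓ0)
      rw [← dist_eq_norm, dist_comm]
      exact BoundedContinuousFunction.dist_coe_le_dist y
  set p := hctr.fixedPoint Φ with hp
  have hfix : Φ p = p := hctr.fixedPoint_isFixedPt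
  have hpx : ∀ x, D1 (G p) x = p x := fun x => by
    have := congrArg (fun q : EE m →ᵇ ED m => q x) hfix
    exact this
  set Bg := B + (|H 0| + ℓ * ‖p‖) with hBg
  have hB0 : 0 ≤ B := (abs_nonneg _).trans (hB 0)
  have hBg0 : 0 ≤ Bg := by positivity
  have hCR := (CR_parts m).1
  have hKg : ∀ x y, |G p x - G p y| ≤ (K + ℓ * (CR m * Bg)) * √‖x - y‖ := by
    intro x y
    have h1 := hK x y
    have h2 := hH (p x) (p y)
    have h3 := D1_holder (hGc p) (hGB p) x y
    rw [hpx, hpx] at h3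
    have h4 := mul_le_mul_of_nonneg_left h3 hℓ0
    simp only [hG]
    rw [show f x - H (p x) - (f y - H (p y)) = (f x - f y) - (H (p x) - H (p y)) by ring]
    refine (abs_sub _ _).trans ?_
    nlinarith
  have hK1 : 0 ≤ K + ℓ * (CR m * Bg) := by positivity
  refine ⟨Rop (G p), Rop_contDiff (hGc p) (hGB p) hK1 hKg, ⟨_, Rop_bound (hGB p)⟩, fun x => ?_⟩
  rw [Rop_eq (hGc p) (hGB p) hK1 hKg, (Rop_hasFDerivAt (hGc p) (hGB p) x).fderiv, hpx]
  simp [hG]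

lemma Lc_translate {u : EE m → ℝ} (h x : EE m) :
    fderiv ℝ (fun y => u (y + h)) x = fderiv ℝ u (x + h) ∧
    Lc (fun y => u (y + h)) x = Lc u (x + h) := by
  have e : fderiv ℝ (fun y => u (y + h)) = fun x => fderiv ℝ u (x + h) :=
    funext fun x => fderiv_comp_add_right h
  refine ⟨congrFun e x, ?_⟩
  unfold Lc
  rw [e, fderiv_comp_add_right h]

lemma trans_lip {ρ ℓ Λ B : ℝ} (hρ : 0 < ρ) {H : ED m → ℝ}
    (hH : ∀ p q, |H p - H q| ≤ ℓ * ‖p - q‖) {u f : EE m → ℝ} (hu : ContDiff ℝ 2 u)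
    (hB : ∀ x, |u x| ≤ B) (hf : ∀ x y, |f x - f y| ≤ Λ * ‖x - y‖)
    (h : ∀ x, ρ * u x - 1/2 * Lc u x + H (fderiv ℝ u x) = f x) (x y : EE m) :
    |u x - u y| ≤ Λ / ρ * ‖x - y‖ := by
  have key : ∀ x y, u x - u y ≤ Λ / ρ * ‖x - y‖ := by
    intro x y
    have := comparison (u := fun z => u (z + (x - y))) (v := u) (B := B + B)
      (δ := Λ * ‖x - y‖) hρ hH (hu.comp (contDiff_id.add contDiff_const)) hu
      (fun z => ?_) (fun z => ?_) y
    · simp only [add_sub_cancel] at this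
      rw [div_mul_eq_mul_div, le_div_iff₀ hρ]
      linarith
    · have h1 := hB (z + (x - y)); have h2 := hB z
      rw [abs_le] at h1 h2; linarith
    · rw [(Lc_translate (u := u) (x - y) z).1, (Lc_translate (u := u) (x - y) z).2, h, h]
      have := hf (z + (x - y)) z
      rw [add_sub_cancel_left] at this
      have := (abs_le.1 this).2
      linarith
  rw [abs_le]
  have h1 := key x y; have h2 := key y x
  rw [norm_sub_rev] at h2
  constructor <;> linarith

lemma rho_exists {ℓ ρ : ℝ} (hρ : 0 < ρ) (hρ1 : ρ < 1) (hℓ0 : 0 ≤ ℓ) (hℓ : CR m * ℓ ≤ 1 / 2)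
    {H : ED m → ℝ} (hH : ∀ p q, |H p - H q| ≤ ℓ * ‖p - q‖) {f : EE m → ℝ} {B L : ℝ}
    (hB : ∀ x, |f x| ≤ B) (hL0 : 0 ≤ L) (hL : ∀ x y, |f x - f y| ≤ L * ‖x - y‖) :
    ∃ u : EE m → ℝ, ContDiff ℝ 2 u ∧ (∃ Bu, ∀ x, |u x| ≤ Bu) ∧
      ∀ x, ρ * u x - 1/2 * Lc u x + H (fderiv ℝ u x) = f x := by
  set Λ := L / ρ with hΛ
  have hΛ0 : 0 ≤ Λ := by positivity
  have hΛe : L + (1 - ρ) * Λ = Λ := by rw [hΛ]; field_simp; ring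
  have hfc : Continuous f := by
    refine LipschitzWith.continuous (K := ⟨L, hL0⟩) (LipschitzWith.of_dist_le_mul fun p q => ?_)
    rw [Real.dist_eq, dist_eq_norm]; exact hL p q
  set s : Set (EE m →ᵇ ℝ) := {v | ∀ x y, |v x - v y| ≤ Λ * ‖x - y‖} with hs
  have hglip : ∀ v ∈ s, ∀ x y, |(f x + (1 - ρ) * v x) - (f y + (1 - ρ) * v y)| ≤ Λ * ‖x - y‖ := by
    intro v hv x y
    have h1 := hL x y
    have h2 := hv x y
    have e : (f x + (1 - ρ) * v x) - (f y + (1 - ρ) * v y) = (f x - f y) + (1 - ρ) * (v x - v y) := by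
      ring
    rw [e, ← hΛe]
    refine (abs_add_le _ _).trans ?_
    rw [abs_mul, abs_of_pos (sub_pos.2 hρ1)]
    have := mul_le_mul_of_nonneg_left h2 (sub_pos.2 hρ1).le
    linarith
  have hex : ∀ v : EE m →ᵇ ℝ, ∃ u : EE m →ᵇ ℝ, v ∈ s → (ContDiff ℝ 2 u ∧ u ∈ s ∧
      ∀ x, u x - 1/2 * Lc u x + H (fderiv ℝ u x) = f x + (1 - ρ) * v x) := by
    intro v
    by_cases hv : v ∈ s
    · have hgb : ∀ x, |f x + (1 - ρ) * v x| ≤ B + (1 - ρ) * ‖v‖ := fun x => by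
        refine (abs_add_le _ _).trans (add_le_add (hB x) ?_)
        rw [abs_mul, abs_of_pos (sub_pos.2 hρ1)]
        exact mul_le_mul_of_nonneg_left (v.norm_coe_le_norm x) (sub_pos.2 hρ1).le
      obtain ⟨u, hu, ⟨Bu, hBu⟩, heq⟩ := small_exists hℓ0 hℓ hH (f := fun x => f x + (1 - ρ) * v x)
        (by have := v.continuous; fun_prop) hgb
        (K := 2 * (B + (1 - ρ) * ‖v‖) + Λ)
        (by have := (abs_nonneg _).trans (hgb 0); positivity) (holder_of_lip hΛ0 hgb (hglip v hv))
      refine ⟨BoundedContinuousFunction.ofNormedAddCommGroup u hu.continuous Bu hBu, fun _ => ⟨hu, ?_, heq⟩⟩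
      intro x y
      have := trans_lip one_pos hH hu hBu (hglip v hv) (by simpa using heq) x y
      simpa using this
    · exact ⟨v, fun h => absurd h hv⟩
  choose Φ hΦ using hex
  have hmaps : MapsTo Φ s s := fun v hv => (hΦ v hv).2.1
  have hclosed : IsClosed s := by
    have e : s = ⋂ x, ⋂ y, {v : EE m →ᵇ ℝ | |v x - v y| ≤ Λ * ‖x - y‖} := by
      ext v; simp [hs]
    rw [e]
    refine isClosed_iInter fun x => isClosed_iInter fun y => ?_
    refine isClosed_le ?_ continuous_const
    have hev : ∀ x : EE m, Continuous fun v : EE m →ᵇ ℝ => v x := fun x => continuous_eval_const x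
    exact ((hev x).sub (hev y)).abs
  have hctr : ContractingWith ⟨1 - ρ, (sub_pos.2 hρ1).le⟩ (hmaps.restrict Φ s s) := by
    refine ⟨NNReal.coe_lt_coe.1 (by change 1 - ρ < 1; linarith), LipschitzWith.of_dist_le_mul fun v w => ?_⟩
    have key : ∀ v w : EE m →ᵇ ℝ, v ∈ s → w ∈ s → ∀ x, Φ v x - Φ w x ≤ (1 - ρ) * dist v w := by
      intro v w hv hw x
      obtain ⟨a1, a2, a3⟩ := hΦ v hv
      obtain ⟨b1, b2, b3⟩ := hΦ w hw
      have := comparison one_pos hH a1 b1 (B := ‖Φ v‖ + ‖Φ w‖) (δ := (1 - ρ) * dist v w)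
        (fun z => ?_) (fun z => ?_) x
      · linarith
      · have h1 := (abs_le.1 ((Φ v).norm_coe_le_norm z)).2
        have h2 := (abs_le.1 ((Φ w).norm_coe_le_norm z)).1
        linarith
      · rw [one_mul, one_mul, a3, b3]
        have h1 : v z - w z ≤ dist v w := by
          have := BoundedContinuousFunction.dist_coe_le_dist (f := v) (g := w) z
          rw [Real.dist_eq] at this
          exact (le_abs_self _).trans this
        have := mul_le_mul_of_nonneg_left h1 (sub_pos.2 hρ1).le
        linarith
    change dist (Φ v.1) (Φ w.1) ≤ (1 - ρ) * dist v.1 w.1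
    rw [BoundedContinuousFunction.dist_le (mul_nonneg (sub_pos.2 hρ1).le dist_nonneg)]
    intro x
    rw [Real.dist_eq, abs_le]
    have h1 := key v.1 w.1 v.2 w.2 x
    have h2 := key w.1 v.1 w.2 v.2 x
    rw [dist_comm] at h2
    constructor <;> linarith
  obtain ⟨u, hus, hfix, -⟩ := hctr.exists_fixedPoint' hclosed.isComplete hmaps
    (x := 0) (fun x y => by simp; positivity) (edist_ne_top _ _)
  obtain ⟨a1, a2, a3⟩ := hΦ u hus
  rw [hfix.eq] at a1 a3
  exact ⟨u, a1, ⟨‖u‖, fun x => u.norm_coe_le_norm x⟩, fun x => by have := a3 x; linarith⟩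

lemma Lc_scale {u : EE m → ℝ} (hu : ContDiff ℝ 2 u) (κ : ℝ) (x : EE m) :
    fderiv ℝ (fun y => u (κ • y)) x = κ • fderiv ℝ u (κ • x) ∧
    Lc (fun y => u (κ • y)) x = κ ^ 2 * Lc u (κ • x) := by
  obtain ⟨h1, h2, -⟩ := C2_fderiv hu
  have hid : ∀ x : EE m, HasFDerivAt (fun y : EE m => κ • y) (κ • ContinuousLinearMap.id ℝ (EE m)) x :=
    fun x => (hasFDerivAt_id x).const_smul κ
  have e : fderiv ℝ (fun y => u (κ • y)) = fun x => κ • fderiv ℝ u (κ • x) := by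
    ext1 x
    refine ((h1 (κ • x)).comp x (hid x)).fderiv.trans ?_
    ext a; simp
  refine ⟨congrFun e x, ?_⟩
  unfold Lc
  rw [e]
  have := (((h2 (κ • x)).comp x (hid x)).const_smul κ).fderiv
  have e2 : fderiv ℝ (fun x => κ • fderiv ℝ u (κ • x)) x = κ^2 • fderiv ℝ (fderiv ℝ u) (κ • x) := by
    refine this.trans ?_
    ext a b; simp; ring
  rw [e2, trc_smul]

lemma lip_exists {ℓ ρ : ℝ} (hρ : 0 < ρ) (hℓ0 : 0 ≤ ℓ)
    {H : ED m → ℝ} (hH : ∀ p q, |H p - H q| ≤ ℓ * ‖p - q‖) {f : EE m → ℝ} {B L : ℝ}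
    (hB : ∀ x, |f x| ≤ B) (hL0 : 0 ≤ L) (hL : ∀ x y, |f x - f y| ≤ L * ‖x - y‖) :
    ∃ u : EE m → ℝ, ContDiff ℝ 2 u ∧ (∃ Bu, ∀ x, |u x| ≤ Bu) ∧
      ∀ x, ρ * u x - 1/2 * Lc u x + H (fderiv ℝ u x) = f x := by
  have hCR := (CR_parts m).1
  set κ := 1 + ρ + 2 * (CR m * ℓ) with hκ
  have hc : 0 ≤ CR m * ℓ := by positivity
  have hκ1 : 1 ≤ κ := by linarith
  have hκ0 : 0 < κ := by linarith
  have hsq : κ ≤ κ ^ 2 := by nlinarith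
  obtain ⟨u, hu, ⟨Bu, hBu⟩, heq⟩ := rho_exists (m := m) (ρ := ρ / κ ^ 2) (ℓ := ℓ / κ)
    (H := fun p => H (κ • p) / κ ^ 2) (f := fun y => f (κ⁻¹ • y) / κ ^ 2) (B := B / κ ^ 2)
    (L := L / κ ^ 2 * κ⁻¹)
    (by positivity) (by rw [div_lt_one (by positivity)]; linarith) (by positivity)
    (by rw [← mul_div_assoc, div_le_iff₀ hκ0]; linarith)
    (fun p q => by
      rw [← sub_div, abs_div, abs_of_pos (a := κ ^ 2) (by positivity), div_le_iff₀ (by positivity)]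
      refine (hH _ _).trans (le_of_eq ?_)
      rw [← smul_sub, norm_smul, Real.norm_of_nonneg hκ0.le]; field_simp)
    (fun x => by
      rw [abs_div, abs_of_pos (a := κ ^ 2) (by positivity)]
      exact div_le_div_of_nonneg_right (hB _) (by positivity))
    (by positivity)
    (fun x y => by
      rw [← sub_div, abs_div, abs_of_pos (a := κ ^ 2) (by positivity), div_le_iff₀ (by positivity)]
      refine (hL _ _).trans (le_of_eq ?_)
      rw [← smul_sub, norm_smul, Real.norm_of_nonneg (by positivity)]; field_simp)
  refine ⟨fun x => u (κ • x), hu.comp (contDiff_id.const_smul κ), ⟨Bu, fun x => hBu _⟩, fun x => ?_⟩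
  rw [(Lc_scale hu κ x).1, (Lc_scale hu κ x).2]
  have := heq (κ • x)
  simp only [smul_smul, inv_mul_cancel₀ hκ0.ne', one_smul] at this
  field_simp at this
  linarith

lemma rpow_lip {θ M : ℝ} (hθ : 1 < θ) {a b : ℝ} (ha : a ∈ Icc 0 M) (hb : b ∈ Icc 0 M) :
    |a ^ θ - b ^ θ| ≤ θ * M ^ (θ - 1) * |a - b| := by
  refine Convex.norm_image_sub_le_of_norm_hasDerivWithin_le (s := Icc 0 M) (f := fun x => x ^ θ)
    (f' := fun x => θ * x ^ (θ - 1)) (fun x _ => ?_) (fun x hx => ?_) (convex_Icc 0 M) hb ha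
  · exact (Real.hasDerivAt_rpow_const (Or.inr hθ.le)).hasDerivWithinAt
  · have : 0 ≤ x ^ (θ - 1) := Real.rpow_nonneg hx.1 _
    rw [Real.norm_of_nonneg (by positivity)]
    have := Real.rpow_le_rpow hx.1 hx.2 (by linarith : 0 ≤ θ - 1)
    gcongr

theorem propA {ρ θ : ℝ} (hρ : 0 < ρ) (hθ : 1 < θ) {f : EE m → ℝ} {B L : ℝ}
    (hB : ∀ x, |f x| ≤ B) (hL0 : 0 ≤ L) (hL : ∀ x y, |f x - f y| ≤ L * ‖x - y‖) :
    ∃ u : EE m → ℝ, ContDiff ℝ 2 u ∧ (∃ Bu, ∀ x, |u x| ≤ Bu) ∧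
      ∀ x, ρ * u x - 1/2 * Lc u x + (1/θ) * ‖fderiv ℝ u x‖ ^ θ = f x := by
  set M := L / ρ with hM
  have hM0 : 0 ≤ M := by positivity
  have hH : ∀ p q : ED m, |(1/θ) * (min ‖p‖ M) ^ θ - (1/θ) * (min ‖q‖ M) ^ θ|
      ≤ M ^ (θ - 1) * ‖p - q‖ := by
    intro p q
    rw [← mul_sub, abs_mul, abs_of_pos (a := 1 / θ) (by positivity)]
    have h1 := rpow_lip hθ (a := min ‖p‖ M) (b := min ‖q‖ M) (M := M)
      ⟨le_min (norm_nonneg _) hM0, min_le_right _ _⟩ ⟨le_min (norm_nonneg _) hM0, min_le_right _ _⟩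
    have h2 : |min ‖p‖ M - min ‖q‖ M| ≤ ‖p - q‖ := by
      have h3 := abs_min_sub_min_le_max ‖p‖ M ‖q‖ M
      simp only [sub_self, abs_zero] at h3
      rw [max_eq_left (abs_nonneg _)] at h3
      exact h3.trans (abs_norm_sub_norm_le p q)
    have h4 : 0 ≤ M ^ (θ - 1) := Real.rpow_nonneg hM0 _
    calc _ ≤ (1/θ) * (θ * M ^ (θ - 1) * ‖p - q‖) := by gcongr; exact h1.trans (by gcongr)
      _ = _ := by field_simp
  obtain ⟨u, hu, ⟨Bu, hBu⟩, heq⟩ := lip_exists hρ (Real.rpow_nonneg hM0 (θ - 1)) hH hB hL0 hL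
  refine ⟨u, hu, ⟨Bu, hBu⟩, fun x => ?_⟩
  have hlip := trans_lip hρ hH hu hBu hL heq
  have : ‖fderiv ℝ u x‖ ≤ M := by
    have h1 : LipschitzWith ⟨M, hM0⟩ u := LipschitzWith.of_dist_le_mul fun p q => by
      rw [Real.dist_eq, dist_eq_norm]; exact hlip p q
    exact norm_fderiv_le_of_lipschitz ℝ h1
  have h2 := heq x
  rwa [min_eq_left this] at h2

end

open Filter
open scoped Topology
set_option maxSynthPendingDepth 3

section
open Set
variable {m : ℕ}

lemma strict_quot {F : Type*} [NormedAddCommGroup F] [NormedSpace ℝ F] {G : EE m → F}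
    {G' : EE m →L[ℝ] F} {x : EE m} (hG : HasStrictFDerivAt G G' x) {ι : Type*} {l : Filter ι}
    {y : ι → EE m} {h : ι → ℝ} (hy : Tendsto y l (𝓝 x)) (hh : Tendsto h l (𝓝 0))
    (hne : ∀ n, h n ≠ 0) (e : EE m) :
    Tendsto (fun n => (h n)⁻¹ • (G (y n + h n • e) - G (y n))) l (𝓝 (G' e)) := by
  have h1 := hG.isLittleO
  have hlim : Tendsto (fun n => (y n + h n • e, y n)) l (𝓝 (x, x)) := by
    refine Tendsto.prodMk_nhds ?_ hy
    simpa using hy.add (hh.smul_const e)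
  have h2 := h1.comp_tendsto hlim
  have h3 : (fun n => G (y n + h n • e) - G (y n) - G' (h n • e)) =o[l] h := by
    have hO : ((fun p : EE m × EE m => p.1 - p.2) ∘ fun n => (y n + h n • e, y n)) =O[l] h := by
      refine Asymptotics.IsBigO.of_bound ‖e‖ (Eventually.of_forall fun n => ?_)
      simp [norm_smul, mul_comm]
    exact (h2.trans_isBigO hO).congr_left (fun n => by simp)
  have h4 := (h3.const_smul_left (1:ℝ)).tendsto_inv_smul_nhds_zero
  have h5 := h4.add_const (G' e)
  rw [zero_add] at h5
  refine h5.congr fun n => ?_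
  rw [one_smul, smul_sub, map_smul, smul_smul, inv_mul_cancel₀ (hne n), one_smul, sub_add_cancel]

lemma sum_sq_dual (p : ED m) : ∑ i : Fin m, (p (EuclideanSpace.single i 1)) ^ 2 = ‖p‖ ^ 2 := by
  obtain ⟨v, rfl⟩ := (InnerProductSpace.toDual ℝ (EE m)).surjective p
  simp [EuclideanSpace.real_norm_sq_eq, EuclideanSpace.inner_single_right]

lemma Lc_sumsq {U : Fin m → EE m → ℝ} (hU : ∀ k, ContDiff ℝ 2 (U k)) (x : EE m) :
    ContDiff ℝ 2 (fun y => ∑ k, (U k y) ^ 2) ∧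
    fderiv ℝ (fun y => ∑ k, (U k y) ^ 2) x = ∑ k, (2 * U k x) • fderiv ℝ (U k) x ∧
    Lc (fun y => ∑ k, (U k y) ^ 2) x = ∑ k, (2 * ‖fderiv ℝ (U k) x‖ ^ 2 + 2 * U k x * Lc (U k) x) := by
  have hd : ∀ x, HasFDerivAt (fun y => ∑ k, (U k y) ^ 2) (∑ k, (2 * U k x) • fderiv ℝ (U k) x) x := by
    intro x
    have := HasFDerivAt.fun_sum (u := Finset.univ) (A := fun k y => (U k y) ^ 2) (x := x)
      (fun k _ => ((C2_fderiv (hU k)).1 x).pow 2)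
    refine this.congr_fderiv (Finset.sum_congr rfl fun k _ => ?_)
    simp [nsmul_eq_mul]
  have e : fderiv ℝ (fun y => ∑ k, (U k y) ^ 2) = fun x => ∑ k, (2 * U k x) • fderiv ℝ (U k) x :=
    funext fun x => (hd x).fderiv
  refine ⟨ContDiff.sum fun k _ => (hU k).pow 2, congrFun e x, ?_⟩
  unfold Lc
  rw [e]
  have hd2 : HasFDerivAt (fun x => ∑ k, (2 * U k x) • fderiv ℝ (U k) x)
      (∑ k, ((2 * U k x) • fderiv ℝ (fderiv ℝ (U k)) x +
        ((2:ℝ) • fderiv ℝ (U k) x).smulRight (fderiv ℝ (U k) x))) x :=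
    HasFDerivAt.fun_sum (u := Finset.univ) (A := fun k x => (2 * U k x) • fderiv ℝ (U k) x)
      (fun k _ => (((C2_fderiv (hU k)).1 x).const_mul 2).smul ((C2_fderiv (hU k)).2.1 x))
  rw [hd2.fderiv, ← trcL_apply, map_sum]
  refine Finset.sum_congr rfl fun k _ => ?_
  rw [trcL_apply, trc_add, trc_smul, add_comm]
  congr 1
  rw [← sum_sq_dual, Finset.mul_sum]
  unfold trc
  refine Finset.sum_congr rfl fun i _ => ?_
  simp; ring

/-- difference quotient -/
noncomputable def dq (u : EE m → ℝ) (h : ℝ) (k : Fin m) (x : EE m) : ℝ :=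
  h⁻¹ * (u (x + h • EuclideanSpace.single k 1) - u x)

lemma dq_C2 {u : EE m → ℝ} (hu : ContDiff ℝ 2 u) (h : ℝ) (k : Fin m) : ContDiff ℝ 2 (dq u h k) := by
  unfold dq
  exact contDiff_const.mul ((hu.comp (contDiff_id.add contDiff_const)).sub hu)

lemma dq_deriv {u : EE m → ℝ} (hu : ContDiff ℝ 2 u) (h : ℝ) (k : Fin m) (x : EE m) :
    fderiv ℝ (dq u h k) x =
      h⁻¹ • (fderiv ℝ u (x + h • EuclideanSpace.single k 1) - fderiv ℝ u x) ∧
    Lc (dq u h k) x = dq (Lc u) h k x := by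
  have hv : ContDiff ℝ 2 (fun y => u (y + h • EuclideanSpace.single k 1)) :=
    hu.comp (contDiff_id.add contDiff_const)
  have hsub : ContDiff ℝ 2 (fun y => u (y + h • EuclideanSpace.single k 1) - u y) := hv.sub hu
  have e : fderiv ℝ (dq u h k) = fun x =>
      h⁻¹ • fderiv ℝ (fun y => u (y + h • EuclideanSpace.single k 1) - u y) x := by
    ext1 x
    exact (((C2_fderiv hsub).1 x).const_mul h⁻¹).fderiv
  constructor
  · rw [congrFun e x, (Lc_sub hv hu x).1, (Lc_translate _ _).1]
  · have h2 := (Lc_sub hv hu x).2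
    rw [(Lc_translate _ _).2] at h2
    have e3 : dq (Lc u) h k x = h⁻¹ * (Lc u (x + h • EuclideanSpace.single k 1) - Lc u x) := rfl
    rw [e3, ← h2]
    conv_lhs => unfold Lc
    have e4 := (((C2_fderiv hsub).2.1 x).const_smul h⁻¹).fderiv
    rw [e]
    refine (congrArg trc e4).trans ?_
    rw [trc_smul]
    rfl

/-- inequality at a maximum for fixed step -/
lemma bern_step {u f G : EE m → ℝ} (hu : ContDiff ℝ 2 u) {ρ K h a : ℝ} (hρ : 0 ≤ ρ)
    (heq : ∀ x, ρ * u x - 1/2 * Lc u x + G x = f x) {x : EE m}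
    (hK : ∀ k, |dq f h k x| ≤ K) {B : EE m → ℝ} {DB : EE m → ED m} {D2B : EE m →L[ℝ] ED m}
    (hB : ∀ᶠ y in 𝓝 x, HasFDerivAt B (DB y) y) (hB2 : HasFDerivAt DB D2B x)
    (hmax : IsLocalMax (fun y => ∑ k, (dq u h k y) ^ 2 - a * B y) x) :
    ∑ k, (2 * dq u h k x) • fderiv ℝ (dq u h k) x = a • DB x ∧
    ∑ k, (‖fderiv ℝ (dq u h k) x‖ ^ 2 + 2 * dq u h k x * dq G h k x - 2 * K * |dq u h k x|)
      ≤ 1/2 * (a * trc D2B) := by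
  have hW := Lc_sumsq (dq_C2 hu h)
  have hW0 := (hW x).1
  obtain ⟨k1, k2, -⟩ := C2_fderiv hW0
  have hj := max_jet (G := fun y => ∑ k, (dq u h k y) ^ 2 - a * B y)
    (G' := fun y => fderiv ℝ (fun y => ∑ k, (dq u h k y) ^ 2) y - a • DB y)
    (hB.mono fun y hy => (k1 y).sub (hy.const_mul a)) ((k2 x).sub (hB2.const_smul a)) hmax
  refine ⟨?_, ?_⟩
  · rw [← (hW x).2.1]; exact sub_eq_zero.1 hj.1
  · have ht := trc_le _ 0 (fun b => (hj.2 b).trans (by simp))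
    rw [trc_sub, trc_smul, mul_zero] at ht
    have e := (hW x).2.2
    unfold Lc at e
    rw [e] at ht
    have : ∑ k, (‖fderiv ℝ (dq u h k) x‖ ^ 2 + 2 * dq u h k x * dq G h k x - 2 * K * |dq u h k x|)
      ≤ ∑ k, 1/2 * (2 * ‖fderiv ℝ (dq u h k) x‖ ^ 2 + 2 * dq u h k x * trc (fderiv ℝ (fderiv ℝ (dq u h k)) x)) := by
      refine Finset.sum_le_sum fun k _ => ?_
      have e1 : trc (fderiv ℝ (fderiv ℝ (dq u h k)) x) = dq (Lc u) h k x := (dq_deriv hu h k x).2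
      have e2 : dq (Lc u) h k x = 2 * (ρ * dq u h k x + dq G h k x - dq f h k x) := by
        have a1 := heq x
        have a2 := heq (x + h • EuclideanSpace.single k 1)
        unfold dq
        rw [← a1, ← a2]; ring
      rw [e1, e2]
      have a3 : dq u h k x * dq f h k x ≤ K * |dq u h k x| := by
        refine (le_abs_self _).trans ?_
        rw [abs_mul, mul_comm]
        exact mul_le_mul_of_nonneg_right (hK k) (abs_nonneg _)
      nlinarith [mul_nonneg hρ (sq_nonneg (dq u h k x))]
    rw [← Finset.mul_sum] at this
    linarith

lemma bern_pt {u f G : EE m → ℝ} (hu : ContDiff ℝ 2 u) (hG : ContDiff ℝ 1 G) {ρ K R : ℝ}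
    (hρ : 0 ≤ ρ) (hR : 0 ≤ R)
    (heq : ∀ x, ρ * u x - 1/2 * Lc u x + G x = f x)
    (hK : ∀ x y, ‖x‖ ≤ R + 1 → ‖y‖ ≤ R + 1 → |f x - f y| ≤ K * ‖x - y‖)
    {η : EE m → ℝ} (hηc : Continuous η) (hη0 : ∀ x, 0 ≤ η x) (hηR : ∀ x, 0 < η x → ‖x‖ ≤ R)
    {B : EE m → ℝ} {DB : EE m → ED m} {D2B : EE m → EE m →L[ℝ] ED m}
    (hBη : ∀ x, 0 < η x → η x * B x = 1)
    (hB : ∀ x, 0 < η x → HasFDerivAt B (DB x) x) (hB2 : ∀ x, 0 < η x → HasFDerivAt DB (D2B x) x)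
    (hB3 : ∀ x, 0 < η x → ContinuousAt D2B x) :
    ∃ x : EE m, (∀ y, η y * ‖fderiv ℝ u y‖ ^ 2 ≤ η x * ‖fderiv ℝ u x‖ ^ 2) ∧
      (0 < η x → 
        ∑ k, (2 * fderiv ℝ u x (EuclideanSpace.single k 1)) •
          fderiv ℝ (fderiv ℝ u) x (EuclideanSpace.single k 1) = (η x * ‖fderiv ℝ u x‖ ^ 2) • DB x ∧
        ∑ k, (‖fderiv ℝ (fderiv ℝ u) x (EuclideanSpace.single k 1)‖ ^ 2 +
          2 * fderiv ℝ u x (EuclideanSpace.single k 1) * fderiv ℝ G x (EuclideanSpace.single k 1)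
          - 2 * K * |fderiv ℝ u x (EuclideanSpace.single k 1)|)
        ≤ 1/2 * ((η x * ‖fderiv ℝ u x‖ ^ 2) * trc (D2B x))) := by
  obtain ⟨h1, h2, h3⟩ := C2_fderiv hu
  set h : ℕ → ℝ := fun n => 1 / ((n:ℝ) + 1) with hh
  have hpos : ∀ n, 0 < h n := fun n => by positivity
  have hle : ∀ n, h n ≤ 1 := fun n => by
    simp only [hh]; rw [div_le_one (by positivity)]; linarith [(Nat.cast_nonneg n : (0:ℝ) ≤ n)]
  have hlim : Tendsto h atTop (𝓝 0) := tendsto_one_div_add_atTop_nhds_zero_nat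
  have hcd : ∀ n k, Continuous (dq u (h n) k) := fun n k => (dq_C2 hu _ k).continuous
  have hex : ∀ n, ∃ x ∈ Metric.closedBall (0 : EE m) R, IsMaxOn (fun y => η y * ∑ k, (dq u (h n) k y) ^ 2)
      (Metric.closedBall (0 : EE m) R) x := fun n =>
    (isCompact_closedBall 0 R).exists_isMaxOn ⟨0, by simpa using hR⟩
      (Continuous.continuousOn (by have := hcd n; fun_prop))
  choose x hxR hxmax using hex
  have hglob : ∀ n y, η y * ∑ k, (dq u (h n) k y) ^ 2 ≤ η (x n) * ∑ k, (dq u (h n) k (x n)) ^ 2 := by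
    intro n y
    rcases (hη0 y).lt_or_eq with hy | hy
    · exact hxmax n (mem_closedBall_zero_iff.2 (hηR y hy))
    · rw [← hy, zero_mul]; exact mul_nonneg (hη0 _) (Finset.sum_nonneg fun k _ => sq_nonneg _)
  obtain ⟨φ : Ultrafilter ℕ, hφ⟩ : ∃ φ : Ultrafilter ℕ, (φ : Filter ℕ) ≤ atTop :=
    ⟨Ultrafilter.of atTop, Ultrafilter.of_le _⟩
  obtain ⟨xb, hxb, hxlim⟩ := (isCompact_closedBall (0 : EE m) R).ultrafilter_le_nhds' (φ.map x)
    (by rw [Ultrafilter.mem_map]; exact Eventually.of_forall hxR)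
  have hxl : Tendsto x φ (𝓝 xb) := hxlim
  have hhl : Tendsto h φ (𝓝 0) := hlim.mono_left hφ
  have hne : ∀ n, h n ≠ 0 := fun n => (hpos n).ne'
  have su : ∀ y, HasStrictFDerivAt u (fderiv ℝ u y) y := fun y =>
    hu.contDiffAt.hasStrictFDerivAt (by norm_num)
  have sdu : HasStrictFDerivAt (fderiv ℝ u) (fderiv ℝ (fderiv ℝ u) xb) xb :=
    h3.contDiffAt.hasStrictFDerivAt (by norm_num)
  have sG : HasStrictFDerivAt G (fderiv ℝ G xb) xb :=
    hG.contDiffAt.hasStrictFDerivAt (by norm_num)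
  have tU : ∀ k, Tendsto (fun n => dq u (h n) k (x n)) φ (𝓝 (fderiv ℝ u xb (EuclideanSpace.single k 1))) :=
    fun k => strict_quot (su xb) hxl hhl hne _
  have tG : ∀ k, Tendsto (fun n => dq G (h n) k (x n)) φ (𝓝 (fderiv ℝ G xb (EuclideanSpace.single k 1))) :=
    fun k => strict_quot sG hxl hhl hne _
  have tD : ∀ k, Tendsto (fun n => fderiv ℝ (dq u (h n) k) (x n)) φ
      (𝓝 (fderiv ℝ (fderiv ℝ u) xb (EuclideanSpace.single k 1))) := fun k => by
    have := strict_quot sdu hxl hhl hne (EuclideanSpace.single k 1)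
    refine this.congr fun n => ?_
    rw [(dq_deriv hu _ k _).1]
  have tη : Tendsto (fun n => η (x n)) φ (𝓝 (η xb)) := (hηc.tendsto xb).comp hxl
  have tA : Tendsto (fun n => η (x n) * ∑ k, (dq u (h n) k (x n)) ^ 2) φ (𝓝 (η xb * ‖fderiv ℝ u xb‖ ^ 2)) := by
    rw [← sum_sq_dual]
    exact tη.mul (tendsto_finsetSum _ fun k _ => (tU k).pow 2)
  refine ⟨xb, fun y => ?_, fun hpx => ?_⟩
  · have : Tendsto (fun n => η y * ∑ k, (dq u (h n) k y) ^ 2) φ (𝓝 (η y * ‖fderiv ℝ u y‖ ^ 2)) := by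
      rw [← sum_sq_dual]
      refine tendsto_const_nhds.mul (tendsto_finsetSum _ fun k _ => Tendsto.pow ?_ 2)
      exact strict_quot (su y) tendsto_const_nhds hhl hne _
    exact le_of_tendsto_of_tendsto' this tA fun n => hglob n y
  · have hev : ∀ᶠ n in (φ : Filter ℕ), 0 < η (x n) := tη.eventually (lt_mem_nhds hpx)
    have hopen : IsOpen {y | 0 < η y} := isOpen_lt continuous_const hηc
    have hstep := hev.mono fun n hn => bern_step (u := u) (f := f) (G := G) hu hρ heq (h := h n)
      (x := x n) (K := K) (a := η (x n) * ∑ k, (dq u (h n) k (x n)) ^ 2)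
      (fun k => by
        have hx1 := mem_closedBall_zero_iff.1 (hxR n)
        have n1 : ‖h n • (EuclideanSpace.single k 1 : EE m)‖ = h n := by
          rw [norm_smul, single_norm, mul_one, Real.norm_of_nonneg (hpos n).le]
        have := hK (x n + h n • EuclideanSpace.single k 1) (x n)
          ((norm_add_le _ _).trans (by rw [n1]; linarith [hle n])) (by linarith)
        rw [add_sub_cancel_left, n1] at this
        unfold dq
        rw [abs_mul, abs_of_pos (inv_pos.2 (hpos n)), inv_mul_le_iff₀ (hpos n), mul_comm]
        exact this) (B := B) (DB := DB) (D2B := D2B (x n))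
      (by filter_upwards [hopen.mem_nhds hn] with y hy using hB y hy) (hB2 _ hn)
      (by
        filter_upwards [hopen.mem_nhds hn] with y hy
        have hy' : 0 < η y := hy
        have e1 : η (x n) * (∑ k, (dq u (h n) k (x n)) ^ 2) * B (x n)
            = ∑ k, (dq u (h n) k (x n)) ^ 2 := by
          rw [mul_right_comm, hBη _ hn, one_mul]
        rw [e1, sub_self]
        have h5 := hglob n y
        have hBy : 0 < B y := by
          have := hBη y hy'
          by_contra hneg
          push Not at hneg
          nlinarith
        have h6 := mul_le_mul_of_nonneg_right h5 hBy.le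
        rw [mul_right_comm, hBη y hy', one_mul] at h6
        linarith)
    have hcDB : ContinuousAt DB xb := (hB2 xb hpx).continuousAt
    have tDB : Tendsto (fun n => DB (x n)) φ (𝓝 (DB xb)) := hcDB.tendsto.comp hxl
    have tD2B : Tendsto (fun n => trc (D2B (x n))) φ (𝓝 (trc (D2B xb))) := by
      simp only [← trcL_apply]
      exact ((trcL m).continuous.tendsto _).comp ((hB3 xb hpx).tendsto.comp hxl)
    constructor
    · refine tendsto_nhds_unique_of_eventuallyEq (l := (φ : Filter ℕ)) ?_ (tA.smul tDB)
        (hstep.mono fun n hn => hn.1)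
      exact tendsto_finsetSum _ fun k _ => ((tU k).const_mul 2).smul (tD k)
    · refine le_of_tendsto_of_tendsto ?_ ((tA.mul tD2B).const_mul (1/2))
        (hstep.mono fun n hn => hn.2)
      exact tendsto_finsetSum _ fun k _ => (((tD k).norm.pow 2).add
        (((tU k).const_mul 2).mul (tG k))).sub ((tU k).abs.const_mul _)

end

open Filter
open scoped Topology
set_option maxSynthPendingDepth 3

section
open Set
variable {m : ℕ}

noncomputable def rz (m : ℕ) : ED m →L[ℝ] EE m :=
  ∑ i : Fin m, (ContinuousLinearMap.apply ℝ ℝ (EuclideanSpace.single i 1 : EE m)).smulRight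
    (EuclideanSpace.single i 1 : EE m)

lemma rz_norm (p : ED m) : ‖rz m p‖ = ‖p‖ := by
  have h : ‖rz m p‖ ^ 2 = ‖p‖ ^ 2 := by
    rw [← sum_sq_dual, EuclideanSpace.real_norm_sq_eq]
    refine Finset.sum_congr rfl fun i _ => ?_
    simp [rz, Finset.sum_apply, Pi.single_apply]
  exact (sq_eq_sq₀ (norm_nonneg _) (norm_nonneg _)).1 h

lemma H_C1 {θ : ℝ} (hθ : 1 < θ) : ContDiff ℝ 1 (fun p : ED m => (1/θ) * ‖p‖ ^ θ) := by
  have : ContDiff ℝ 1 (fun p : ED m => (1/θ) * ‖rz m p‖ ^ θ) :=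
    contDiff_const.mul ((rz m).contDiff.norm_rpow hθ)
  simpa only [rz_norm] using this

lemma H_deriv_bound {θ : ℝ} (hθ : 1 < θ) (p : ED m) :
    ‖fderiv ℝ (fun p : ED m => (1/θ) * ‖p‖ ^ θ) p‖ ≤ ‖p‖ ^ (θ - 1) := by
  have e : (fun p : ED m => (1/θ) * ‖p‖ ^ θ) = fun p : ED m => (1/θ) * ‖rz m p‖ ^ θ := by
    simp only [rz_norm]
  rw [e]
  have hd : DifferentiableAt ℝ (fun p : ED m => ‖rz m p‖ ^ θ) p :=
    ((rz m).contDiff.norm_rpow hθ).differentiable one_ne_zero p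
  rw [fderiv_const_mul hd, norm_smul, Real.norm_of_nonneg (by positivity)]
  have h := norm_fderiv_norm_rpow_le (f := rz m) (x := p) (rz m).differentiable hθ
  have h1 : ‖fderiv ℝ (rz m) p‖ ≤ 1 := by
    rw [ContinuousLinearMap.fderiv]
    exact ContinuousLinearMap.opNorm_le_bound _ zero_le_one fun q => by rw [rz_norm, one_mul]
  rw [rz_norm] at h
  have h2 : 0 ≤ ‖p‖ ^ (θ - 1) := Real.rpow_nonneg (norm_nonneg _) _
  calc _ ≤ 1 / θ * (θ * ‖p‖ ^ (θ - 1) * ‖fderiv ℝ (rz m) p‖) := by gcongr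
    _ ≤ 1 / θ * (θ * ‖p‖ ^ (θ - 1) * 1) := by gcongr
    _ = _ := by field_simp

lemma trc_sq_le (S : EE m →L[ℝ] ED m) :
    (trc S) ^ 2 ≤ m * ∑ k : Fin m, ‖S (EuclideanSpace.single k 1)‖ ^ 2 := by
  unfold trc
  have := sq_sum_le_card_mul_sum_sq (s := (Finset.univ : Finset (Fin m)))
    (f := fun i => S (EuclideanSpace.single i 1) (EuclideanSpace.single i 1))
  simp only [Finset.card_univ, Fintype.card_fin] at this
  refine this.trans (mul_le_mul_of_nonneg_left (Finset.sum_le_sum fun k _ => ?_) (Nat.cast_nonneg _))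
  have h := (S (EuclideanSpace.single k 1)).le_opNorm (EuclideanSpace.single k 1)
  rw [single_norm, mul_one, Real.norm_eq_abs] at h
  rw [← sq_abs]
  gcongr

section barrier
variable (c N : ℝ)

lemma hasFDerivAt_zeta (x : EE m) :
    HasFDerivAt (fun y : EE m => 1 - c * ‖y‖ ^ 2) ((-(2 * c)) • inSL m x) x := by
  refine (((hasFDerivAt_nsq x).const_mul c).const_sub 1).congr_fderiv ?_
  ext a; simp; ring

noncomputable def bDB (x : EE m) : ED m := (2 * c * N * (1 - c * ‖x‖ ^ 2) ^ (-N - 1)) • inSL m x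

noncomputable def bD2B (x : EE m) : EE m →L[ℝ] ED m :=
  (2 * c * N * (1 - c * ‖x‖ ^ 2) ^ (-N - 1)) • inSL m +
  ((4 * c ^ 2 * N * (N + 1) * (1 - c * ‖x‖ ^ 2) ^ (-N - 2)) • inSL m x).smulRight (inSL m x)

lemma b_hasFDerivAt {x : EE m} (hx : 0 < 1 - c * ‖x‖ ^ 2) :
    HasFDerivAt (fun y : EE m => (1 - c * ‖y‖ ^ 2) ^ (-N)) (bDB c N x) x := by
  refine ((hasFDerivAt_zeta c x).rpow_const (Or.inl hx.ne')).congr_fderiv ?_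
  unfold bDB
  rw [smul_smul]; congr 1; ring

lemma bD_hasFDerivAt {x : EE m} (hx : 0 < 1 - c * ‖x‖ ^ 2) :
    HasFDerivAt (bDB c N : EE m → ED m) (bD2B c N x) x := by
  have h1 := ((hasFDerivAt_zeta c x).rpow_const (p := -N - 1) (Or.inl hx.ne')).const_mul (2 * c * N)
  refine (h1.smul ((inSL m).hasFDerivAt (x := x))).congr_fderiv ?_
  unfold bD2B
  congr 2
  rw [smul_smul, smul_smul]
  congr 1
  rw [show -N - 1 - 1 = -N - 2 by ring]; ring

lemma bD2_cont {x : EE m} (hx : 0 < 1 - c * ‖x‖ ^ 2) :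
    ContinuousAt (bD2B c N : EE m → EE m →L[ℝ] ED m) x := by
  unfold bD2B
  have h : ContinuousAt (fun y : EE m => 1 - c * ‖y‖ ^ 2) x := by fun_prop
  have hr : ∀ p : ℝ, ContinuousAt (fun y : EE m => (1 - c * ‖y‖ ^ 2) ^ p) x := fun p =>
    h.rpow_const (Or.inl hx.ne')
  have hi : ContinuousAt (fun y : EE m => inSL m y) x := (inSL m).continuous.continuousAt
  refine ((continuousAt_const.mul (hr _)).smul continuousAt_const).add ?_
  have h2 := (((continuousAt_const (y := 4 * c ^ 2 * N * (N + 1))).mul (hr (-N - 2))).smul hi)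
  have e : (fun y : EE m => ((4 * c ^ 2 * N * (N + 1) * (1 - c * ‖y‖ ^ 2) ^ (-N - 2)) • inSL m y).smulRight (inSL m y))
    = fun y : EE m => ContinuousLinearMap.smulRightL ℝ (EE m) (ED m)
      ((4 * c ^ 2 * N * (N + 1) * (1 - c * ‖y‖ ^ 2) ^ (-N - 2)) • inSL m y) (inSL m y) := by
    ext; simp [mul_assoc]
  rw [e]
  exact (((ContinuousLinearMap.smulRightL ℝ (EE m) (ED m)).continuous.continuousAt.comp h2)).clm_apply hi

lemma trc_inSL : trc (inSL m) = m := by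
  unfold trc; simp [inSL_apply]

lemma trc_rank1 (x : EE m) : trc ((inSL m x).smulRight (inSL m x)) = ‖x‖ ^ 2 := by
  rw [← inSL_norm, ← sum_sq_dual]
  unfold trc
  refine Finset.sum_congr rfl fun i _ => ?_
  simp; ring

lemma trc_bD2 (x : EE m) : trc (bD2B c N x) = 2 * c * N * (1 - c * ‖x‖ ^ 2) ^ (-N - 1) * m +
    4 * c ^ 2 * N * (N + 1) * (1 - c * ‖x‖ ^ 2) ^ (-N - 2) * ‖x‖ ^ 2 := by
  unfold bD2B
  rw [trc_add, trc_smul, trc_inSL]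
  congr 1
  generalize 4 * c ^ 2 * N * (N + 1) * (1 - c * ‖x‖ ^ 2) ^ (-N - 2) = t
  rw [← trc_rank1, ← trc_smul]
  congr 1
  ext a b
  simp [mul_assoc]
end barrier

/-- scalar consequence -/
lemma scalar_bern {θ C1 C2 C3 M s z : ℝ} (hθ : 1 < θ) (hC1 : 0 ≤ C1) (hC2 : 0 ≤ C2) (hC3 : 0 ≤ C3)
    (hM : 0 ≤ M) (hs : 1 ≤ s) (hz : 0 < z) (hz1 : z ≤ 1)
    (h : (s ^ θ) ^ 2 ≤ M * (C1 * s ^ (θ - 1) * s ^ 2 * z⁻¹ + C2 * s ^ 2 * (z⁻¹) ^ 2 + C3 * s)) :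
    z ^ (2 / (θ - 1)) * s ^ 2 ≤ (1 + M * (C1 + C2 + C3)) ^ (2 / (θ - 1)) := by
  have hs0 : 0 < s := by linarith
  set Y := s ^ (θ - 1) with hY
  have hY0 : 0 < Y := Real.rpow_pos_of_pos hs0 _
  have e1 : s ^ θ = s * Y := by
    rw [hY, ← Real.rpow_one_add' hs0.le (by linarith)]; congr 1; ring
  have hN : 0 < 2 / (θ - 1) := div_pos two_pos (by linarith)
  have e2 : z ^ (2 / (θ - 1)) * s ^ 2 = (Y * z) ^ (2 / (θ - 1)) := by
    rw [Real.mul_rpow hY0.le hz.le, hY, ← Real.rpow_mul hs0.le, mul_comm]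
    congr 1
    rw [mul_div_cancel₀ _ (by linarith : θ - 1 ≠ 0)]
    norm_num
  rw [e2]
  refine Real.rpow_le_rpow (by positivity) ?_ hN.le
  set X := Y * z with hX
  have hX0 : 0 < X := by positivity
  have hq : X ^ 2 ≤ M * (C1 * X + C2 + C3) := by
    have h1 : (s * Y) ^ 2 * (z ^ 2 / s ^ 2) ≤
      (M * (C1 * Y * s ^ 2 * z⁻¹ + C2 * s ^ 2 * (z⁻¹) ^ 2 + C3 * s)) * (z ^ 2 / s ^ 2) := by
      rw [e1] at h
      exact mul_le_mul_of_nonneg_right h (by positivity)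
    have h2 : (s * Y) ^ 2 * (z ^ 2 / s ^ 2) = X ^ 2 := by rw [hX]; field_simp
    have h3 : (M * (C1 * Y * s ^ 2 * z⁻¹ + C2 * s ^ 2 * (z⁻¹) ^ 2 + C3 * s)) * (z ^ 2 / s ^ 2) =
      M * (C1 * X + C2 + C3 * (z ^ 2 / s)) := by rw [hX]; field_simp
    rw [h2, h3] at h1
    have h4 : z ^ 2 / s ≤ 1 := by rw [div_le_one hs0]; nlinarith
    refine h1.trans (mul_le_mul_of_nonneg_left ?_ hM)
    nlinarith
  by_contra hcon
  push Not at hcon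
  have hX1 : 1 ≤ X := by
    have : 0 ≤ M * (C1 + C2 + C3) := by positivity
    linarith
  have : X ^ 2 ≤ M * (C1 + C2 + C3) * X := by
    refine hq.trans ?_
    have a2 : C2 ≤ C2 * X := le_mul_of_one_le_right hC2 hX1
    have a3 : C3 ≤ C3 * X := le_mul_of_one_le_right hC3 hX1
    rw [mul_assoc]
    refine mul_le_mul_of_nonneg_left ?_ hM
    linarith
  nlinarith

end

open Filter
open scoped Topology
set_option maxSynthPendingDepth 3

section
open Set
variable {m : ℕ}

set_option maxHeartbeats 2000000 in
theorem grad_bound (m : ℕ) {θ R K C0 : ℝ} (hθ : 1 < θ) (hR : 0 < R) (hK0 : 0 ≤ K) (hC0 : 0 ≤ C0) :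
    ∃ C, 0 ≤ C ∧ ∀ (u f : EE m → ℝ) (ρ : ℝ), ContDiff ℝ 2 u → 0 ≤ ρ →
      (∀ x, ρ * u x - 1/2 * Lc u x + (1/θ) * ‖fderiv ℝ u x‖ ^ θ = f x) →
      (∀ x y, ‖x‖ ≤ R + 1 → ‖y‖ ≤ R + 1 → |f x - f y| ≤ K * ‖x - y‖) →
      (∀ x, ‖x‖ ≤ R → f x - ρ * u x ≤ C0) →
      ∀ x, ‖x‖ ≤ R / 2 → ‖fderiv ℝ u x‖ ≤ C := by
  set c := 1 / R ^ 2 with hc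
  have hc0 : 0 < c := by positivity
  set N := 2 / (θ - 1) with hN
  have hN0 : 0 < N := div_pos two_pos (by linarith)
  set C1 := 2 * N / R with hC1
  set C2 := c * N * m + 2 * c * N * (N + 1) with hC2
  set C3 := 2 * K * m with hC3
  have p1 : 0 ≤ C1 := by positivity
  have p2 : 0 ≤ C2 := by positivity
  have p3 : 0 ≤ C3 := by positivity
  set M := θ ^ 2 * m with hM
  have pM : 0 ≤ M := by positivity
  set s0 := 1 + 2 * θ * C0 with hs0
  have ps0 : 1 ≤ s0 := by
    have : 0 ≤ 2 * θ * C0 := by positivity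
    linarith
  set CA := s0 ^ 2 + (1 + M * (C1 + C2 + C3)) ^ N with hCA
  have pX : 0 ≤ (1 + M * (C1 + C2 + C3)) ^ N := by positivity
  have pA : 0 ≤ CA := by positivity
  refine ⟨√(CA / (3/4) ^ N), Real.sqrt_nonneg _, fun u f ρ hu hρ heq hK hF => ?_⟩
  set η : EE m → ℝ := fun x => (max (1 - c * ‖x‖ ^ 2) 0) ^ N with hη
  have hζ : ∀ x, 0 < η x → 0 < 1 - c * ‖x‖ ^ 2 := fun x hx => by
    by_contra hneg
    push Not at hneg
    simp only [hη] at hx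
    rw [max_eq_right hneg, Real.zero_rpow hN0.ne'] at hx
    exact lt_irrefl _ hx
  have hηe : ∀ x, 0 < η x → η x = (1 - c * ‖x‖ ^ 2) ^ N := fun x hx => by
    simp only [hη]; rw [max_eq_left (hζ x hx).le]
  have hcR : ∀ x : EE m, 0 ≤ 1 - c * ‖x‖ ^ 2 → ‖x‖ ≤ R := fun x hx => by
    have h1 : c * ‖x‖ ^ 2 ≤ 1 := by linarith
    rw [hc, one_div, inv_mul_le_iff₀ (by positivity), mul_one] at h1
    exact (sq_le_sq₀ (norm_nonneg _) hR.le).1 h1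
  obtain ⟨hd1, hd2, hd3⟩ := C2_fderiv hu
  have hHd : ∀ p : ED m, HasFDerivAt (fun p : ED m => (1/θ) * ‖p‖ ^ θ)
      (fderiv ℝ (fun p : ED m => (1/θ) * ‖p‖ ^ θ) p) p := fun p =>
    ((H_C1 hθ).differentiable one_ne_zero p).hasFDerivAt
  obtain ⟨x, hxmax, hxin⟩ := bern_pt (u := u) (f := f) (G := fun y => (1/θ) * ‖fderiv ℝ u y‖ ^ θ)
    hu ((H_C1 hθ).comp hd3) hρ hR.le heq hK (η := η)
    (by
      refine Continuous.rpow_const (by fun_prop) fun y => Or.inr hN0.le)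
    (fun y => Real.rpow_nonneg (le_max_right _ _) _)
    (fun y hy => hcR y (hζ y hy).le)
    (B := fun y => (1 - c * ‖y‖ ^ 2) ^ (-N)) (DB := bDB c N) (D2B := bD2B c N)
    (fun y hy => by
      rw [hηe y hy, ← Real.rpow_add (hζ y hy)]; simp)
    (fun y hy => b_hasFDerivAt c N (hζ y hy)) (fun y hy => bD_hasFDerivAt c N (hζ y hy))
    (fun y hy => bD2_cont c N (hζ y hy))
  have hmain : η x * ‖fderiv ℝ u x‖ ^ 2 ≤ CA := by
    rcases (Real.rpow_nonneg (le_max_right _ _) _ : 0 ≤ η x).lt_or_eq with hpx | hpx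
    swap
    · rw [show η x = 0 from hpx.symm, zero_mul]; exact pA
    obtain ⟨h1, h2⟩ := hxin hpx
    have hz := hζ x hpx
    have hηx := hηe x hpx
    have hxR := hcR x hz.le
    set z := 1 - c * ‖x‖ ^ 2 with hzdef
    have hz1 : z ≤ 1 := by
      have : 0 ≤ c * ‖x‖ ^ 2 := by positivity
      linarith
    set p := fderiv ℝ u x with hp
    set s := ‖p‖ with hs
    have hs_nonneg : 0 ≤ s := norm_nonneg _
    set S := fderiv ℝ (fderiv ℝ u) x with hS
    rcases le_or_gt s s0 with hss | hss
    · have : η x ≤ 1 := by rw [hηx]; exact Real.rpow_le_one hz.le hz1 hN0.le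
      have hsq : s ^ 2 ≤ s0 ^ 2 := by gcongr
      have : η x * s ^ 2 ≤ 1 * s0 ^ 2 := by gcongr
      linarith
    have hs1 : 1 ≤ s := by linarith
    have hspos : 0 < s := by linarith
    set H := (1/θ) * s ^ θ with hH
    have hsθ : s ≤ s ^ θ := by
      conv_lhs => rw [← Real.rpow_one s]
      exact Real.rpow_le_rpow_of_exponent_le hs1 hθ.le
    have hH0 : 2 * C0 ≤ H := by
      rw [hH, one_div, le_inv_mul_iff₀ (by positivity)]
      linarith
    -- trace bound
    have htr : trc S = 2 * (H - (f x - ρ * u x)) := by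
      have e0 := heq x
      have e1 : Lc u x = trc S := rfl
      rw [e1] at e0
      linarith
    have hFx := hF x hxR
    have hHtr : H ^ 2 ≤ (trc S) ^ 2 := by
      have a1 : H ≤ trc S := by rw [htr]; linarith
      have a2 : 0 ≤ H := by linarith
      gcongr
    have hT := hHtr.trans (trc_sq_le S)
    set T := ∑ k : Fin m, ‖S (EuclideanSpace.single k 1)‖ ^ 2 with hTdef
    set DH := fderiv ℝ (fun p : ED m => (1/θ) * ‖p‖ ^ θ) p with hDH
    have hGd : fderiv ℝ (fun y => (1/θ) * ‖fderiv ℝ u y‖ ^ θ) x = DH.comp S :=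
      ((hHd p).comp x (hd2 x)).fderiv
    have hDHn : ‖DH‖ ≤ s ^ (θ - 1) := H_deriv_bound hθ p
    set A := η x * s ^ 2 with hA
    have pA0 : 0 ≤ A := by
      rw [hA]; exact mul_nonneg hpx.le (sq_nonneg _)
    have hcross : ∑ k : Fin m, 2 * p (EuclideanSpace.single k 1) * (DH.comp S) (EuclideanSpace.single k 1)
        = A * DH (bDB c N x) := by
      have := congrArg DH h1
      rw [map_sum, map_smul] at this
      simp only [map_smul, smul_eq_mul] at this
      exact this
    rw [hGd, Finset.sum_sub_distrib, Finset.sum_add_distrib, hcross] at h2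
    have hzr : ∀ j : ℝ, 0 ≤ z ^ j := fun j => Real.rpow_nonneg hz.le j
    have hKs : ∑ k : Fin m, 2 * K * |p (EuclideanSpace.single k 1)| ≤ C3 * s := by
      calc _ ≤ ∑ k : Fin m, 2 * K * s := Finset.sum_le_sum fun k _ => by
            have := p.le_opNorm (EuclideanSpace.single k 1)
            rw [single_norm, mul_one, Real.norm_eq_abs] at this
            gcongr
        _ = _ := by simp [hC3]; ring
    have ez1 : z ^ N * z ^ (-N - 1) = z⁻¹ := by
      rw [← Real.rpow_add hz, show N + (-N - 1) = -1 by ring, Real.rpow_neg_one]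
    have ez2 : z ^ N * z ^ (-N - 2) = (z⁻¹) ^ 2 := by
      rw [← Real.rpow_add hz, show N + (-N - 2) = -2 by ring, Real.rpow_neg hz.le, inv_pow]
      norm_num
    have hcx : c * ‖x‖ ≤ 1 / R := by
      have e : c * R = 1 / R := by rw [hc]; field_simp
      rw [← e]; gcongr
    have hcx2 : c * ‖x‖ ^ 2 ≤ 1 := by linarith
    have hDB : -(A * DH (bDB c N x)) ≤ C1 * s ^ (θ - 1) * s ^ 2 * z⁻¹ := by
      have a1 : -(DH (bDB c N x)) ≤ ‖DH‖ * ‖bDB c N x‖ :=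
        (neg_le_abs _).trans (DH.le_opNorm _)
      have a2 : ‖bDB c N x‖ = 2 * N * (c * ‖x‖) * z ^ (-N - 1) := by
        unfold bDB
        rw [norm_smul, inSL_norm, ← hzdef, Real.norm_of_nonneg (by have := hzr (-N - 1); positivity)]
        ring
      have a3 : ‖bDB c N x‖ ≤ 2 * N * (1 / R) * z ^ (-N - 1) := by
        rw [a2]; have := hzr (-N - 1); gcongr
      have a5 : 0 ≤ s ^ (θ - 1) := Real.rpow_nonneg hs_nonneg _
      have a4 : ‖DH‖ * ‖bDB c N x‖ ≤ s ^ (θ - 1) * (2 * N * (1 / R) * z ^ (-N - 1)) :=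
        mul_le_mul hDHn a3 (norm_nonneg _) a5
      calc -(A * DH (bDB c N x)) = A * -(DH (bDB c N x)) := by ring
        _ ≤ A * (s ^ (θ - 1) * (2 * N * (1 / R) * z ^ (-N - 1))) :=
            mul_le_mul_of_nonneg_left (a1.trans a4) pA0
        _ = C1 * s ^ (θ - 1) * s ^ 2 * (z ^ N * z ^ (-N - 1)) := by
            rw [hA, hηx, hC1]; ring
        _ = _ := by rw [ez1]
    have hD2B : 1/2 * (A * trc (bD2B c N x)) ≤ C2 * s ^ 2 * (z⁻¹) ^ 2 := by
      rw [trc_bD2, ← hzdef, hA, hηx]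
      have hzi : z⁻¹ ≤ (z⁻¹) ^ 2 := by
        have : 1 ≤ z⁻¹ := (one_le_inv₀ hz).2 hz1
        nlinarith
      calc _ = c * N * m * s ^ 2 * (z ^ N * z ^ (-N - 1)) +
              2 * c * N * (N + 1) * (c * ‖x‖ ^ 2) * s ^ 2 * (z ^ N * z ^ (-N - 2)) := by ring
        _ = c * N * m * s ^ 2 * z⁻¹ +
              2 * c * N * (N + 1) * (c * ‖x‖ ^ 2) * s ^ 2 * (z⁻¹) ^ 2 := by rw [ez1, ez2]
        _ ≤ c * N * m * s ^ 2 * (z⁻¹) ^ 2 +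
              2 * c * N * (N + 1) * 1 * s ^ 2 * (z⁻¹) ^ 2 := by gcongr
        _ = _ := by rw [hC2]; ring
    have hTle : T ≤ C1 * s ^ (θ - 1) * s ^ 2 * z⁻¹ + C2 * s ^ 2 * (z⁻¹) ^ 2 + C3 * s := by
      linarith
    have hfin := scalar_bern (C1 := C1) (C2 := C2) (C3 := C3) (M := M) hθ p1 p2 p3 pM hs1 hz hz1 (by
      have e : (s ^ θ) ^ 2 = θ ^ 2 * H ^ 2 := by rw [hH]; field_simp
      rw [e, hM, mul_assoc]
      refine mul_le_mul_of_nonneg_left (hT.trans ?_) (sq_nonneg _)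
      exact mul_le_mul_of_nonneg_left hTle (Nat.cast_nonneg _))
    rw [hA, hηx]
    refine hfin.trans ?_
    have : 0 ≤ s0 ^ 2 := sq_nonneg _
    linarith
  intro y hy
  have h34 : (0:ℝ) < (3/4) ^ N := by positivity
  refine Real.le_sqrt_of_sq_le ?_
  rw [le_div_iff₀ h34]
  refine le_trans ?_ ((hxmax y).trans hmain)
  rw [mul_comm]
  refine mul_le_mul_of_nonneg_right ?_ (sq_nonneg _)
  refine Real.rpow_le_rpow (by norm_num) (le_max_of_le_left ?_) hN0.le
  have : c * ‖y‖ ^ 2 ≤ c * (R / 2) ^ 2 := by gcongr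
  have e : c * (R / 2) ^ 2 = 1 / 4 := by rw [hc]; field_simp; norm_num
  linarith

end

open Filter
open scoped Topology
set_option maxSynthPendingDepth 3

section
open Set
variable {m : ℕ} {ι : Type*}

/-- family of functions, bounded and Hölder on balls, eventually uniformly along a filter -/
def LH {F : Type*} [NormedAddCommGroup F] (l : Filter ι) (h : ι → EE m → F) : Prop :=
  ∀ R : ℝ, ∃ K : ℝ, 0 ≤ K ∧ ∀ᶠ i in l, (∀ x, ‖x‖ ≤ R → ‖h i x‖ ≤ K) ∧
    ∀ x y, ‖x‖ ≤ R → ‖y‖ ≤ R → ‖h i x - h i y‖ ≤ K * √‖x - y‖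

lemma LH_add {F : Type*} [NormedAddCommGroup F] {l : Filter ι} {h k : ι → EE m → F}
    (hh : LH l h) (hk : LH l k) : LH l (fun i x => h i x + k i x) := by
  intro R
  obtain ⟨K, hK0, hK⟩ := hh R
  obtain ⟨K', hK0', hK'⟩ := hk R
  refine ⟨K + K', by positivity, ?_⟩
  filter_upwards [hK, hK'] with i h1 h2
  refine ⟨fun x hx => (norm_add_le _ _).trans (add_le_add (h1.1 x hx) (h2.1 x hx)),
    fun x y hx hy => ?_⟩
  rw [add_sub_add_comm, add_mul]
  exact (norm_add_le _ _).trans (add_le_add (h1.2 x y hx hy) (h2.2 x y hx hy))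

lemma LH_mul {l : Filter ι} {h k : ι → EE m → ℝ}
    (hh : LH l h) (hk : LH l k) : LH l (fun i x => h i x * k i x) := by
  intro R
  obtain ⟨K, hK0, hK⟩ := hh R
  obtain ⟨K', hK0', hK'⟩ := hk R
  refine ⟨2 * K * K', by positivity, ?_⟩
  filter_upwards [hK, hK'] with i h1 h2
  refine ⟨fun x hx => ?_, fun x y hx hy => ?_⟩
  · rw [norm_mul]
    calc _ ≤ K * K' := mul_le_mul (h1.1 x hx) (h2.1 x hx) (norm_nonneg _) hK0
      _ ≤ _ := by nlinarith [mul_nonneg hK0 hK0']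
  · rw [show h i x * k i x - h i y * k i y = h i x * (k i x - k i y) + (h i x - h i y) * k i y by ring]
    refine (norm_add_le _ _).trans ?_
    rw [norm_mul, norm_mul]
    calc _ ≤ K * (K' * √‖x - y‖) + (K * √‖x - y‖) * K' :=
          add_le_add (mul_le_mul (h1.1 x hx) (h2.2 x y hx hy) (norm_nonneg _) hK0)
            (mul_le_mul (h1.2 x y hx hy) (h2.1 y hy) (norm_nonneg _) (by positivity))
      _ = _ := by ring

lemma LH_lip {F : Type*} [NormedAddCommGroup F] (l : Filter ι) {h : EE m → F}
    (hh : LocallyLipschitz h) : LH l (fun _ => h) := by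
  intro R
  obtain ⟨K, hK⟩ := LocallyLipschitzOn.exists_lipschitzOnWith_of_compact
    (isCompact_closedBall (0 : EE m) R) (hh.locallyLipschitzOn)
  obtain ⟨B, hB⟩ := (isCompact_closedBall (0 : EE m) R).exists_bound_of_continuousOn
    (hh.continuous.continuousOn)
  refine ⟨|B| + K * √(2 * R), by positivity, Eventually.of_forall fun i => ⟨fun x hx => ?_, fun x y hx hy => ?_⟩⟩
  · have := hB x (by simpa using hx)
    have h2 : 0 ≤ K * √(2 * R) := by positivity
    linarith [le_abs_self B]
  · have h1 := hK.norm_sub_le (by simpa using hx : x ∈ Metric.closedBall 0 R) (by simpa using hy : y ∈ Metric.closedBall 0 R)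
    have h2 : ‖x - y‖ ≤ 2 * R := (norm_sub_le _ _).trans (by linarith)
    calc _ ≤ K * ‖x - y‖ := h1
      _ = K * (√‖x - y‖ * √‖x - y‖) := by rw [Real.mul_self_sqrt (norm_nonneg _)]
      _ ≤ K * (√(2 * R) * √‖x - y‖) := by gcongr
      _ ≤ _ := by
        have : 0 ≤ |B| * √‖x - y‖ := by positivity
        linarith

lemma LH_clm {F G : Type*} [NormedAddCommGroup F] [NormedSpace ℝ F] [NormedAddCommGroup G]
    [NormedSpace ℝ G] {l : Filter ι} {h : ι → EE m → F}
    (hh : LH l h) (A : F →L[ℝ] G) : LH l (fun i x => A (h i x)) := by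
  intro R
  obtain ⟨K, hK0, hK⟩ := hh R
  refine ⟨‖A‖ * K, by positivity, ?_⟩
  filter_upwards [hK] with i h1
  refine ⟨fun x hx => A.le_opNorm_of_le (h1.1 x hx), fun x y hx hy => ?_⟩
  rw [← map_sub, mul_assoc]
  exact A.le_opNorm_of_le (h1.2 x y hx hy)

lemma LH_sum {l : Filter ι} {κ : Type*} (s : Finset κ) {h : κ → ι → EE m → ℝ}
    (hh : ∀ k, LH l (h k)) : LH l (fun i x => ∑ k ∈ s, h k i x) := by
  classical
  induction s using Finset.induction_on with
  | empty => simpa using LH_lip l (LipschitzWith.const (0:ℝ)).locallyLipschitz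
  | insert a s ha ih =>
    simp only [Finset.sum_insert ha]
    exact LH_add (hh a) ih

lemma LH_const (l : Filter ι) (c : ℝ) : LH l (fun _ (_ : EE m) => c) :=
  LH_lip l (LipschitzWith.const c).locallyLipschitz

lemma LH_H {l : Filter ι} {P : ι → EE m → ED m} {θ : ℝ} (hθ : 1 < θ) (hP : LH l P) :
    LH l (fun i x => (1/θ) * ‖P i x‖ ^ θ) := by
  refine LH_mul (LH_const l _) ?_
  intro R
  obtain ⟨K, hK0, hK⟩ := hP R
  refine ⟨K ^ θ + θ * K ^ (θ - 1) * K, by positivity, ?_⟩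
  filter_upwards [hK] with i h1
  refine ⟨fun x hx => ?_, fun x y hx hy => ?_⟩
  · rw [Real.norm_of_nonneg (by positivity)]
    have : ‖P i x‖ ^ θ ≤ K ^ θ := Real.rpow_le_rpow (norm_nonneg _) (h1.1 x hx) (by linarith)
    have h2 : 0 ≤ θ * K ^ (θ - 1) * K := by positivity
    linarith
  · have h2 := rpow_lip hθ (M := K) ⟨norm_nonneg _, h1.1 x hx⟩ ⟨norm_nonneg _, h1.1 y hy⟩
    have h3 : |‖P i x‖ - ‖P i y‖| ≤ K * √‖x - y‖ := (abs_norm_sub_norm_le _ _).trans (h1.2 x y hx hy)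
    have h4 : 0 ≤ K ^ θ * √‖x - y‖ := by positivity
    calc _ ≤ θ * K ^ (θ - 1) * |‖P i x‖ - ‖P i y‖| := h2
      _ ≤ θ * K ^ (θ - 1) * (K * √‖x - y‖) := by gcongr
      _ ≤ _ := by linarith

lemma LH_limit {F : Type*} [NormedAddCommGroup F] {l : Filter ι} [l.NeBot] {h : ι → EE m → F}
    {k : EE m → F} (hh : LH l h) (hk : ∀ x, Tendsto (fun i => h i x) l (𝓝 (k x))) {κ : Type*} (l' : Filter κ) :
    LH l' (fun _ => k) := by
  intro R
  obtain ⟨K, hK0, hK⟩ := hh R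
  refine ⟨K, hK0, Eventually.of_forall fun _ => ⟨fun x hx => ?_, fun x y hx hy => ?_⟩⟩
  · exact le_of_tendsto (hk x).norm (hK.mono fun i hi => hi.1 x hx)
  · exact le_of_tendsto ((hk x).sub (hk y)).norm (hK.mono fun i hi => hi.2 x y hx hy)

lemma LH_global {l : Filter ι} {h : ι → EE m → ℝ} (hh : LH l h) {r : ℝ}
    (hr : ∀ i x, r < ‖x‖ → h i x = 0) : ∃ K, 0 ≤ K ∧ ∀ᶠ i in l, (∀ x, |h i x| ≤ K) ∧
      ∀ x y, |h i x - h i y| ≤ K * √‖x - y‖ := by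
  obtain ⟨K, hK0, hK⟩ := hh (r + 1)
  refine ⟨K, hK0, ?_⟩
  filter_upwards [hK] with i h1
  have hb : ∀ x, |h i x| ≤ K := fun x => by
    rcases le_or_gt ‖x‖ r with hx | hx
    · exact h1.1 x (by linarith)
    · rw [hr i x hx]; simpa using hK0
  have key : ∀ x y, r + 1 < ‖y‖ → |h i x - h i y| ≤ K * √‖x - y‖ := fun x y hy => by
    rw [hr i y (by linarith), sub_zero]
    rcases le_or_gt ‖x‖ r with hx | hx
    · have : 1 ≤ ‖x - y‖ := by
        have := norm_sub_norm_le y x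
        rw [norm_sub_rev] at this
        linarith
      have h3 : 1 ≤ √‖x - y‖ := Real.one_le_sqrt.2 this
      exact (hb x).trans (le_mul_of_one_le_right hK0 h3)
    · rw [hr i x hx, abs_zero]; positivity
  refine ⟨hb, fun x y => ?_⟩
  rcases le_or_gt ‖y‖ (r + 1) with hy | hy
  · rcases le_or_gt ‖x‖ (r + 1) with hx | hx
    · exact h1.2 x y hx hy
    · rw [abs_sub_comm, norm_sub_rev]; exact key y x hx
  · exact key x y hy

lemma hold_continuous {g : EE m → ℝ} {K : ℝ} (hK : ∀ x y, |g x - g y| ≤ K * √‖x - y‖) :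
    Continuous g := by
  refine continuous_iff_continuousAt.2 fun x => ?_
  rw [ContinuousAt, tendsto_iff_dist_tendsto_zero]
  refine squeeze_zero (fun _ => dist_nonneg) (fun y => hK y x) ?_
  have : Continuous fun y : EE m => K * √‖y - x‖ := by fun_prop
  simpa using this.tendsto x

lemma unif_conv {l : Filter ι} [l.NeBot] {h : ι → EE m → ℝ} {g : EE m → ℝ} {K r : ℝ}
    (hK0 : 0 ≤ K) (hK : ∀ᶠ i in l, ∀ x y, |h i x - h i y| ≤ K * √‖x - y‖)
    (hr : ∀ i x, r < ‖x‖ → h i x = 0)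
    (hlim : ∀ x, Tendsto (fun i => h i x) l (𝓝 (g x))) {ε : ℝ} (hε : 0 < ε) :
    ∀ᶠ i in l, ∀ x, |h i x - g x| ≤ ε := by
  have hgK : ∀ x y, |g x - g y| ≤ K * √‖x - y‖ := fun x y =>
    le_of_tendsto ((hlim x).sub (hlim y)).abs (hK.mono fun i hi => hi x y)
  have hgr : ∀ x, r < ‖x‖ → g x = 0 := fun x hx =>
    tendsto_nhds_unique (hlim x) (by simp only [hr _ x hx]; exact tendsto_const_nhds)
  obtain ⟨δ, hδ, hδ'⟩ : ∃ δ > 0, K * √δ ≤ ε / 3 := by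
    refine ⟨(ε / (3 * (K + 1))) ^ 2, by positivity, ?_⟩
    rw [Real.sqrt_sq (by positivity), mul_div_assoc', div_le_div_iff₀ (by positivity) (by positivity)]
    nlinarith
  obtain ⟨t, ht, htf, hcov⟩ := (isCompact_closedBall (0 : EE m) r).finite_cover_balls hδ
  have hev : ∀ᶠ i in l, ∀ z ∈ t, |h i z - g z| ≤ ε / 3 :=
    (Filter.eventually_all_finite htf).2 fun z _ => by
      filter_upwards [Metric.tendsto_nhds.1 (hlim z) (ε / 3) (by positivity)] with i hi
      exact le_of_lt hi
  filter_upwards [hev, hK] with i h1 h2 x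
  rcases le_or_gt ‖x‖ r with hx | hx
  · have := hcov (by simpa using hx : x ∈ Metric.closedBall 0 r)
    simp only [mem_iUnion, Metric.mem_ball, exists_prop] at this
    obtain ⟨z, hz, hxz⟩ := this
    rw [dist_eq_norm] at hxz
    have hs : K * √‖x - z‖ ≤ ε / 3 := le_trans (by gcongr) hδ'
    have e1 := (h2 x z).trans hs
    have e2 := (hgK x z).trans hs
    have e3 := h1 z hz
    rw [abs_le] at *
    constructor <;> linarith
  · rw [hr i x hx, hgr x hx]; simpa using hε.le
end

open Filter
open scoped Topology
set_option maxSynthPendingDepth 3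

section
open Set
variable {m : ℕ} {ι : Type*}

lemma bump_exists (m : ℕ) {R : ℝ} (hR : 0 < R) : ∃ χ : EE m → ℝ, ContDiff ℝ 3 χ ∧
    (∀ x, ‖x‖ < R → χ =ᶠ[𝓝 x] fun _ => 1) ∧ (∀ x, R + 1 < ‖x‖ → χ =ᶠ[𝓝 x] fun _ => 0) := by
  let b : ContDiffBump (0 : EE m) := ⟨R, R + 1, hR, by linarith⟩
  refine ⟨b, b.contDiff, fun x hx => ?_, fun x hx => ?_⟩
  · filter_upwards [Metric.isOpen_ball.mem_nhds (by simpa using hx : x ∈ Metric.ball 0 R)] with y hy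
    exact b.one_of_mem_closedBall (Metric.ball_subset_closedBall hy)
  · have ho : IsOpen {y : EE m | R + 1 < ‖y‖} := isOpen_lt continuous_const continuous_norm
    filter_upwards [ho.mem_nhds hx] with y hy
    refine b.zero_of_le_dist ?_
    rw [dist_zero_right]; exact le_of_lt hy

lemma Lc_congr {u v : EE m → ℝ} {x : EE m} (h : u =ᶠ[𝓝 x] v) : Lc u x = Lc v x := by
  unfold Lc
  rw [(h.fderiv (𝕜 := ℝ)).fderiv_eq]

lemma Lc_const (c : ℝ) (x : EE m) : Lc (fun _ : EE m => c) x = 0 := by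
  have : fderiv ℝ (fun _ : EE m => c) = fun _ => 0 := by ext1 y; simp
  unfold Lc
  rw [this]
  simp [trc]

noncomputable def gg (θ : ℝ) (χ v : EE m → ℝ) (P : EE m → ED m) (F : EE m → ℝ) (x : EE m) : ℝ :=
  χ x * v x + χ x * (F x + (-1) * ((1/θ) * ‖P x‖ ^ θ)) + (-1/2) * (Lc χ x * v x) +
    (-1) * ∑ k : Fin m, fderiv ℝ χ x (EuclideanSpace.single k 1) * P x (EuclideanSpace.single k 1)

lemma Lc_mul {u v : EE m → ℝ} (hu : ContDiff ℝ 2 u) (hv : ContDiff ℝ 2 v) (x : EE m) :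
    Lc (fun y => u y * v y) x = u x * Lc v x + Lc u x * v x +
      2 * ∑ k : Fin m, fderiv ℝ u x (EuclideanSpace.single k 1) * fderiv ℝ v x (EuclideanSpace.single k 1) := by
  obtain ⟨h1, h2, -⟩ := C2_fderiv hu
  obtain ⟨k1, k2, -⟩ := C2_fderiv hv
  have e : fderiv ℝ (fun y => u y * v y) = fun x => u x • fderiv ℝ v x + v x • fderiv ℝ u x := by
    ext1 x; exact ((h1 x).mul (k1 x)).fderiv
  have hd2 : HasFDerivAt (fun x => u x • fderiv ℝ v x + v x • fderiv ℝ u x)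
      ((u x • fderiv ℝ (fderiv ℝ v) x + (fderiv ℝ u x).smulRight (fderiv ℝ v x)) +
       (v x • fderiv ℝ (fderiv ℝ u) x + (fderiv ℝ v x).smulRight (fderiv ℝ u x))) x :=
    ((h1 x).smul (k2 x)).fun_add ((k1 x).smul (h2 x))
  unfold Lc
  rw [e, hd2.fderiv, trc_add, trc_add, trc_add, trc_smul, trc_smul]
  have e2 : ∀ p q : ED m, trc (p.smulRight q) =
      ∑ k : Fin m, p (EuclideanSpace.single k 1) * q (EuclideanSpace.single k 1) := fun p q => by
    simp [trc]
  rw [e2, e2]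
  have e3 : ∑ k : Fin m, fderiv ℝ v x (EuclideanSpace.single k 1) * fderiv ℝ u x (EuclideanSpace.single k 1)
    = ∑ k : Fin m, fderiv ℝ u x (EuclideanSpace.single k 1) * fderiv ℝ v x (EuclideanSpace.single k 1) :=
    Finset.sum_congr rfl fun k _ => mul_comm _ _
  rw [e3]; ring

lemma Lc_C1 {χ : EE m → ℝ} (hχ : ContDiff ℝ 3 χ) : ContDiff ℝ 1 (Lc χ) := by
  have h1 : ContDiff ℝ 2 (fderiv ℝ χ) := hχ.fderiv_right (by norm_num)
  have h2 : ContDiff ℝ 1 (fderiv ℝ (fderiv ℝ χ)) := h1.fderiv_right (by norm_num)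
  have : Lc χ = fun x => trcL m (fderiv ℝ (fderiv ℝ χ) x) := by
    ext x; rw [trcL_apply]; rfl
  rw [this]
  exact (trcL m).contDiff.comp h2

lemma gg_LH {θ : ℝ} (hθ : 1 < θ) {χ : EE m → ℝ} (hχ : ContDiff ℝ 3 χ) {l : Filter ι}
    {v F : ι → EE m → ℝ} {P : ι → EE m → ED m} (hv : LH l v) (hP : LH l P) (hF : LH l F) :
    LH l (fun i => gg θ χ (v i) (P i) (F i)) := by
  have hχ1 : LH l (fun _ => χ) := LH_lip l (hχ.of_le (by norm_num)).locallyLipschitz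
  have hχ2 : LH l (fun _ => fderiv ℝ χ) :=
    LH_lip l (ContDiff.locallyLipschitz (𝕂 := ℝ) (hχ.fderiv_right (m := 1) (by norm_num)))
  have hχ3 : LH l (fun _ => Lc χ) := LH_lip l (Lc_C1 hχ).locallyLipschitz
  refine LH_add (LH_add (LH_add (LH_mul hχ1 hv) (LH_mul hχ1 (LH_add hF
    (LH_mul (LH_const l _) (LH_H hθ hP))))) (LH_mul (LH_const l _) (LH_mul hχ3 hv)))
    (LH_mul (LH_const l _) (LH_sum _ fun k => LH_mul ?_ ?_))
  · exact LH_clm hχ2 (ContinuousLinearMap.apply ℝ ℝ (EuclideanSpace.single k 1))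
  · exact LH_clm hP (ContinuousLinearMap.apply ℝ ℝ (EuclideanSpace.single k 1))

lemma gg_supp {θ r : ℝ} {χ : EE m → ℝ} (h0 : ∀ x, r < ‖x‖ → χ =ᶠ[𝓝 x] fun _ => 0)
    (v : EE m → ℝ) (P : EE m → ED m) (F : EE m → ℝ) (x : EE m) (hx : r < ‖x‖) : gg θ χ v P F x = 0 := by
  have h := h0 x hx
  unfold gg
  rw [Lc_congr h, h.fderiv_eq, h.self_of_nhds, Lc_const]
  simp

lemma gg_one {θ : ℝ} {χ v : EE m → ℝ} {P : EE m → ED m} {F : EE m → ℝ} {x : EE m}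
    (h : χ =ᶠ[𝓝 x] fun _ => 1) : gg θ χ v P F x = v x + (F x - (1/θ) * ‖P x‖ ^ θ) := by
  unfold gg
  rw [Lc_congr h, h.fderiv_eq, h.self_of_nhds, Lc_const]
  simp; ring

lemma gg_bound {θ r B0 : ℝ} (hθ : 1 < θ) (hB0 : 0 ≤ B0) {χ : EE m → ℝ} (hχ : ContDiff ℝ 3 χ)
    (h0 : ∀ x, r < ‖x‖ → χ =ᶠ[𝓝 x] fun _ => 0) : ∃ B, 0 ≤ B ∧ ∀ (v F : EE m → ℝ) (P : EE m → ED m),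
      (∀ x, ‖x‖ ≤ r → |v x| ≤ B0 ∧ |F x| ≤ B0 ∧ ‖P x‖ ≤ B0) → ∀ x, |gg θ χ v P F x| ≤ B := by
  have hχ1 : Continuous χ := hχ.continuous
  have hχ2 : Continuous (fderiv ℝ χ) := (hχ.fderiv_right (m := 2) (by norm_num)).continuous
  have hχ3 : Continuous (Lc χ) := (Lc_C1 hχ).continuous
  have hc := isCompact_closedBall (0 : EE m) r
  obtain ⟨b1, hb1⟩ := hc.exists_bound_of_continuousOn hχ1.continuousOn
  obtain ⟨b2, hb2⟩ := hc.exists_bound_of_continuousOn hχ2.continuousOn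
  obtain ⟨b3, hb3⟩ := hc.exists_bound_of_continuousOn hχ3.continuousOn
  refine ⟨|b1| * B0 + |b1| * (B0 + (1/θ) * B0 ^ θ) + |b3| * B0 + m * (|b2| * B0), by positivity,
    fun v F P h x => ?_⟩
  rcases le_or_gt ‖x‖ r with hx | hx
  swap
  · rw [gg_supp h0 v P F x hx, abs_zero]; positivity
  have hx' : x ∈ Metric.closedBall (0 : EE m) r := by simpa using hx
  obtain ⟨a1, a2, a3⟩ := h x hx
  have c1 : |χ x| ≤ |b1| := (hb1 x hx').trans (le_abs_self _)
  have c2 : ‖fderiv ℝ χ x‖ ≤ |b2| := (hb2 x hx').trans (le_abs_self _)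
  have c3 : |Lc χ x| ≤ |b3| := (hb3 x hx').trans (le_abs_self _)
  unfold gg
  refine (abs_add_le _ _).trans (add_le_add ((abs_add_le _ _).trans (add_le_add
    ((abs_add_le _ _).trans (add_le_add ?_ ?_)) ?_)) ?_)
  · rw [abs_mul]; gcongr
  · rw [abs_mul]
    refine mul_le_mul c1 ((abs_add_le _ _).trans (add_le_add a2 ?_)) (abs_nonneg _) (abs_nonneg _)
    rw [abs_mul, abs_neg, abs_one, one_mul, abs_of_nonneg (by positivity)]
    have : ‖P x‖ ^ θ ≤ B0 ^ θ := Real.rpow_le_rpow (norm_nonneg _) a3 (by linarith)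
    gcongr
  · rw [abs_mul, abs_mul, show |(-1/2 : ℝ)| = 1/2 by norm_num [abs_div]]
    have : |Lc χ x| * |v x| ≤ |b3| * B0 := by gcongr
    have h2 : 0 ≤ |b3| * B0 := by positivity
    linarith
  · rw [abs_mul, abs_neg, abs_one, one_mul]
    refine (Finset.abs_sum_le_sum_abs _ _).trans ?_
    calc _ ≤ ∑ k : Fin m, |b2| * B0 := Finset.sum_le_sum fun k _ => by
          rw [abs_mul]
          have d1 := (fderiv ℝ χ x).le_opNorm (EuclideanSpace.single k 1)
          have d2 := (P x).le_opNorm (EuclideanSpace.single k 1)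
          rw [single_norm, mul_one, Real.norm_eq_abs] at d1 d2
          exact mul_le_mul (d1.trans c2) (d2.trans a3) (abs_nonneg _) (abs_nonneg _)
      _ = _ := by simp

lemma LH_single {κ : Type*} {l : Filter κ} [l.NeBot] {g : EE m → ℝ} {r : ℝ} (h : LH l (fun _ => g))
    (hr : ∀ x, r < ‖x‖ → g x = 0) : ∃ K, 0 ≤ K ∧ (∀ x, |g x| ≤ K) ∧
      ∀ x y, |g x - g y| ≤ K * √‖x - y‖ := by
  obtain ⟨K, h0, h1⟩ := LH_global h (r := r) fun _ => hr
  obtain ⟨_, h2⟩ := h1.exists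
  exact ⟨K, h0, h2⟩

/-- local representation -/
lemma gg_repr {θ r : ℝ} (hθ : 1 < θ) {χ : EE m → ℝ} (hχ : ContDiff ℝ 3 χ)
    (h0 : ∀ x, r < ‖x‖ → χ =ᶠ[𝓝 x] fun _ => 0) {v F : EE m → ℝ} (hv : ContDiff ℝ 2 v)
    (hF : LocallyLipschitz F)
    (heq : ∀ x, - (1/2) * Lc v x + (1/θ) * ‖fderiv ℝ v x‖ ^ θ = F x) :
    (fun x => χ x * v x) = Rop (gg θ χ v (fderiv ℝ v) F) := by
  have hχ2 : ContDiff ℝ 2 χ := hχ.of_le (by norm_num)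
  have hLH : LH (pure ()) (fun _ : Unit => gg θ χ v (fderiv ℝ v) F) :=
    gg_LH hθ hχ (LH_lip _ (hv.of_le (by norm_num)).locallyLipschitz)
      (LH_lip _ (C2_fderiv hv).2.2.locallyLipschitz) (LH_lip _ hF)
  obtain ⟨K, hK0, hB, hK⟩ := LH_single hLH (gg_supp h0 v _ F)
  have hgc := hold_continuous hK
  have hw : ContDiff ℝ 2 (fun x => χ x * v x) := hχ2.mul hv
  have hRc := Rop_contDiff hgc hB hK0 hK
  have hweq : ∀ x, χ x * v x - 1/2 * Lc (fun x => χ x * v x) x = gg θ χ v (fderiv ℝ v) F x := fun x => by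
    rw [Lc_mul hχ2 hv]
    unfold gg
    rw [← heq x]; ring
  obtain ⟨b, hb⟩ := (isCompact_closedBall (0 : EE m) r).exists_bound_of_continuousOn hw.continuous.continuousOn
  have hwb : ∀ x, |χ x * v x| ≤ |b| := fun x => by
    rcases le_or_gt ‖x‖ r with hx | hx
    · exact (hb x (by simpa using hx)).trans (le_abs_self _)
    · rw [(h0 x hx).self_of_nhds]; simp
  have hRb := Rop_bound hB
  ext x
  refine le_antisymm ?_ ?_
  · have := comparison (ρ := 1) (ℓ := 0) (δ := 0) (B := |b| + CR m * K) one_pos (H := fun _ => 0) (by simp)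
      hw hRc (fun x => by have := abs_le.1 (hwb x); have := abs_le.1 (hRb x); linarith)
      (fun x => by have := hweq x; have := Rop_eq hgc hB hK0 hK x; linarith) x
    linarith
  · have := comparison (ρ := 1) (ℓ := 0) (δ := 0) (B := |b| + CR m * K) one_pos (H := fun _ => 0) (by simp)
      hRc hw (fun x => by have := abs_le.1 (hwb x); have := abs_le.1 (hRb x); linarith)
      (fun x => by have := hweq x; have := Rop_eq hgc hB hK0 hK x; linarith) x
    linarith
end

open Filter
open scoped Topology
set_option maxSynthPendingDepth 3

section
open Set
variable {m : ℕ} {ι : Type*}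

lemma ultra_lim {F : Type*} [NormedAddCommGroup F] [ProperSpace F] (l : Ultrafilter ι) {h : ι → F} {B : ℝ}
    (hB : ∀ᶠ i in (l : Filter ι), ‖h i‖ ≤ B) : ∃ a, Tendsto h l (𝓝 a) := by
  obtain ⟨a, -, ha⟩ := (isCompact_closedBall (0 : F) B).ultrafilter_le_nhds' (l.map h)
    (by
      change ∀ᶠ i in (l : Filter ι), h i ∈ Metric.closedBall 0 B
      filter_upwards [hB] with i hi
      simpa using hi)
  exact ⟨a, ha⟩

lemma LH_of_grad {l : Filter ι} {v : ι → EE m → ℝ} (hv : ∀ i, ContDiff ℝ 2 (v i))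
    (hbd : ∀ R : ℝ, ∃ B, 0 ≤ B ∧ ∀ᶠ i in l, ∀ x, ‖x‖ ≤ R → |v i x| ≤ B ∧ ‖fderiv ℝ (v i) x‖ ≤ B) :
    LH l v := by
  intro R
  obtain ⟨B, hB0, hB⟩ := hbd R
  refine ⟨B + B * √(2 * R), by positivity, ?_⟩
  filter_upwards [hB] with i hi
  refine ⟨fun x hx => ?_, fun x y hx hy => ?_⟩
  · have h2 : 0 ≤ B * √(2 * R) := by positivity
    have := (hi x hx).1
    rw [Real.norm_eq_abs]; linarith
  · have h1 : ‖v i x - v i y‖ ≤ B * ‖x - y‖ :=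
      (convex_closedBall (0 : EE m) R).norm_image_sub_le_of_norm_fderiv_le
        (fun z _ => (hv i).differentiable (by norm_num) z) (fun z hz => (hi z (by simpa using hz)).2)
        (by simpa using hy) (by simpa using hx)
    have h2 : ‖x - y‖ ≤ 2 * R := (norm_sub_le _ _).trans (by linarith)
    calc _ ≤ B * ‖x - y‖ := h1
      _ = B * (√‖x - y‖ * √‖x - y‖) := by rw [Real.mul_self_sqrt (norm_nonneg _)]
      _ ≤ B * (√(2 * R) * √‖x - y‖) := by gcongr
      _ ≤ _ := by
        have : 0 ≤ B * √‖x - y‖ := by positivity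
        linarith

lemma gg_cont1 {θ r : ℝ} (hθ : 1 < θ) {χ : EE m → ℝ} (hχ : ContDiff ℝ 3 χ)
    (h0 : ∀ x, r < ‖x‖ → χ =ᶠ[𝓝 x] fun _ => 0) {v F : EE m → ℝ} (hv : ContDiff ℝ 2 v)
    (hF : LocallyLipschitz F) : Continuous (gg θ χ v (fderiv ℝ v) F) := by
  have hLH : LH (pure ()) (fun _ : Unit => gg θ χ v (fderiv ℝ v) F) :=
    gg_LH hθ hχ (LH_lip _ (hv.of_le (by norm_num)).locallyLipschitz)
      (LH_lip _ (C2_fderiv hv).2.2.locallyLipschitz) (LH_lip _ hF)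
  obtain ⟨K, hK0, hB, hK⟩ := LH_single hLH (gg_supp h0 v _ F)
  exact hold_continuous hK

lemma gg_D1 {θ r : ℝ} (hθ : 1 < θ) {χ : EE m → ℝ} (hχ : ContDiff ℝ 3 χ)
    (h0 : ∀ x, r < ‖x‖ → χ =ᶠ[𝓝 x] fun _ => 0) {v F : EE m → ℝ} (hv : ContDiff ℝ 2 v)
    (hF : LocallyLipschitz F)
    (heq : ∀ x, - (1/2) * Lc v x + (1/θ) * ‖fderiv ℝ v x‖ ^ θ = F x) {B : ℝ}
    (hB : ∀ x, |gg θ χ v (fderiv ℝ v) F x| ≤ B) {x : EE m} (hx : χ =ᶠ[𝓝 x] fun _ => 1) :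
    fderiv ℝ v x = D1 (gg θ χ v (fderiv ℝ v) F) x := by
  have h1 := Rop_hasFDerivAt (gg_cont1 hθ hχ h0 hv hF) hB x
  rw [← gg_repr hθ hχ h0 hv hF heq] at h1
  have h2 : v =ᶠ[𝓝 x] fun x => χ x * v x := by
    filter_upwards [hx] with y hy
    simp [hy]
  exact (h1.congr_of_eventuallyEq h2).fderiv

theorem limit_thm {θ : ℝ} (hθ : 1 < θ) (l : Ultrafilter ι) {v F : ι → EE m → ℝ} {Fl : EE m → ℝ}
    (hv : ∀ i, ContDiff ℝ 2 (v i)) (hF : ∀ i, LocallyLipschitz (F i))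
    (heq : ∀ i x, - (1/2) * Lc (v i) x + (1/θ) * ‖fderiv ℝ (v i) x‖ ^ θ = F i x)
    (hbd : ∀ R : ℝ, ∃ B, 0 ≤ B ∧ ∀ᶠ i in (l : Filter ι), ∀ x, ‖x‖ ≤ R →
      |v i x| ≤ B ∧ ‖fderiv ℝ (v i) x‖ ≤ B)
    (hFLH : LH (l : Filter ι) F) (hFl : ∀ x, Tendsto (fun i => F i x) l (𝓝 (Fl x))) :
    ∃ w : EE m → ℝ, ContDiff ℝ 2 w ∧ (∀ x, Tendsto (fun i => v i x) l (𝓝 (w x))) ∧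
      ∀ x, - (1/2) * Lc w x + (1/θ) * ‖fderiv ℝ w x‖ ^ θ = Fl x := by
  have hvLH := LH_of_grad hv hbd
  have hPLH : LH (l : Filter ι) (fun i => fderiv ℝ (v i)) := by
    intro R
    obtain ⟨χ, hχ, hχ1, hχ0⟩ := bump_exists m (R := |R| + 1) (by positivity)
    obtain ⟨B1, hB10, hB1⟩ := hbd (|R| + 1 + 1)
    obtain ⟨B2, hB20, hB2⟩ := hFLH (|R| + 1 + 1)
    obtain ⟨B, hB0, hB⟩ := gg_bound (B0 := B1 + B2) hθ (by positivity) hχ hχ0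
    have hCR := (CR_parts m).1
    refine ⟨B1 + CR m * B, by positivity, ?_⟩
    filter_upwards [hB1, hB2] with i h1 h2
    have hg := hB (v i) (F i) (fderiv ℝ (v i)) (fun x hx =>
      ⟨(h1 x hx).1.trans (by linarith), (h2.1 x hx).trans (by linarith), (h1 x hx).2.trans (by linarith)⟩)
    have hR := le_abs_self R
    refine ⟨fun x hx => ?_, fun x y hx hy => ?_⟩
    · have := (h1 x (by linarith)).2
      have h3 : 0 ≤ CR m * B := by positivity
      linarith
    · rw [gg_D1 hθ hχ hχ0 (hv i) (hF i) (heq i) hg (hχ1 x (by linarith)),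
        gg_D1 hθ hχ hχ0 (hv i) (hF i) (heq i) hg (hχ1 y (by linarith))]
      refine (D1_holder (gg_cont1 hθ hχ hχ0 (hv i) (hF i)) hg x y).trans ?_
      have : 0 ≤ B1 * √‖x - y‖ := by positivity
      linarith
  have hw : ∀ x, ∃ a, Tendsto (fun i => v i x) l (𝓝 a) := fun x => by
    obtain ⟨B, -, hB⟩ := hbd ‖x‖
    exact ultra_lim l (hB.mono fun i hi => (hi x le_rfl).1)
  have : ProperSpace (ED m) := FiniteDimensional.proper ℝ _
  have hP : ∀ x, ∃ a, Tendsto (fun i => fderiv ℝ (v i) x) l (𝓝 a) := fun x => by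
    obtain ⟨B, -, hB⟩ := hbd ‖x‖
    exact ultra_lim l (hB.mono fun i hi => (hi x le_rfl).2)
  choose w hw using hw
  choose P hP using hP
  have main : ∀ x0, ContDiffAt ℝ 2 w x0 ∧ - (1/2) * Lc w x0 + (1/θ) * ‖fderiv ℝ w x0‖ ^ θ = Fl x0 := by
    intro x0
    obtain ⟨χ, hχ, hχ1, hχ0⟩ := bump_exists m (R := ‖x0‖ + 1) (by positivity)
    have hx1 := hχ1 x0 (by linarith)
    set g := gg θ χ w P Fl with hgdef
    have hlim : ∀ x, Tendsto (fun i => gg θ χ (v i) (fderiv ℝ (v i)) (F i) x) l (𝓝 (g x)) := by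
      intro x
      have hn : Tendsto (fun i => ‖fderiv ℝ (v i) x‖ ^ θ) l (𝓝 (‖P x‖ ^ θ)) :=
        (hP x).norm.rpow_const (Or.inr (by linarith))
      refine (((((hw x).const_mul _).add (((hFl x).add ((hn.const_mul _).const_mul _)).const_mul _)).add
        (((hw x).const_mul _).const_mul _)).add (Tendsto.const_mul _ (tendsto_finsetSum _ fun k _ =>
          Tendsto.const_mul _ ?_)))
      exact (((ContinuousLinearMap.apply ℝ ℝ (EuclideanSpace.single k (1:ℝ) : EE m)).continuous.tendsto _).comp (hP x))
    have hLHg := gg_LH hθ hχ hvLH hPLH hFLH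
    have hsupp : ∀ i x, ‖x0‖ + 1 + 1 < ‖x‖ → gg θ χ (v i) (fderiv ℝ (v i)) (F i) x = 0 :=
      fun i => gg_supp hχ0 _ _ _
    obtain ⟨K, hK0, hK⟩ := LH_global hLHg hsupp
    have hLHl : LH (pure ()) (fun _ : Unit => g) := LH_limit hLHg hlim _
    obtain ⟨K1, hK10, hgB, hgK⟩ := LH_single hLHl (gg_supp hχ0 _ _ _)
    have hgc := hold_continuous hgK
    have hCR := (CR_parts m).1
    have hdiff : ∀ ε > 0, ∀ᶠ i in (l : Filter ι), ∀ x,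
        |Rop (gg θ χ (v i) (fderiv ℝ (v i)) (F i)) x - Rop g x| ≤ CR m * ε ∧
        ‖D1 (gg θ χ (v i) (fderiv ℝ (v i)) (F i)) x - D1 g x‖ ≤ CR m * ε := by
      intro ε hε
      filter_upwards [unif_conv hK0 (hK.mono fun i hi => hi.2) hsupp hlim hε, hK] with i h1 h2 x
      have hc := gg_cont1 hθ hχ hχ0 (hv i) (hF i)
      rw [← Rop_sub hc h2.1 hgc hgB x, ← D1_sub hc h2.1 hgc hgB x]
      exact ⟨Rop_bound h1 x, D1_bound h1 x⟩
    have hR : (fun x => χ x * w x) = Rop g := by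
      ext x
      refine tendsto_nhds_unique ((hw x).const_mul (χ x)) ?_
      rw [Metric.tendsto_nhds]
      intro ε hε
      filter_upwards [hdiff (ε / (2 * CR m)) (by positivity)] with i hi
      have := (hi x).1
      rw [← congrFun (gg_repr hθ hχ hχ0 (hv i) (hF i) (heq i)) x] at this
      rw [Real.dist_eq]
      refine this.trans_lt ?_
      rw [show CR m * (ε / (2 * CR m)) = ε / 2 by field_simp]
      linarith
    have hD : D1 g x0 = P x0 := by
      refine tendsto_nhds_unique ?_ (hP x0)
      rw [Metric.tendsto_nhds]
      intro ε hε
      filter_upwards [hdiff (ε / (2 * CR m)) (by positivity), hK] with i hi h2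
      have := (hi x0).2
      rw [← gg_D1 hθ hχ hχ0 (hv i) (hF i) (heq i) h2.1 hx1] at this
      rw [dist_eq_norm]
      refine this.trans_lt ?_
      rw [show CR m * (ε / (2 * CR m)) = ε / 2 by field_simp]
      linarith
    have hloc : w =ᶠ[𝓝 x0] Rop g := by
      filter_upwards [hx1] with y hy
      rw [← congrFun hR y, hy, one_mul]
    refine ⟨(Rop_contDiff hgc hgB hK10 hgK).contDiffAt.congr_of_eventuallyEq hloc, ?_⟩
    have e1 := Rop_eq hgc hgB hK10 hgK x0
    rw [hloc.fderiv_eq, (Rop_hasFDerivAt hgc hgB x0).fderiv, hD, Lc_congr hloc]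
    rw [← hloc.self_of_nhds, hgdef, gg_one hx1] at e1
    linarith
  exact ⟨w, contDiff_iff_contDiffAt.2 fun x => (main x).1, hw, fun x => (main x).2⟩
end

open Filter
open scoped Topology
set_option maxSynthPendingDepth 3

section
open Set
variable {m : ℕ}

lemma locLip_sub {f g : EE m → ℝ} (hf : LocallyLipschitz f) (hg : LocallyLipschitz g) :
    LocallyLipschitz (fun x => f x - g x) := by
  intro x
  obtain ⟨K, s, hs, h1⟩ := hf x
  obtain ⟨L, t, ht, h2⟩ := hg x
  exact ⟨K + L, s ∩ t, inter_mem hs ht,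
    (h1.mono inter_subset_left).sub (h2.mono inter_subset_right)⟩

lemma min_contr (a b n : ℝ) : |min a n - min b n| ≤ |a - b| := by
  simpa using abs_min_sub_min_le_max a n b n

lemma lip_ball {f : EE m → ℝ} (hf : LocallyLipschitz f) (R : ℝ) :
    ∃ K : ℝ, 0 ≤ K ∧ ∀ x y, ‖x‖ ≤ R → ‖y‖ ≤ R → |f x - f y| ≤ K * ‖x - y‖ := by
  obtain ⟨K, hK⟩ := LocallyLipschitzOn.exists_lipschitzOnWith_of_compact
    (isCompact_closedBall (0 : EE m) R) (hf.locallyLipschitzOn)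
  exact ⟨K, K.2, fun x y hx hy => hK.norm_sub_le (by simpa using hx) (by simpa using hy)⟩

lemma coer_ball {f : EE m → ℝ} (hc : Coercive f) (n : ℝ) : ∃ r : ℝ, 0 < r ∧ ∀ x, r < ‖x‖ → n < f x := by
  have h := hc.eventually (eventually_gt_atTop n)
  rw [← Metric.cobounded_eq_cocompact, Metric.hasBasis_cobounded_compl_closedBall (0 : EE m) |>.eventually_iff] at h
  obtain ⟨r, -, hr⟩ := h
  exact ⟨max r 1, by positivity, fun x hx => hr (by
    simp only [mem_compl_iff, Metric.mem_closedBall, dist_zero_right, not_le]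
    exact (le_max_left _ _).trans_lt hx)⟩

lemma trunc_lip {f : EE m → ℝ} (hf : LocallyLipschitz f) (hc : Coercive f) (h0 : ∀ x, 0 ≤ f x)
    {n : ℝ} (hn : 0 ≤ n) : ∃ L : ℝ, 0 ≤ L ∧ ∀ x y, |min (f x) n - min (f y) n| ≤ L * ‖x - y‖ := by
  obtain ⟨r, hr0, hr⟩ := coer_ball hc n
  obtain ⟨K, hK0, hK⟩ := lip_ball hf (r + 1)
  have hb : ∀ x, 0 ≤ min (f x) n ∧ min (f x) n ≤ n := fun x => ⟨le_min (h0 x) hn, min_le_right _ _⟩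
  have hout : ∀ x, r < ‖x‖ → min (f x) n = n := fun x hx => min_eq_right (hr x hx).le
  have key : ∀ x y, r + 1 < ‖y‖ → |min (f x) n - min (f y) n| ≤ (K + n) * ‖x - y‖ := fun x y hy => by
    rcases le_or_gt ‖x‖ r with hx | hx
    · have : 1 ≤ ‖x - y‖ := by
        have := norm_sub_norm_le y x
        rw [norm_sub_rev] at this
        linarith
      have h1 : |min (f x) n - min (f y) n| ≤ n := by
        rw [abs_le]; have := hb x; have := hb y; constructor <;> linarith
      nlinarith
    · rw [hout x hx, hout y (by linarith), sub_self, abs_zero]; positivity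
  refine ⟨K + n, by positivity, fun x y => ?_⟩
  rcases le_or_gt ‖y‖ (r + 1) with hy | hy
  · rcases le_or_gt ‖x‖ (r + 1) with hx | hx
    · refine (min_contr _ _ _).trans ((hK x y hx hy).trans ?_)
      gcongr; linarith
    · rw [abs_sub_comm, norm_sub_rev]; exact key y x hx
  · exact key x y hy

lemma min_principle {θ ρ B η : ℝ} (hθ : 1 < θ) {u F : EE m → ℝ} (hu : ContDiff ℝ 2 u)
    (hB : ∀ x, |u x| ≤ B) (heq : ∀ x, ρ * u x - 1/2 * Lc u x + (1/θ) * ‖fderiv ℝ u x‖ ^ θ = F x)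
    (hη : 0 < η) (hη1 : η ≤ 1) (x0 : EE m) : ∃ x, u x ≤ u x0 ∧ F x ≤ ρ * u x + 2 * η := by
  have h1 : ContDiff ℝ 2 (fun y => (0:ℝ) - u y) := contDiff_const.sub hu
  obtain ⟨x, a1, a2, a3⟩ := approx_max h1 (B := B) (fun x => by have := abs_le.1 (hB x); linarith) x0 hη
  obtain ⟨b1, b2⟩ := Lc_sub (contDiff_const (c := (0:ℝ))) hu x
  rw [b1] at a2
  rw [b2, Lc_const] at a3
  have e : ‖fderiv ℝ u x‖ ≤ η := by simpa using a2
  have e2 : ‖fderiv ℝ u x‖ ^ θ ≤ η := by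
    calc _ ≤ η ^ θ := Real.rpow_le_rpow (norm_nonneg _) e (by linarith)
      _ ≤ η ^ (1:ℝ) := Real.rpow_le_rpow_of_exponent_ge hη hη1 hθ.le
      _ = η := Real.rpow_one _
  have e3 : (1/θ) * ‖fderiv ℝ u x‖ ^ θ ≤ 1 * η := by
    gcongr
    rw [div_le_one (by linarith)]; exact hθ.le
  refine ⟨x, by linarith, ?_⟩
  have := heq x
  linarith

lemma u_nonneg {θ ρ B : ℝ} (hθ : 1 < θ) (hρ : 0 < ρ) {u F : EE m → ℝ} (hu : ContDiff ℝ 2 u)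
    (hB : ∀ x, |u x| ≤ B) (heq : ∀ x, ρ * u x - 1/2 * Lc u x + (1/θ) * ‖fderiv ℝ u x‖ ^ θ = F x)
    (hF : ∀ x, 0 ≤ F x) (x0 : EE m) : 0 ≤ u x0 := by
  by_contra hneg
  push Not at hneg
  have hp : 0 < -(ρ * u x0) := by nlinarith
  obtain ⟨x, h1, h2⟩ := min_principle hθ hu hB heq (η := min 1 (-(ρ * u x0) / 4)) (by positivity)
    (min_le_left _ _) x0
  have h3 := min_le_right 1 (-(ρ * u x0) / 4)
  have h4 : ρ * u x ≤ ρ * u x0 := by gcongr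
  have := hF x
  linarith

/-- bound for rho u(0) -/
lemma rho_u0 {θ ρ C C0 : ℝ} (hθ : 1 < θ) (hρ : 0 < ρ) {u F : EE m → ℝ} (hu : ContDiff ℝ 2 u)
    (heq : ∀ x, ρ * u x - 1/2 * Lc u x + (1/θ) * ‖fderiv ℝ u x‖ ^ θ = F x)
    (hC : ∀ x, ‖x‖ ≤ 1 → ‖fderiv ℝ u x‖ ≤ C) (hC0 : ∀ x, ‖x‖ ≤ 1 → F x ≤ C0) :
    ρ * u 0 ≤ C0 + (C + 1) * m := by
  have hCn : 0 ≤ C := (norm_nonneg _).trans (hC 0 (by simp))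
  obtain ⟨h1, h2, -⟩ := C2_fderiv hu
  set ψ : EE m → ℝ := fun x => u x - (C + 1) * ‖x‖ ^ 2 with hψ
  have hψd : ∀ x, HasFDerivAt ψ (fderiv ℝ u x - (C + 1) • ((2:ℝ) • inSL m x)) x := fun x =>
    (h1 x).sub ((hasFDerivAt_nsq x).const_mul (C + 1))
  have hψd2 : ∀ x, HasFDerivAt (fun x => fderiv ℝ u x - (C + 1) • ((2:ℝ) • inSL m x))
      (fderiv ℝ (fderiv ℝ u) x - (C + 1) • ((2:ℝ) • inSL m)) x := fun x =>
    (h2 x).fun_sub (((inSL m).hasFDerivAt (x := x) |>.const_smul (2:ℝ)).const_smul (C + 1))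
  have hψc : Continuous ψ := continuous_iff_continuousAt.2 fun x => (hψd x).continuousAt
  obtain ⟨x1, hx1, hmax⟩ := (isCompact_closedBall (0 : EE m) 1).exists_isMaxOn
    ⟨0, by simp⟩ hψc.continuousOn
  have hx1' : ‖x1‖ ≤ 1 := by simpa using hx1
  have h01 : u 0 ≤ u x1 - (C + 1) * ‖x1‖ ^ 2 := by
    have := hmax (by simp : (0 : EE m) ∈ Metric.closedBall 0 1)
    simpa [hψ] using this
  have hgrow : ‖u x1 - u 0‖ ≤ C * ‖x1 - 0‖ :=
    (convex_closedBall (0 : EE m) 1).norm_image_sub_le_of_norm_fderiv_le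
      (fun z _ => (h1 z).differentiableAt) (fun z hz => hC z (by simpa using hz))
      (by simp) hx1
  rw [sub_zero, Real.norm_eq_abs] at hgrow
  have hlt : ‖x1‖ < 1 := by
    rcases hx1'.lt_or_eq with h | h
    · exact h
    · rw [h] at hgrow h01
      have := abs_le.1 hgrow
      linarith
  have hloc : IsLocalMax ψ x1 := hmax.isLocalMax
    (mem_of_superset (Metric.isOpen_ball.mem_nhds (by simpa using hlt : x1 ∈ Metric.ball 0 1))
      Metric.ball_subset_closedBall)
  obtain ⟨-, hS⟩ := max_jet (Eventually.of_forall hψd) (hψd2 x1) hloc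
  have htr := trc_le (fderiv ℝ (fderiv ℝ u) x1 - (C + 1) • ((2:ℝ) • inSL m)) 0
    (fun a => by rw [zero_mul]; exact hS a)
  rw [trc_sub, trc_smul, trc_smul, trc_inSL, mul_zero] at htr
  have hL : Lc u x1 ≤ 2 * ((C + 1) * m) := by unfold Lc; linarith
  have hH : 0 ≤ (1/θ) * ‖fderiv ℝ u x1‖ ^ θ := by positivity
  have h3 := heq x1
  have h4 := hC0 x1 hx1'
  have h5 : u 0 ≤ u x1 := by
    have : 0 ≤ (C + 1) * ‖x1‖ ^ 2 := by positivity
    linarith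
  have h6 : ρ * u 0 ≤ ρ * u x1 := by gcongr
  linarith

lemma LH_bdconst {ι : Type*} {l : Filter ι} {a : ι → ℝ} {B : ℝ} (h : ∀ i, |a i| ≤ B) (hB : 0 ≤ B) :
    LH l (fun i (_ : EE m) => a i) := fun _ =>
  ⟨B, hB, Eventually.of_forall fun i => ⟨fun _ _ => h i, fun x y _ _ => by
    rw [sub_self, norm_zero]; positivity⟩⟩

theorem main_nonneg {θ : ℝ} (hθ : 1 < θ) {f : EE m → ℝ} (hf : LocallyLipschitz f) (hc : Coercive f)
    (h0 : ∀ x, 0 ≤ f x) : ∃ (lam : ℝ) (w : EE m → ℝ), ContDiff ℝ 2 w ∧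
      (∀ x, -(1/2) * Lc w x + (1/θ) * ‖fderiv ℝ w x‖ ^ θ = f x - lam) ∧ BddBelow (range w) := by
  have hθ0 : 0 < θ := by linarith
  set ρ : ℕ → ℝ := fun n => 1 / ((n:ℝ) + 1) with hρ
  have hρ0 : ∀ n, 0 < ρ n := fun n => by simp only [hρ]; positivity
  have hρ1 : ∀ n, ρ n ≤ 1 := fun n => by
    simp only [hρ]; rw [div_le_one (by positivity)]; have : (0:ℝ) ≤ n := Nat.cast_nonneg _; linarith
  have hρlim : Tendsto ρ atTop (𝓝 0) := tendsto_one_div_add_atTop_nhds_zero_nat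
  set fn : ℕ → EE m → ℝ := fun n x => min (f x) n with hfn
  have hfn0 : ∀ n x, 0 ≤ fn n x := fun n x => le_min (h0 x) (Nat.cast_nonneg n)
  have hfnle : ∀ n x, fn n x ≤ f x := fun n x => min_le_left _ _
  have hfnd : ∀ n x y, |fn n x - fn n y| ≤ |f x - f y| := fun n x y => min_contr _ _ _
  have hex : ∀ n : ℕ, ∃ u : EE m → ℝ, ContDiff ℝ 2 u ∧ (∃ Bu, ∀ x, |u x| ≤ Bu) ∧
      ∀ x, ρ n * u x - 1/2 * Lc u x + (1/θ) * ‖fderiv ℝ u x‖ ^ θ = fn n x := fun n => by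
    obtain ⟨L, hL0, hL⟩ := trunc_lip hf hc h0 (Nat.cast_nonneg n)
    refine propA (hρ0 n) hθ (B := n) (fun x => ?_) hL0 hL
    rw [abs_of_nonneg (hfn0 n x)]; exact min_le_right _ _
  choose u hu hub heq using hex
  choose Bu hBu using hub
  have hu0 : ∀ n x, 0 ≤ u n x := fun n => u_nonneg hθ (hρ0 n) (hu n) (hBu n) (heq n) (hfn0 n)
  -- gradient bounds
  have hgrad : ∀ R : ℝ, ∃ C, 0 ≤ C ∧ ∀ n x, ‖x‖ ≤ R → ‖fderiv ℝ (u n) x‖ ≤ C := by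
    intro R
    obtain ⟨K, hK0, hK⟩ := lip_ball hf (2 * (|R| + 1) + 1)
    obtain ⟨C0, hC0⟩ := (isCompact_closedBall (0 : EE m) (2 * (|R| + 1))).exists_bound_of_continuousOn
      hf.continuous.continuousOn
    obtain ⟨C, hCn, hC⟩ := grad_bound m (R := 2 * (|R| + 1)) (C0 := |C0|) hθ (by positivity) hK0 (abs_nonneg _)
    refine ⟨C, hCn, fun n x hx => ?_⟩
    refine hC (u n) (fn n) (ρ n) (hu n) (hρ0 n).le (heq n)
      (fun x y hx hy => (hfnd n x y).trans (hK x y hx hy)) (fun x hx => ?_) x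
      (by have := le_abs_self R; linarith)
    have h1 := (hC0 x (by simpa using hx))
    rw [Real.norm_eq_abs] at h1
    have h2 := hfnle n x
    have h3 := mul_nonneg (hρ0 n).le (hu0 n x)
    have h4 := le_abs_self (f x)
    have h5 := le_abs_self C0
    linarith
  -- bound on rho u(0)
  obtain ⟨Λ, hΛ0, hΛ⟩ : ∃ Λ : ℝ, 0 ≤ Λ ∧ ∀ n, ρ n * u n 0 ≤ Λ := by
    obtain ⟨C, hC0, hC⟩ := hgrad 1
    obtain ⟨b, hb⟩ := (isCompact_closedBall (0 : EE m) 1).exists_bound_of_continuousOn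
      hf.continuous.continuousOn
    have key : ∀ n, ρ n * u n 0 ≤ b + (C + 1) * m := fun n => rho_u0 hθ (hρ0 n) (hu n) (heq n) (hC n)
      (fun x hx => (hfnle n x).trans ((le_abs_self _).trans (hb x (by simpa using hx))))
    exact ⟨b + (C + 1) * m, (mul_nonneg (hρ0 0).le (hu0 0 0)).trans (key 0), key⟩
  set v : ℕ → EE m → ℝ := fun n x => u n x - u n 0 with hv
  have hvC : ∀ n, ContDiff ℝ 2 (v n) := fun n => (hu n).sub contDiff_const
  have hvd : ∀ n x, fderiv ℝ (v n) x = fderiv ℝ (u n) x ∧ Lc (v n) x = Lc (u n) x := fun n x => by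
    obtain ⟨a, b⟩ := Lc_sub (hu n) (contDiff_const (c := u n 0)) x
    rw [Lc_const, sub_zero] at b
    exact ⟨a.trans (by simp), b⟩
  have hvb : ∀ R : ℝ, 0 ≤ R → ∃ B, 0 ≤ B ∧ ∀ n x, ‖x‖ ≤ R → |v n x| ≤ B ∧ ‖fderiv ℝ (v n) x‖ ≤ B := by
    intro R hR
    obtain ⟨C, hC0, hC⟩ := hgrad R
    refine ⟨C * R + C, by positivity, fun n x hx => ?_⟩
    have h1 : ‖u n x - u n 0‖ ≤ C * ‖x - 0‖ :=
      (convex_closedBall (0 : EE m) R).norm_image_sub_le_of_norm_fderiv_le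
        (fun z _ => (hu n).differentiable (by norm_num) z) (fun z hz => hC n z (by simpa using hz))
        (by simpa using hR) (by simpa using hx)
    rw [sub_zero] at h1
    have h2 : C * ‖x‖ ≤ C * R := by gcongr
    have h3 : 0 ≤ C * R := by positivity
    constructor
    · change ‖u n x - u n 0‖ ≤ _; linarith
    · rw [(hvd n x).1]; have := hC n x hx; linarith
  set l : Ultrafilter ℕ := hyperfilter ℕ with hl
  have hle : (l : Filter ℕ) ≤ atTop := Nat.hyperfilter_le_atTop
  have hbd : ∀ R : ℝ, ∃ B, 0 ≤ B ∧ ∀ᶠ i in (l : Filter ℕ), ∀ x, ‖x‖ ≤ R →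
      |v i x| ≤ B ∧ ‖fderiv ℝ (v i) x‖ ≤ B := fun R => by
    obtain ⟨B, hB0, hB⟩ := hvb |R| (abs_nonneg _)
    exact ⟨B, hB0, Eventually.of_forall fun n x hx => hB n x (hx.trans (le_abs_self _))⟩
  have hab : ∀ n, |ρ n * u n 0| ≤ Λ := fun n => by
    rw [abs_of_nonneg (mul_nonneg (hρ0 n).le (hu0 n 0))]; exact hΛ n
  obtain ⟨lam, hlam⟩ := ultra_lim l (h := fun n => ρ n * u n 0) (Eventually.of_forall hab)
  set F : ℕ → EE m → ℝ := fun n x => fn n x + (-1) * (ρ n * u n 0 + ρ n * v n x) with hF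
  have hFe : ∀ n x, F n x = fn n x - ρ n * u n x := fun n x => by simp only [hF, hv]; ring
  have hfnLH : LH (l : Filter ℕ) fn := by
    intro R
    obtain ⟨K, hK0, hK⟩ := LH_lip (l : Filter ℕ) hf R
    refine ⟨K, hK0, hK.mono fun n hn => ⟨fun x hx => ?_, fun x y hx hy => (hfnd n x y).trans (hn.2 x y hx hy)⟩⟩
    refine le_trans ?_ (hn.1 x hx)
    rw [Real.norm_of_nonneg (hfn0 n x), Real.norm_of_nonneg (h0 x)]
    exact hfnle n x
  have hFLH : LH (l : Filter ℕ) F := LH_add hfnLH (LH_mul (LH_const _ _) (LH_add (LH_bdconst hab hΛ0)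
    (LH_mul (LH_bdconst (fun n => by rw [abs_of_pos (hρ0 n)]; exact hρ1 n) zero_le_one) (LH_of_grad hvC hbd))))
  have hFl : ∀ x, Tendsto (fun n => F n x) l (𝓝 (f x - lam)) := fun x => by
    have a1 : Tendsto (fun n => fn n x) l (𝓝 (f x)) := by
      refine Tendsto.mono_left ?_ hle
      refine tendsto_const_nhds.congr' ?_
      filter_upwards [tendsto_natCast_atTop_atTop.eventually_ge_atTop (f x)] with n hn
      exact (min_eq_left hn).symm
    have a2 : Tendsto (fun n => ρ n * v n x) l (𝓝 0) := by
      obtain ⟨B, hB0, hB⟩ := hvb ‖x‖ (norm_nonneg _)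
      refine Tendsto.mono_left ?_ hle
      refine squeeze_zero_norm (a := fun n => ρ n * B) (fun n => ?_) (by simpa using hρlim.mul_const B)
      rw [norm_mul, Real.norm_of_nonneg (hρ0 n).le]
      exact mul_le_mul_of_nonneg_left (hB n x le_rfl).1 (hρ0 n).le
    have := a1.add ((hlam.add a2).const_mul (-1))
    convert this using 2
    ring
  have hFlip : ∀ n, LocallyLipschitz (F n) := fun n => by
    have e : F n = fun x => fn n x - ρ n * u n x := funext (hFe n)
    rw [e]
    refine locLip_sub ?_ ((contDiff_const.mul (hu n)).of_le (by norm_num)).locallyLipschitz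
    obtain ⟨L, hL0, hL⟩ := trunc_lip hf hc h0 (Nat.cast_nonneg n)
    exact (LipschitzWith.of_dist_le_mul (K := ⟨L, hL0⟩) fun x y => by
      rw [dist_eq_norm, dist_eq_norm]; exact hL x y).locallyLipschitz
  obtain ⟨w, hw, hwl, hweq⟩ := limit_thm hθ l hvC hFlip (fun n x => by
    rw [(hvd n x).1, (hvd n x).2, hFe]
    have := heq n x
    linarith) hbd hFLH hFl
  refine ⟨lam, w, hw, hweq, ?_⟩
  obtain ⟨r, hr0, hr⟩ := coer_ball hc (Λ + 2)
  obtain ⟨B, hB0, hB⟩ := hvb r hr0.le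
  refine ⟨-B, ?_⟩
  rintro _ ⟨y, rfl⟩
  refine ge_of_tendsto (hwl y) ?_
  filter_upwards [hle (tendsto_natCast_atTop_atTop.eventually_gt_atTop (Λ + 2))] with n hn
  replace hn : Λ + 2 < (n:ℝ) := hn
  rcases le_or_gt (u n 0) (u n y) with h | h
  · simp only [hv]; linarith
  obtain ⟨x, h1, h2⟩ := min_principle hθ (hu n) (hBu n) (heq n) one_pos le_rfl y
  have h3 : ρ n * u n x ≤ ρ n * u n 0 := mul_le_mul_of_nonneg_left (by linarith) (hρ0 n).le
  have h4 : fn n x ≤ Λ + 2 := by have := hΛ n; linarith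
  have h5 : ‖x‖ ≤ r := by
    by_contra hcon
    push Not at hcon
    have h6 := hr x hcon
    have : Λ + 2 < fn n x := lt_min h6 hn
    linarith
  have h7 := (abs_le.1 (hB n x h5).1).1
  simp only [hv] at h7 ⊢
  linarith
end

open Filter
open scoped Topology
set_option maxSynthPendingDepth 3

theorem stmt7 (m : ℕ) (hm : 1 ≤ m) (θ : ℝ) (hθ : 1 < θ)
    (f : EuclideanSpace ℝ (Fin m) → ℝ) (hf : LocallyLipschitz f) (hcoer : Coercive f) :
    ∃ lam : ℝ, ∃ φ, IsSolution θ f lam φ ∧ BddBelow (Set.range φ) := by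
  obtain ⟨x0, hx0⟩ := hf.continuous.exists_forall_le hcoer
  obtain ⟨lam, w, h1, h2, h3⟩ := main_nonneg (f := fun x => f x - f x0) hθ
    (locLip_sub hf (LipschitzWith.const (f x0)).locallyLipschitz)
    (tendsto_atTop_add_const_right _ (-f x0) hcoer)
    (fun x => sub_nonneg.2 (hx0 x))
  refine ⟨lam + f x0, w, ⟨h1, fun y => ?_⟩, h3⟩
  rw [lap_eq_Lc, norm_gradient_eq, h2 y]
  ring
end
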